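/- Let M = S^{d_1} × ⋯ × S^{d_n} be a product of n ≥ 2 round spheres of dimensions d_i ≥ 1, with the product metric, and let N(λ) count (with multiplicity) the Laplace–Beltrami eigenvalues −λ_j² with λ_j ≤ λ. Then N(λ) = (|B_{|d|}|/(2π)^{|d|})·vol(M)·λ^{|d|} + O(λ^{|d|−1−(n−1)/(n+1)}), where |d| = d_1+⋯+d_n and |B_{|d|}| is the volume of the unit ball in ℝ^{|d|}. -/

import Mathlib

section

open MeasureTheory Set Filter Topology

/-- The Fresnel integrals from the origin are bounded by `3` on the positive axis. -/
theorem norm_fresnel_integral_zero_le_of_nonneg {b : ℝ} (hb : 0 ≤ b) :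
    ‖∫ u in (0 : ℝ)..b, Complex.exp (Complex.I * (u : ℂ) ^ 2)‖ ≤ 3 := by
  have hn : ∀ u : ℝ, ‖Complex.exp (Complex.I * (u : ℂ) ^ 2)‖ = 1 := fun u => by
    rw [Complex.norm_exp]; simp [← Complex.ofReal_pow]
  have hcont : Continuous fun u : ℝ => Complex.exp (Complex.I * (u : ℂ) ^ 2) := by fun_prop
  have hone : ∀ c : ℝ, 0 ≤ c → c ≤ 1 →
      ‖∫ u in (0 : ℝ)..c, Complex.exp (Complex.I * (u : ℂ) ^ 2)‖ ≤ 1 := fun c h0 h1 => by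
    have := intervalIntegral.norm_integral_le_of_norm_le_const (a := 0) (b := c) (C := 1)
      (f := fun u : ℝ => Complex.exp (Complex.I * (u : ℂ) ^ 2)) (fun u _ => (hn u).le)
    rw [sub_zero, abs_of_nonneg h0] at this
    linarith
  rcases le_total b 1 with h1 | h1
  · linarith [hone b hb h1]
  rw [← intervalIntegral.integral_add_adjacent_intervals (b := 1)
    (hcont.intervalIntegrable _ _) (hcont.intervalIntegrable _ _)]
  have hpos : ∀ u ∈ uIcc 1 b, 0 < u := fun u hu => by
    rw [uIcc_of_le h1] at hu; linarith [hu.1]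
  have hd : ∀ u ∈ uIcc 1 b, HasDerivAt
      (fun u : ℝ => Complex.exp (Complex.I * (u : ℂ) ^ 2) * (2 * Complex.I * u)⁻¹)
      (Complex.exp (Complex.I * (u : ℂ) ^ 2)
        - Complex.exp (Complex.I * (u : ℂ) ^ 2) * (2 * Complex.I * (u : ℂ) ^ 2)⁻¹) u := by
    intro u hu
    have hu0 : (u : ℂ) ≠ 0 := by exact_mod_cast (hpos u hu).ne'
    have h1 : HasDerivAt (fun z : ℂ => Complex.exp (Complex.I * z ^ 2) * (2 * Complex.I * z)⁻¹)
        (Complex.exp (Complex.I * (u : ℂ) ^ 2) * (Complex.I * (2 * (u : ℂ)))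
            * (2 * Complex.I * u)⁻¹
          + Complex.exp (Complex.I * (u : ℂ) ^ 2)
            * (-(2 * Complex.I * 1) / (2 * Complex.I * (u : ℂ)) ^ 2)) u := by
      refine HasDerivAt.mul ?_ ?_
      · have := ((hasDerivAt_pow 2 (u : ℂ)).const_mul Complex.I).cexp
        simpa using this
      · exact ((hasDerivAt_id (u : ℂ)).const_mul (2 * Complex.I)).inv
          (by simp [hu0])
    convert h1.comp_ofReal using 1
    have hI : Complex.I ≠ 0 := Complex.I_ne_zero
    field_simp
    ring
  have hci : ContinuousOn (fun u : ℝ =>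
      Complex.exp (Complex.I * (u : ℂ) ^ 2) * (2 * Complex.I * (u : ℂ) ^ 2)⁻¹) (uIcc 1 b) := by
    refine hcont.continuousOn.mul (ContinuousOn.inv₀ (by fun_prop) fun u hu => ?_)
    have hu0 : (u : ℂ) ≠ 0 := by exact_mod_cast (hpos u hu).ne'
    simp [hu0]
  have key := intervalIntegral.integral_eq_sub_of_hasDerivAt hd
    ((hcont.intervalIntegrable _ _).sub hci.intervalIntegrable)
  rw [intervalIntegral.integral_sub (hcont.intervalIntegrable _ _) hci.intervalIntegrable,
    sub_eq_iff_eq_add] at key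
  rw [key]
  have e1 : ‖Complex.exp (Complex.I * (b : ℂ) ^ 2) * (2 * Complex.I * (b : ℂ))⁻¹‖ ≤ 1 / 2 := by
    rw [norm_mul, hn, norm_inv]
    simp only [norm_mul, Complex.norm_I, Complex.norm_real, Complex.norm_ofNat, one_mul, mul_one]
    rw [Real.norm_of_nonneg hb, one_div]
    gcongr; linarith
  have e2 : ‖Complex.exp (Complex.I * ((1 : ℝ) : ℂ) ^ 2) * (2 * Complex.I * ((1 : ℝ) : ℂ))⁻¹‖
      ≤ 1 / 2 := by
    rw [norm_mul, hn, norm_inv]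
    simp
  have e3 : ‖∫ u in (1 : ℝ)..b,
      Complex.exp (Complex.I * (u : ℂ) ^ 2) * (2 * Complex.I * (u : ℂ) ^ 2)⁻¹‖ ≤ 1 / 2 := by
    have hint : IntervalIntegrable (fun u : ℝ => (1 / 2 : ℝ) * (u ^ 2)⁻¹) volume 1 b := by
      refine ContinuousOn.intervalIntegrable (continuousOn_const.mul
        (ContinuousOn.inv₀ (by fun_prop) fun u hu => (pow_pos (hpos u hu) 2).ne'))
    refine (intervalIntegral.norm_integral_le_of_norm_le h1 (ae_of_all _ fun u _ => ?_)
      hint).trans ?_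
    · rw [norm_mul, hn, norm_inv]
      simp [mul_comm]
    · have hF : ∀ u ∈ uIcc 1 b, HasDerivAt (fun u : ℝ => -(1 / 2 : ℝ) * u⁻¹)
          ((1 / 2 : ℝ) * (u ^ 2)⁻¹) u := fun u hu => by
        convert! (hasDerivAt_inv (hpos u hu).ne').const_mul (-(1 / 2 : ℝ)) using 1
        ring
      rw [intervalIntegral.integral_eq_sub_of_hasDerivAt hF hint]
      have : 0 ≤ b⁻¹ := inv_nonneg.2 hb
      linarith
  calc _ ≤ ‖_‖ + ‖_‖ := norm_add_le _ _
    _ ≤ 1 + ((1 / 2 + 1 / 2) + 1 / 2) := by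
        refine add_le_add (hone 1 zero_le_one le_rfl) ((norm_add_le _ _).trans
          (add_le_add ((norm_sub_le _ _).trans (add_le_add e1 e2)) e3))
    _ ≤ 3 := by norm_num

theorem norm_fresnel_integral_le (a b : ℝ) :
    ‖∫ u in a..b, Complex.exp (Complex.I * (u : ℂ) ^ 2)‖ ≤ 6 := by
  have hcont : Continuous fun u : ℝ => Complex.exp (Complex.I * (u : ℂ) ^ 2) := by fun_prop
  have h0 : ∀ c : ℝ, ‖∫ u in (0 : ℝ)..c, Complex.exp (Complex.I * (u : ℂ) ^ 2)‖ ≤ 3 := by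
    intro c
    rcases le_total 0 c with hc | hc
    · exact norm_fresnel_integral_zero_le_of_nonneg hc
    · have := norm_fresnel_integral_zero_le_of_nonneg (neg_nonneg.2 hc)
      have e := intervalIntegral.integral_comp_neg (a := c) (b := 0)
        (fun u : ℝ => Complex.exp (Complex.I * (u : ℂ) ^ 2))
      rw [neg_zero] at e
      rw [← e, intervalIntegral.integral_symm] at this
      simpa using this
  rw [← intervalIntegral.integral_interval_sub_left (a := 0) (hcont.intervalIntegrable _ _)
    (hcont.intervalIntegrable _ _)]
  linarith [norm_sub_le (∫ u in (0 : ℝ)..b, Complex.exp (Complex.I * (u : ℂ) ^ 2))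
    (∫ u in (0 : ℝ)..a, Complex.exp (Complex.I * (u : ℂ) ^ 2)), h0 a, h0 b]

/-- Uniform second-derivative bound for the phase `T t + Q / t` with weight `t ^ (-3/2)`. -/
theorem norm_integral_exp_phase_le {T Q a b : ℝ} (hT : 0 ≤ T) (hQ : 0 < Q) (ha : 0 < a)
    (hab : a ≤ b) :
    ‖∫ t in a..b, Complex.exp (Complex.I * ((T * t + Q / t : ℝ) : ℂ)) * (((t * √t)⁻¹ : ℝ) : ℂ)‖
      ≤ 12 / √Q := by
  have hpos : ∀ t ∈ uIcc a b, 0 < t := fun t ht => by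
    rw [uIcc_of_le hab] at ht; linarith [ht.1]
  have hcont : Continuous fun u : ℝ => Complex.exp (Complex.I * (u : ℂ) ^ 2) := by fun_prop
  have hdm : ∀ t ∈ uIcc a b, HasDerivAt (fun t : ℝ => √T * √t - √Q * (√t)⁻¹)
      (√T * (1 / (2 * √t)) + √Q * ((1 / 2) * (t * √t)⁻¹)) t := by
    intro t ht
    have h0 := hpos t ht
    have hs := Real.hasDerivAt_sqrt h0.ne'
    have hs0 : √t ≠ 0 := (Real.sqrt_pos.2 h0).ne'
    convert! (hs.const_mul (√T)).sub ((hs.inv hs0).const_mul (√Q)) using 1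
    rw [Real.sq_sqrt h0.le]
    field_simp
    ring
  have hdp : ∀ t ∈ uIcc a b, HasDerivAt (fun t : ℝ => √T * √t + √Q * (√t)⁻¹)
      (√T * (1 / (2 * √t)) - √Q * ((1 / 2) * (t * √t)⁻¹)) t := by
    intro t ht
    have h0 := hpos t ht
    have hs := Real.hasDerivAt_sqrt h0.ne'
    have hs0 : √t ≠ 0 := (Real.sqrt_pos.2 h0).ne'
    convert! (hs.const_mul (√T)).add ((hs.inv hs0).const_mul (√Q)) using 1
    rw [Real.sq_sqrt h0.le]
    field_simp
    ring
  have hc1 : ContinuousOn (fun t : ℝ => 1 / (2 * √t)) (uIcc a b) :=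
    ContinuousOn.div continuousOn_const (by fun_prop) fun t ht =>
      (mul_pos two_pos (Real.sqrt_pos.2 (hpos t ht))).ne'
  have hc2 : ContinuousOn (fun t : ℝ => (t * √t)⁻¹) (uIcc a b) :=
    ContinuousOn.inv₀ (by fun_prop) fun t ht =>
      (mul_pos (hpos t ht) (Real.sqrt_pos.2 (hpos t ht))).ne'
  have hcm : ContinuousOn (fun t : ℝ => √T * (1 / (2 * √t)) + √Q * ((1 / 2) * (t * √t)⁻¹))
      (uIcc a b) := by fun_prop
  have hcp : ContinuousOn (fun t : ℝ => √T * (1 / (2 * √t)) - √Q * ((1 / 2) * (t * √t)⁻¹))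
      (uIcc a b) := by fun_prop
  have em := intervalIntegral.integral_deriv_smul_comp hdm hcm hcont
  have ep := intervalIntegral.integral_deriv_smul_comp hdp hcp hcont
  have him := (hcm.smul (hcont.comp_continuousOn
    (fun t ht => (hdm t ht).continuousAt.continuousWithinAt))).intervalIntegrable (μ := volume)
  have hip := (hcp.smul (hcont.comp_continuousOn
    (fun t ht => (hdp t ht).continuousAt.continuousWithinAt))).intervalIntegrable (μ := volume)
  set w : ℂ := Complex.exp (Complex.I * ((2 * (√T * √Q) : ℝ) : ℂ)) with hw
  set w' : ℂ := Complex.exp (-(Complex.I * ((2 * (√T * √Q) : ℝ) : ℂ))) with hw'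
  have hwn : ‖w‖ = 1 := by rw [hw, mul_comm, Complex.norm_exp_ofReal_mul_I]
  have hwn' : ‖w'‖ = 1 := by
    rw [hw', Complex.norm_exp]; simp
  have hmain : (√Q : ℂ) * ∫ t in a..b,
        Complex.exp (Complex.I * ((T * t + Q / t : ℝ) : ℂ)) * (((t * √t)⁻¹ : ℝ) : ℂ)
      = w * (∫ u in (√T * √a - √Q * (√a)⁻¹)..(√T * √b - √Q * (√b)⁻¹),
          Complex.exp (Complex.I * (u : ℂ) ^ 2))
        - w' * (∫ u in (√T * √a + √Q * (√a)⁻¹)..(√T * √b + √Q * (√b)⁻¹),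
          Complex.exp (Complex.I * (u : ℂ) ^ 2)) := by
    rw [← em, ← ep, ← intervalIntegral.integral_const_mul, ← intervalIntegral.integral_const_mul,
      ← intervalIntegral.integral_const_mul]
    refine Eq.trans ?_ (intervalIntegral.integral_sub (him.const_mul w) (hip.const_mul w'))
    refine intervalIntegral.integral_congr fun t ht => ?_
    have h0 := hpos t ht
    have hs0 : √t ≠ 0 := (Real.sqrt_pos.2 h0).ne'
    have hA : (T * t + Q / t : ℝ) = 2 * (√T * √Q) + (√T * √t - √Q * (√t)⁻¹) ^ 2 := by
      have e1 : (√T * √t) ^ 2 = T * t := by rw [mul_pow, Real.sq_sqrt hT, Real.sq_sqrt h0.le]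
      have e2 : (√Q * (√t)⁻¹) ^ 2 = Q / t := by
        rw [mul_pow, inv_pow, Real.sq_sqrt hQ.le, Real.sq_sqrt h0.le, div_eq_mul_inv]
      have e3 : (√T * √t) * (√Q * (√t)⁻¹) = √T * √Q := by field_simp
      linear_combination -e1 - e2 + 2 * e3
    have hB : (T * t + Q / t : ℝ) = -(2 * (√T * √Q)) + (√T * √t + √Q * (√t)⁻¹) ^ 2 := by
      rw [hA]; field_simp; ring
    have hA' : Complex.exp (Complex.I * ((T * t + Q / t : ℝ) : ℂ))
        = w * Complex.exp (Complex.I * ((√T * √t - √Q * (√t)⁻¹ : ℝ) : ℂ) ^ 2) := by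
      rw [hw, ← Complex.exp_add, hA]; push_cast; ring_nf
    have hB' : Complex.exp (Complex.I * ((T * t + Q / t : ℝ) : ℂ))
        = w' * Complex.exp (Complex.I * ((√T * √t + √Q * (√t)⁻¹ : ℝ) : ℂ) ^ 2) := by
      rw [hw', ← Complex.exp_add, hB]; push_cast; ring_nf
    simp only [Function.comp_apply, Complex.real_smul]
    rw [mul_left_comm w, mul_left_comm w', ← hA', ← hB', ← sub_mul]
    push_cast
    ring
  have hsq : 0 < √Q := Real.sqrt_pos.2 hQ
  rw [le_div_iff₀ hsq]
  calc _ = ‖(√Q : ℂ) * ∫ t in a..b,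
        Complex.exp (Complex.I * ((T * t + Q / t : ℝ) : ℂ)) * (((t * √t)⁻¹ : ℝ) : ℂ)‖ := by
        rw [norm_mul, Complex.norm_real, Real.norm_of_nonneg hsq.le, mul_comm]
    _ ≤ 6 + 6 := by
        rw [hmain]
        refine (norm_sub_le _ _).trans (add_le_add ?_ ?_)
        · rw [norm_mul, hwn, one_mul]; exact norm_fresnel_integral_le _ _
        · rw [norm_mul, hwn', one_mul]; exact norm_fresnel_integral_le _ _
    _ = 12 := by norm_num

end

section

open MeasureTheory Set Filter Topology

/-- Integration by parts against the phase `T y + Q / y`: only the total variation of the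
amplitude enters. -/
theorem norm_integral_Ioi_exp_phase_mul_le {T Q : ℝ} (hT : 0 ≤ T) (hQ : 0 < Q)
    {h h' : ℝ → ℂ} {k : ℝ → ℝ} (hd : ∀ y, 0 < y → HasDerivAt h (h' y) y)
    (hk : IntegrableOn k (Ioi 0)) (hh' : ∀ y, 0 < y → ‖h' y‖ ≤ k y)
    (hlim : Tendsto h atTop (𝓝 0))
    (hint : IntegrableOn (fun y : ℝ => h y *
      (Complex.exp (Complex.I * ((T * y + Q / y : ℝ) : ℂ)) * (((y * √y)⁻¹ : ℝ) : ℂ))) (Ioi 0)) :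
    ‖∫ y in Ioi (0 : ℝ), h y *
      (Complex.exp (Complex.I * ((T * y + Q / y : ℝ) : ℂ)) * (((y * √y)⁻¹ : ℝ) : ℂ))‖
      ≤ 12 / √Q * ∫ y in Ioi (0 : ℝ), k y := by
  set φ : ℝ → ℂ := fun y =>
    Complex.exp (Complex.I * ((T * y + Q / y : ℝ) : ℂ)) * (((y * √y)⁻¹ : ℝ) : ℂ) with hφ
  have hφc : ContinuousOn φ (Ioi 0) := by
    have h1 : ContinuousOn (fun y : ℝ => T * y + Q / y) (Ioi 0) :=
      ContinuousOn.add (by fun_prop) (ContinuousOn.div continuousOn_const continuousOn_id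
        fun y hy => (mem_Ioi.1 hy).ne')
    have h2 : ContinuousOn (fun y : ℝ => (y * √y)⁻¹) (Ioi 0) :=
      ContinuousOn.inv₀ (by fun_prop) fun y hy => (mul_pos hy (Real.sqrt_pos.2 hy)).ne'
    exact ((continuousOn_const.mul (Complex.continuous_ofReal.comp_continuousOn h1)).cexp).mul
      (Complex.continuous_ofReal.comp_continuousOn h2)
  have hsub : ∀ a b : ℝ, 0 < a → 0 < b → uIcc a b ⊆ Ioi 0 := fun a b ha hb y hy =>
    lt_of_lt_of_le (lt_min ha hb) hy.1
  have hφi : ∀ a b : ℝ, 0 < a → 0 < b → IntervalIntegrable φ volume a b := fun a b ha hb =>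
    (hφc.mono (hsub a b ha hb)).intervalIntegrable
  have hh'i : IntegrableOn h' (Ioi 0) := by
    refine Integrable.mono' hk ?_ ?_
    · refine (aestronglyMeasurable_deriv h _).congr ?_
      filter_upwards [ae_restrict_mem measurableSet_Ioi] with y hy using (hd y hy).deriv
    · filter_upwards [ae_restrict_mem measurableSet_Ioi] with y hy using hh' y hy
  have hk0 : ∀ y, 0 < y → 0 ≤ k y := fun y hy => (norm_nonneg _).trans (hh' y hy)
  have hKpos : 0 ≤ 12 / √Q := by positivity
  have hfin : ∀ a b : ℝ, 0 < a → a ≤ b →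
      ‖∫ y in a..b, h y * φ y‖ ≤ 12 / √Q * ‖h b‖ + 12 / √Q * ∫ y in Ioi (0 : ℝ), k y := by
    intro a b ha hab
    have hb : 0 < b := ha.trans_le hab
    have hΨ : ∀ y ∈ uIcc a b, HasDerivAt (fun y => ∫ t in a..y, φ t) (φ y) y := by
      intro y hy
      have hy0 : y ∈ Ioi (0 : ℝ) := hsub a b ha hb hy
      exact intervalIntegral.integral_hasDerivAt_right (hφi a y ha hy0)
        (hφc.stronglyMeasurableAtFilter isOpen_Ioi y hy0)
        (hφc.continuousAt (isOpen_Ioi.mem_nhds hy0))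
    have hh'ab : IntervalIntegrable h' volume a b := by
      rw [intervalIntegrable_iff_integrableOn_Ioc_of_le hab]
      exact hh'i.mono_set fun y hy => ha.trans hy.1
    have hkab : IntervalIntegrable k volume a b := by
      rw [intervalIntegrable_iff_integrableOn_Ioc_of_le hab]
      exact hk.mono_set fun y hy => ha.trans hy.1
    rw [intervalIntegral.integral_mul_deriv_eq_deriv_mul
      (fun y hy => hd y (hsub a b ha hb hy)) hΨ hh'ab (hφi a b ha hb)]
    rw [intervalIntegral.integral_same, mul_zero, sub_zero]
    refine (norm_sub_le _ _).trans (add_le_add ?_ ?_)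
    · rw [norm_mul, mul_comm]
      gcongr
      exact norm_integral_exp_phase_le hT hQ ha hab
    · have h1 : ‖∫ y in a..b, h' y * ∫ t in a..y, φ t‖ ≤ ∫ y in a..b, 12 / √Q * k y := by
        refine intervalIntegral.norm_integral_le_of_norm_le hab (ae_of_all _ fun y hy => ?_)
          (hkab.const_mul _)
        rw [norm_mul, mul_comm]
        gcongr
        · exact norm_integral_exp_phase_le hT hQ ha hy.1.le
        · exact hh' y (ha.trans hy.1)
      refine h1.trans ?_
      rw [intervalIntegral.integral_const_mul, intervalIntegral.integral_of_le hab]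
      refine mul_le_mul_of_nonneg_left (setIntegral_mono_set hk ?_ ?_) hKpos
      · filter_upwards [ae_restrict_mem measurableSet_Ioi] with y hy using hk0 y hy
      · exact Eventually.of_forall fun y hy => ha.trans hy.1
  have hIoi : ∀ a : ℝ, 0 < a →
      ‖∫ y in Ioi a, h y * φ y‖ ≤ 12 / √Q * ∫ y in Ioi (0 : ℝ), k y := by
    intro a ha
    have h1 := intervalIntegral_tendsto_integral_Ioi a
      (hint.mono_set (Ioi_subset_Ioi ha.le)) tendsto_id
    have h2 : Tendsto (fun b => 12 / √Q * ‖h b‖ + 12 / √Q * ∫ y in Ioi (0 : ℝ), k y) atTop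
        (𝓝 (12 / √Q * 0 + 12 / √Q * ∫ y in Ioi (0 : ℝ), k y)) :=
      ((tendsto_norm_zero.comp hlim).const_mul _).add_const _
    rw [mul_zero, zero_add] at h2
    exact le_of_tendsto_of_tendsto h1.norm h2
      ((eventually_ge_atTop a).mono fun b hb => hfin a b ha hb)
  have hcov : AECover (volume.restrict (Ioi (0 : ℝ))) (𝓝[>] (0 : ℝ)) fun a : ℝ => Ioi a :=
    aecover_Ioi_of_Ioi (tendsto_id.mono_left nhdsWithin_le_nhds)
  have h3 := hcov.integral_tendsto_of_countably_generated hint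
  refine le_of_tendsto h3.norm ?_
  filter_upwards [self_mem_nhdsWithin] with a ha
  have ha0 : (0 : ℝ) < a := ha
  rw [Measure.restrict_restrict measurableSet_Ioi,
    inter_eq_left.2 (Ioi_subset_Ioi ha0.le)]
  exact hIoi a ha0

end

section

open MeasureTheory Set Filter Topology

theorem one_add_pow_mul_exp_neg_le (P : ℕ) {t : ℝ} (ht : 0 ≤ t) :
    (1 + t) ^ P * Real.exp (-(Real.pi ^ 2 * t ^ 2)) ≤ P.factorial * Real.exp 2 := by
  have h1 := Real.pow_div_factorial_le_exp (1 + t) (by positivity) P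
  rw [div_le_iff₀ (by positivity)] at h1
  have hpi : 1 ≤ Real.pi ^ 2 := by nlinarith [Real.pi_gt_three]
  have h2 : 1 + t + -(Real.pi ^ 2 * t ^ 2) ≤ 2 := by nlinarith [sq_nonneg t, sq_nonneg (t - 1)]
  calc (1 + t) ^ P * Real.exp (-(Real.pi ^ 2 * t ^ 2))
      ≤ (Real.exp (1 + t) * P.factorial) * Real.exp (-(Real.pi ^ 2 * t ^ 2)) := by gcongr
    _ = P.factorial * Real.exp (1 + t + -(Real.pi ^ 2 * t ^ 2)) := by
        rw [Real.exp_add (1 + t)]; ring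
    _ ≤ _ := by gcongr

theorem integral_inv_sqrt_mul_div {b : ℝ} (hb : 0 < b) :
    IntegrableOn (fun y : ℝ => (√y)⁻¹ * (b / (y + b))) (Ioi 0) ∧
      ∫ y in Ioi (0 : ℝ), (√y)⁻¹ * (b / (y + b)) = Real.pi * √b := by
  have hsb : 0 < √b := Real.sqrt_pos.2 hb
  have hd : ∀ y ∈ Ioi (0 : ℝ), HasDerivAt (fun y : ℝ => 2 * √b * Real.arctan (√y / √b))
      ((√y)⁻¹ * (b / (y + b))) y := by
    intro y hy
    have hy' : 0 < y := hy
    have hsy : 0 < √y := Real.sqrt_pos.2 hy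
    convert! (((Real.hasDerivAt_sqrt hy'.ne').div_const (√b)).arctan.const_mul (2 * √b)) using 1
    rw [div_pow, Real.sq_sqrt hy'.le, Real.sq_sqrt hb.le]
    field_simp
    ring
  have hc : ContinuousWithinAt (fun y : ℝ => 2 * √b * Real.arctan (√y / √b)) (Ici 0) 0 := by
    apply Continuous.continuousWithinAt
    fun_prop
  have hl : Tendsto (fun y : ℝ => 2 * √b * Real.arctan (√y / √b)) atTop
      (𝓝 (2 * √b * (Real.pi / 2))) := by
    refine Tendsto.const_mul _ ((Real.tendsto_arctan_atTop.mono_right nhdsWithin_le_nhds).comp ?_)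
    exact Real.tendsto_sqrt_atTop.atTop_div_const hsb
  have hpos : ∀ y ∈ Ioi (0 : ℝ), 0 ≤ (√y)⁻¹ * (b / (y + b)) := fun y hy => by
    have : 0 < y := hy
    positivity
  refine ⟨integrableOn_Ioi_deriv_of_nonneg hc hd hpos hl, ?_⟩
  rw [integral_Ioi_of_hasDerivAt_of_nonneg hc hd hpos hl]
  simp
  ring

/-- The size of the amplitudes met below, as a function of `σ = ‖s‖`. -/
noncomputable def ampl (α : ℝ) (L N : ℕ) (b Y σ : ℝ) : ℝ :=
  σ ^ (-α - 1) * (1 + b / σ) ^ L * ((1 + σ * Y) ^ N)⁻¹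

theorem ampl_nonneg {α : ℝ} {L N : ℕ} {b Y σ : ℝ} (hb : 0 ≤ b) (hY : 0 ≤ Y) (hσ : 0 ≤ σ) :
    0 ≤ ampl α L N b Y σ := by
  unfold ampl; positivity

theorem ampl_mul_le {α : ℝ} (hα : 1 ≤ α) (L N : ℕ) : ∃ C > 0, ∀ b Y σ : ℝ,
    0 < b → 0 ≤ Y → 0 < σ →
    σ * ampl α L N b Y σ * (5 / 2 + 2 * (Real.pi ^ 2 * (b / σ) ^ 2))
        * Real.exp (-(Real.pi ^ 2 * (b / σ) ^ 2))
      ≤ C * (b ^ (-α) * ((1 + b * Y) ^ N)⁻¹) * (b / (σ + b)) := by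
  set P := ⌈α⌉₊ + L + N + 3 with hP
  refine ⟨(5 / 2 + 2 * Real.pi ^ 2) * (P.factorial * Real.exp 2), by positivity, ?_⟩
  intro b Y σ hb hY hσ
  obtain ⟨t, ht⟩ : ∃ t, t = b / σ := ⟨_, rfl⟩
  have ht0 : 0 < t := by rw [ht]; positivity
  have hbt : σ = b / t := by rw [ht]; field_simp
  have e1 : σ * σ ^ (-α - 1) = b ^ (-α) * t ^ α := by
    rw [Real.rpow_sub hσ, Real.rpow_one, mul_div_cancel₀ _ hσ.ne', hbt,
      Real.div_rpow hb.le ht0.le, Real.rpow_neg ht0.le, div_inv_eq_mul]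
  have e2 : ((1 + σ * Y) ^ N)⁻¹ ≤ (1 + t) ^ N * ((1 + b * Y) ^ N)⁻¹ := by
    rw [← inv_pow, ← inv_pow, ← mul_pow]
    gcongr
    rw [inv_eq_one_div, div_le_iff₀ (by positivity), mul_assoc, ← div_eq_inv_mul, mul_div,
      le_div_iff₀ (by positivity)]
    have : t * σ = b := by rw [ht]; field_simp
    have h2 : t * (σ * Y) = b * Y := by rw [← this]; ring
    nlinarith [mul_nonneg hσ.le hY]
  have e3 : t ^ α ≤ t * (1 + t) ^ ⌈α⌉₊ := by
    calc t ^ α = t * t ^ (α - 1) := by rw [Real.rpow_sub ht0, Real.rpow_one]; field_simp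
      _ ≤ t * (1 + t) ^ (α - 1) := by
          gcongr
          · linarith
      _ ≤ t * (1 + t) ^ (⌈α⌉₊ : ℝ) := by
          gcongr
          · linarith
          · linarith [Nat.le_ceil α]
      _ = _ := by rw [Real.rpow_natCast]
  have e4 : 5 / 2 + 2 * (Real.pi ^ 2 * t ^ 2) ≤ (5 / 2 + 2 * Real.pi ^ 2) * (1 + t) ^ 2 := by
    nlinarith [sq_nonneg Real.pi, mul_nonneg (sq_nonneg Real.pi) ht0.le]
  have e5 : b / (σ + b) = t / (1 + t) := by rw [hbt]; field_simp
  rw [e5, ← ht]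
  have e6 := one_add_pow_mul_exp_neg_le P ht0.le
  have hA : 0 ≤ b ^ (-α) * ((1 + b * Y) ^ N)⁻¹ := by positivity
  calc σ * ampl α L N b Y σ * (5 / 2 + 2 * (Real.pi ^ 2 * t ^ 2))
        * Real.exp (-(Real.pi ^ 2 * t ^ 2))
      = (b ^ (-α) * t ^ α) * (1 + t) ^ L * ((1 + σ * Y) ^ N)⁻¹
        * (5 / 2 + 2 * (Real.pi ^ 2 * t ^ 2)) * Real.exp (-(Real.pi ^ 2 * t ^ 2)) := by
        rw [← e1, ampl, ← ht]; ring
    _ ≤ (b ^ (-α) * (t * (1 + t) ^ ⌈α⌉₊)) * (1 + t) ^ L * ((1 + t) ^ N * ((1 + b * Y) ^ N)⁻¹)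
        * ((5 / 2 + 2 * Real.pi ^ 2) * (1 + t) ^ 2) * Real.exp (-(Real.pi ^ 2 * t ^ 2)) := by
        gcongr
    _ = (b ^ (-α) * ((1 + b * Y) ^ N)⁻¹) * (5 / 2 + 2 * Real.pi ^ 2) * (t / (1 + t)) *
        ((1 + t) ^ P * Real.exp (-(Real.pi ^ 2 * t ^ 2))) := by
        rw [hP]; field_simp; ring
    _ ≤ (b ^ (-α) * ((1 + b * Y) ^ N)⁻¹) * (5 / 2 + 2 * Real.pi ^ 2) * (t / (1 + t)) *
        (P.factorial * Real.exp 2) := by gcongr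
    _ = _ := by ring

theorem norm_cexp_neg_div_line {c y q : ℝ} (hy : 0 < y) (s : ℂ)
    (hs : s = (c : ℂ) + Complex.I * y) :
    ‖Complex.exp (-(Complex.I * (q : ℂ)) / (s * y))‖ = Real.exp (-(q / ‖s‖ ^ 2)) := by
  have hre : s.re = c := by simp [hs]
  have him : s.im = y := by simp [hs]
  have hs0 : s ≠ 0 := by
    intro h; rw [h] at him; simp at him; linarith
  have hyC : (y : ℂ) ≠ 0 := by exact_mod_cast hy.ne'
  have hn : (‖s‖ : ℝ) ^ 2 = c ^ 2 + y ^ 2 := by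
    rw [← Complex.normSq_eq_norm_sq, Complex.normSq_apply, hre, him]; ring
  rw [Complex.norm_exp]
  congr 1
  rw [Complex.div_re, Complex.normSq_mul, Complex.normSq_ofReal, Complex.normSq_eq_norm_sq, hn]
  simp only [Complex.mul_re, Complex.mul_im, Complex.neg_re, Complex.neg_im, Complex.I_re,
    Complex.I_im, Complex.ofReal_re, Complex.ofReal_im, hre, him]
  have : 0 < c ^ 2 + y ^ 2 := by positivity
  field_simp
  ring

theorem norm_integral_osc_le {α : ℝ} (hα : 1 ≤ α) (L N : ℕ) : ∃ C > 0,
    ∀ R T Y A r : ℝ, 0 < R → 0 ≤ T → T ≤ R ^ 2 → 0 ≤ Y → 0 ≤ A → 0 < r →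
    ∀ (s : ℝ → ℂ) (a a' : ℝ → ℂ), (∀ y, s y = (((R ^ 2)⁻¹ : ℝ) : ℂ) + Complex.I * y) →
      (∀ y, 0 < y → HasDerivAt a (a' y) y) →
      (∀ y, 0 < y → ‖a y‖ ≤ A * ampl α L N (r / R) Y ‖s y‖) →
      (∀ y, 0 < y → ‖a' y‖ ≤ A * ampl α L N (r / R) Y ‖s y‖ / ‖s y‖) →
      ‖∫ y in Ioi (0 : ℝ), Complex.exp (s y * T) *
          Complex.exp (-(Real.pi ^ 2 * r ^ 2 : ℝ) / s y) * a y‖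
        ≤ C * A * (r⁻¹ * ((r / R) ^ (1 / 2 - α) * ((1 + r / R * Y) ^ N)⁻¹)) := by
  obtain ⟨C, hC, hCb⟩ := ampl_mul_le hα L N
  refine ⟨12 * Real.exp 1 * C, by positivity, ?_⟩
  intro R T Y A r hR hT hTR hY hA hr s a a' hs ha hab ha'b
  set c : ℝ := (R ^ 2)⁻¹ with hc
  set b : ℝ := r / R with hb
  have hc0 : 0 < c := by positivity
  have hb0 : 0 < b := by positivity
  have hcT : c * T ≤ 1 := by
    rw [hc, inv_mul_le_iff₀ (by positivity), mul_one]; exact hTR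
  set q : ℝ := Real.pi ^ 2 * b ^ 2 with hq
  have hsre : ∀ y, (s y).re = c := fun y => by simp [hs]
  have hsim : ∀ y, (s y).im = y := fun y => by simp [hs]
  have hsy : ∀ y, 0 < y → y ≤ ‖s y‖ := fun y hy => by
    have := Complex.abs_im_le_norm (s y)
    rwa [hsim, abs_of_pos hy] at this
  have hs0 : ∀ y, s y ≠ 0 := fun y h => by
    have := hsre y; rw [h] at this; simp at this; linarith
  have hsd : ∀ y, HasDerivAt s Complex.I y := fun y => by
    have h1 : HasDerivAt (fun y : ℝ => (c : ℂ) + Complex.I * (y : ℂ)) (Complex.I * 1) y :=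
      ((Complex.ofRealCLM.hasDerivAt (x := y)).const_mul Complex.I).const_add _
    rw [mul_one] at h1
    exact h1.congr_of_eventuallyEq (Eventually.of_forall hs)
  set w : ℝ → ℂ := fun y => -(Complex.I * (q : ℂ)) / (s y * y) with hw
  set w' : ℝ → ℂ := fun y => Complex.I * q * (s y + Complex.I * y) / (s y * y) ^ 2 with hw'
  set h : ℝ → ℂ := fun y =>
    (Real.exp (c * T) : ℂ) * (((y * √y : ℝ) : ℂ) * a y * Complex.exp (w y)) with hh
  set h' : ℝ → ℂ := fun y => (Real.exp (c * T) : ℂ) * (((3 / 2 * √y : ℝ) : ℂ) * a y +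
    ((y * √y : ℝ) : ℂ) * a' y + ((y * √y : ℝ) : ℂ) * a y * w' y) * Complex.exp (w y) with hh'
  have hwd : ∀ y, 0 < y → HasDerivAt w (w' y) y := fun y hy => by
    have hyC : (y : ℂ) ≠ 0 := by exact_mod_cast hy.ne'
    have h1 : HasDerivAt (fun y : ℝ => s y * (y : ℂ)) (Complex.I * y + s y * 1) y :=
      (hsd y).mul (Complex.ofRealCLM.hasDerivAt (x := y))
    convert! (hasDerivAt_const y (-(Complex.I * (q : ℂ)))).div h1 (mul_ne_zero (hs0 y) hyC) using 1
    simp only [hw']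
    congr 1
    ring
  have hsq : ∀ y : ℝ, 0 < y → HasDerivAt (fun y : ℝ => ((y * √y : ℝ) : ℂ))
      ((3 / 2 * √y : ℝ) : ℂ) y := fun y hy => by
    have h1 : HasDerivAt (fun y : ℝ => y * √y) (3 / 2 * √y) y := by
      convert! (hasDerivAt_id y).mul (Real.hasDerivAt_sqrt hy.ne') using 1
      have : 0 < √y := Real.sqrt_pos.2 hy
      simp only [id]
      field_simp
      rw [Real.sq_sqrt hy.le]
      ring
    exact h1.ofReal_comp
  have hd : ∀ y, 0 < y → HasDerivAt h (h' y) y := fun y hy => by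
    convert! (((hsq y hy).mul (ha y hy)).mul (hwd y hy).cexp).const_mul (Real.exp (c * T) : ℂ)
      using 1
    simp only [hh', Pi.mul_apply]
    ring
  have hew : ∀ y, 0 < y → ‖Complex.exp (w y)‖ = Real.exp (-(Real.pi ^ 2 * (b / ‖s y‖) ^ 2)) :=
    fun y hy => by
    rw [hw]
    simp only
    rw [norm_cexp_neg_div_line hy (s y) (hs y), hq, mul_div_assoc, ← div_pow]
  set B : ℝ := b ^ (-α) * ((1 + b * Y) ^ N)⁻¹ with hB
  have hB0 : 0 ≤ B := by positivity
  have hecT : Real.exp (c * T) ≤ Real.exp 1 := Real.exp_le_exp.2 hcT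
  set k : ℝ → ℝ := fun y => Real.exp 1 * A * (C * B) * ((√y)⁻¹ * (b / (y + b))) with hk
  have hmain : ∀ y, 0 < y → Real.exp 1 * (A * ampl α L N b Y ‖s y‖) * ‖s y‖ *
      (5 / 2 + 2 * (Real.pi ^ 2 * (b / ‖s y‖) ^ 2)) * Real.exp (-(Real.pi ^ 2 * (b / ‖s y‖) ^ 2))
      ≤ Real.exp 1 * A * (C * B) * (b / (‖s y‖ + b)) := fun y hy => by
    have := hCb b Y ‖s y‖ hb0 hY (norm_pos_iff.2 (hs0 y))
    calc _ = Real.exp 1 * A * (‖s y‖ * ampl α L N b Y ‖s y‖ *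
        (5 / 2 + 2 * (Real.pi ^ 2 * (b / ‖s y‖) ^ 2)) *
          Real.exp (-(Real.pi ^ 2 * (b / ‖s y‖) ^ 2))) := by ring
      _ ≤ Real.exp 1 * A * (C * B * (b / (‖s y‖ + b))) := by gcongr
      _ = _ := by ring
  have hh'b : ∀ y, 0 < y → ‖h' y‖ ≤ k y := fun y hy => by
    have hσ : 0 < ‖s y‖ := norm_pos_iff.2 (hs0 y)
    have hq0 : 0 ≤ q := by positivity
    have hyσ := hsy y hy
    obtain ⟨v, hv, rfl⟩ : ∃ v : ℝ, 0 < v ∧ y = v ^ 2 :=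
      ⟨√y, Real.sqrt_pos.2 hy, (Real.sq_sqrt hy.le).symm⟩
    obtain ⟨σ, hσe⟩ : ∃ σ, σ = ‖s (v ^ 2)‖ := ⟨_, rfl⟩
    have hA0 := mul_nonneg hA (ampl_nonneg (α := α) (L := L) (N := N) hb0.le hY hσ.le)
    have hm := hmain _ hy
    have hab' := hab _ hy
    have hab'' := ha'b _ hy
    rw [← hσe] at hm hab' hab'' hσ hyσ hA0
    have hw'b : ‖w' (v ^ 2)‖ ≤ 2 * q / (σ * v ^ 4) := by
      simp only [hw']
      rw [norm_div, norm_mul, norm_mul, norm_pow, norm_mul, ← hσe]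
      simp only [Complex.norm_I, one_mul, Complex.norm_real, Real.norm_eq_abs, abs_of_nonneg hq0,
        abs_of_pos hy]
      rw [div_le_div_iff₀ (by positivity) (by positivity)]
      have h1 : ‖s (v ^ 2) + Complex.I * ((v ^ 2 : ℝ) : ℂ)‖ ≤ 2 * σ := by
        refine (norm_add_le _ _).trans ?_
        rw [norm_mul, Complex.norm_I, one_mul, Complex.norm_real, Real.norm_eq_abs,
          abs_of_pos hy, ← hσe]
        linarith
      calc _ ≤ q * (2 * σ) * (σ * v ^ 4) := by gcongr
        _ = _ := by ring
    have hsqrt : √(v ^ 2) = v := Real.sqrt_sq hv.le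
    simp only [hh', hk]
    rw [norm_mul, hew _ hy, norm_mul, ← hσe, Complex.norm_real, Real.norm_eq_abs,
      abs_of_pos (Real.exp_pos _), hsqrt]
    set Ψ := A * ampl α L N b Y σ with hΨ
    have hin : ‖((3 / 2 * v : ℝ) : ℂ) * a (v ^ 2) + ((v ^ 2 * v : ℝ) : ℂ) * a' (v ^ 2) +
        ((v ^ 2 * v : ℝ) : ℂ) * a (v ^ 2) * w' (v ^ 2)‖ ≤
        v⁻¹ * (Ψ * σ * (5 / 2 + 2 * (Real.pi ^ 2 * (b / σ) ^ 2))) := by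
      refine (norm_add₃_le).trans ?_
      simp only [norm_mul, Complex.norm_real, Real.norm_eq_abs]
      rw [abs_of_pos (by norm_num : (0 : ℝ) < 3 / 2), abs_of_pos hv, abs_of_pos hy]
      have e1 : 3 / 2 * v * ‖a (v ^ 2)‖ ≤ 3 / 2 * (v⁻¹ * (Ψ * σ)) := by
        calc 3 / 2 * v * ‖a (v ^ 2)‖ ≤ 3 / 2 * v * Ψ := by gcongr
          _ = 3 / 2 * (v⁻¹ * (Ψ * v ^ 2)) := by field_simp
          _ ≤ _ := by gcongr
      have e2 : v ^ 2 * v * ‖a' (v ^ 2)‖ ≤ v⁻¹ * (Ψ * σ) := by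
        calc v ^ 2 * v * ‖a' (v ^ 2)‖ ≤ v ^ 2 * v * (Ψ / σ) := by gcongr
          _ = v⁻¹ * (Ψ * (v ^ 2 * v ^ 2 / σ)) := by field_simp
          _ ≤ v⁻¹ * (Ψ * (σ * σ / σ)) := by gcongr
          _ = _ := by field_simp
      have e3 : v ^ 2 * v * ‖a (v ^ 2)‖ * ‖w' (v ^ 2)‖ ≤
          v⁻¹ * (Ψ * σ * (2 * (Real.pi ^ 2 * (b / σ) ^ 2))) := by
        calc _ ≤ v ^ 2 * v * Ψ * (2 * q / (σ * v ^ 4)) := by gcongr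
          _ = _ := by rw [hq]; field_simp
      linarith
    have hvy : b / (σ + b) ≤ b / (v ^ 2 + b) := by gcongr
    calc _ ≤ Real.exp 1 * (v⁻¹ * (Ψ * σ * (5 / 2 + 2 * (Real.pi ^ 2 * (b / σ) ^ 2)))) *
          Real.exp (-(Real.pi ^ 2 * (b / σ) ^ 2)) := by gcongr
      _ = v⁻¹ * (Real.exp 1 * Ψ * σ * (5 / 2 + 2 * (Real.pi ^ 2 * (b / σ) ^ 2)) *
          Real.exp (-(Real.pi ^ 2 * (b / σ) ^ 2))) := by ring
      _ ≤ v⁻¹ * (Real.exp 1 * A * (C * B) * (b / (σ + b))) := by gcongr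
      _ ≤ v⁻¹ * (Real.exp 1 * A * (C * B) * (b / (v ^ 2 + b))) := by gcongr
      _ = _ := by ring
  have hhb : ∀ y, 0 < y → ‖h y‖ ≤ Real.exp 1 * A * (C * B) * (y * √y) * (b / (‖s y‖ * ‖s y‖)) :=
    fun y hy => by
    have hσ : 0 < ‖s y‖ := norm_pos_iff.2 (hs0 y)
    have hA0 := mul_nonneg hA (ampl_nonneg (α := α) (L := L) (N := N) hb0.le hY hσ.le)
    have hm := hmain _ hy
    have hab' := hab _ hy
    have hy3 : 0 < y * √y := mul_pos hy (Real.sqrt_pos.2 hy)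
    simp only [hh]
    rw [norm_mul, norm_mul, norm_mul, hew y hy, Complex.norm_real, Complex.norm_real,
      Real.norm_eq_abs, Real.norm_eq_abs, abs_of_pos (Real.exp_pos _), abs_of_pos hy3]
    set E := Real.exp (-(Real.pi ^ 2 * (b / ‖s y‖) ^ 2)) with hE
    have hE0 : 0 < E := Real.exp_pos _
    set Ψ := A * ampl α L N b Y ‖s y‖ with hΨ
    set X := Real.pi ^ 2 * (b / ‖s y‖) ^ 2 with hX
    have hX0 : 0 ≤ X := by positivity
    have h1 : Real.exp 1 * Ψ * ‖s y‖ * 1 * E ≤ Real.exp 1 * Ψ * ‖s y‖ * (5 / 2 + 2 * X) * E := by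
      gcongr; linarith
    have h2 : Real.exp 1 * A * (C * B) * (b / (‖s y‖ + b)) ≤
        Real.exp 1 * A * (C * B) * (b / ‖s y‖) := by
      gcongr; linarith
    calc Real.exp (c * T) * (y * √y * ‖a y‖ * E) ≤ Real.exp 1 * (y * √y * Ψ * E) := by gcongr
      _ = (y * √y) * (Real.exp 1 * Ψ * ‖s y‖ * 1 * E) / ‖s y‖ := by field_simp
      _ ≤ (y * √y) * (Real.exp 1 * A * (C * B) * (b / ‖s y‖)) / ‖s y‖ := by
          exact div_le_div_of_nonneg_right
            (mul_le_mul_of_nonneg_left (h1.trans (hm.trans h2)) hy3.le) hσ.le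
      _ = _ := by field_simp
  have hlim : Tendsto h atTop (𝓝 0) := by
    have h1 : Tendsto (fun y : ℝ => Real.exp 1 * A * (C * B) * b * (√y)⁻¹) atTop
        (𝓝 (Real.exp 1 * A * (C * B) * b * 0)) :=
      (tendsto_inv_atTop_zero.comp Real.tendsto_sqrt_atTop).const_mul _
    rw [mul_zero] at h1
    refine squeeze_zero_norm' ?_ h1
    filter_upwards [eventually_gt_atTop 0] with y hy
    refine (hhb y hy).trans ?_
    have hσ : 0 < ‖s y‖ := norm_pos_iff.2 (hs0 y)
    have hs1 : 0 < √y := Real.sqrt_pos.2 hy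
    calc _ ≤ Real.exp 1 * A * (C * B) * (y * √y) * (b / (y * y)) := by
          gcongr <;> exact hsy y hy
      _ = Real.exp 1 * A * (C * B) * b * (√y / y) := by field_simp
      _ = _ := by
          congr 1
          rw [div_eq_iff hy.ne']
          nth_rewrite 3 [← Real.sq_sqrt hy.le]
          field_simp
  have hφn : ∀ y, 0 < y → ‖Complex.exp (Complex.I * ((T * y + Real.pi ^ 2 * r ^ 2 / y : ℝ) : ℂ)) *
      (((y * √y)⁻¹ : ℝ) : ℂ)‖ = (y * √y)⁻¹ := fun y hy => by
    have hy3 : 0 < y * √y := mul_pos hy (Real.sqrt_pos.2 hy)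
    rw [norm_mul, mul_comm Complex.I, Complex.norm_exp_ofReal_mul_I, one_mul, Complex.norm_real,
      Real.norm_eq_abs, abs_of_pos (by positivity)]
  have hcs : Continuous s := continuous_iff_continuousAt.2 fun y => (hsd y).continuousAt
  have hint : IntegrableOn (fun y : ℝ => h y *
      (Complex.exp (Complex.I * ((T * y + Real.pi ^ 2 * r ^ 2 / y : ℝ) : ℂ)) *
        (((y * √y)⁻¹ : ℝ) : ℂ))) (Ioi 0) := by
    have hg : Integrable fun y : ℝ => Real.exp 1 * A * (C * B) * b / c ^ 2 *
        (1 + (y * c⁻¹) ^ 2)⁻¹ :=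
      ((integrable_inv_one_add_sq ).comp_mul_right' (inv_ne_zero hc0.ne')).const_mul _
    refine Integrable.mono' hg.integrableOn ?_ ?_
    · refine ContinuousOn.aestronglyMeasurable ?_ measurableSet_Ioi
      have h1 : ContinuousOn (fun y : ℝ => T * y + Real.pi ^ 2 * r ^ 2 / y) (Ioi 0) :=
        ContinuousOn.add (by fun_prop) (ContinuousOn.div continuousOn_const continuousOn_id
          fun y hy => (mem_Ioi.1 hy).ne')
      have h2 : ContinuousOn (fun y : ℝ => (y * √y)⁻¹) (Ioi 0) :=
        ContinuousOn.inv₀ (by fun_prop) fun y hy => (mul_pos hy (Real.sqrt_pos.2 hy)).ne'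
      have h3 : ContinuousOn h (Ioi 0) := fun y hy => (hd y hy).continuousAt.continuousWithinAt
      exact h3.mul (((continuousOn_const.mul
        (Complex.continuous_ofReal.comp_continuousOn h1)).cexp).mul
        (Complex.continuous_ofReal.comp_continuousOn h2))
    · filter_upwards [ae_restrict_mem measurableSet_Ioi] with y hy
      have hy0 : 0 < y := hy
      have hs1 : 0 < √y := Real.sqrt_pos.2 hy
      rw [norm_mul, hφn y hy]
      refine (mul_le_mul_of_nonneg_right (hhb y hy) (by positivity)).trans (le_of_eq ?_)
      have hn : ‖s y‖ * ‖s y‖ = c ^ 2 + y ^ 2 := by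
        rw [← sq, ← Complex.normSq_eq_norm_sq, Complex.normSq_apply, hsre, hsim]; ring
      rw [hn]
      field_simp
  have hfin := norm_integral_Ioi_exp_phase_mul_le (k := k) hT (by positivity : 0 < Real.pi ^ 2 * r ^ 2)
    hd ((integral_inv_sqrt_mul_div hb0).1.const_mul _) hh'b hlim hint
  have heq : ∀ y ∈ Ioi (0 : ℝ), Complex.exp (s y * T) *
      Complex.exp (-(Real.pi ^ 2 * r ^ 2 : ℝ) / s y) * a y = h y *
      (Complex.exp (Complex.I * ((T * y + Real.pi ^ 2 * r ^ 2 / y : ℝ) : ℂ)) *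
        (((y * √y)⁻¹ : ℝ) : ℂ)) := fun y hy => by
    have hy0 : 0 < y := hy
    have hyC : (y : ℂ) ≠ 0 := by exact_mod_cast hy0.ne'
    have hs1 : 0 < √y := Real.sqrt_pos.2 hy
    have hs2 : ((√y : ℝ) : ℂ) ≠ 0 := by exact_mod_cast hs1.ne'
    have hRC : (R : ℂ) ≠ 0 := by exact_mod_cast hR.ne'
    have hsne := hs0 y
    have e1 : Complex.exp (s y * T) * Complex.exp (-(Real.pi ^ 2 * r ^ 2 : ℝ) / s y) =
        (Real.exp (c * T) : ℂ) * (Complex.exp (w y) *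
          Complex.exp (Complex.I * ((T * y + Real.pi ^ 2 * r ^ 2 / y : ℝ) : ℂ))) := by
      rw [Complex.ofReal_exp, ← Complex.exp_add, ← Complex.exp_add, ← Complex.exp_add]
      congr 1
      have e2 : -(Complex.I * (q : ℂ)) / (s y * y) + Complex.I * (Real.pi ^ 2 * r ^ 2 / y) =
          -(Real.pi ^ 2 * r ^ 2) / s y := by
        have e3 : (q : ℂ) = Real.pi ^ 2 * r ^ 2 * (R ^ 2 : ℂ)⁻¹ := by
          rw [hq, hb]; push_cast; field_simp
        have e4 : (R ^ 2 : ℂ)⁻¹ = s y - Complex.I * y := by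
          rw [hs, hc]; push_cast; ring
        rw [e3, e4]
        field_simp
        linear_combination (r : ℂ) ^ 2 * y * Complex.I_sq
      have e5 : s y * T = c * T + Complex.I * (T * y) := by rw [hs]; ring
      simp only [hw]
      push_cast
      rw [← e2, e5]
      ring
    rw [e1]
    simp only [hh]
    push_cast
    field_simp
  rw [setIntegral_congr_fun measurableSet_Ioi heq]
  refine hfin.trans (le_of_eq ?_)
  simp only [hk]
  rw [integral_const_mul, (integral_inv_sqrt_mul_div hb0).2, hB, Real.sqrt_mul (by positivity),
    Real.sqrt_sq Real.pi_pos.le, Real.sqrt_sq hr.le, Real.sqrt_eq_rpow,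
    show (1 / 2 - α : ℝ) = 1 / 2 + -α by ring, Real.rpow_add hb0]
  have := Real.pi_pos
  field_simp

end

section

open MeasureTheory Set Filter Topology

/-- The total mass `√(π / s)` of the Gaussian `exp (-s x²)`. -/
noncomputable def gaussMass (s : ℂ) : ℂ := ((Real.pi : ℂ) / s) ^ (1 / 2 : ℂ)

theorem gaussMass_sq (s : ℂ) : gaussMass s ^ 2 = Real.pi / s := by
  rw [gaussMass, ← Complex.cpow_nat_mul]; norm_num

theorem norm_gaussMass_sq (s : ℂ) : ‖gaussMass s‖ ^ 2 = Real.pi / ‖s‖ := by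
  rw [← norm_pow, gaussMass_sq, norm_div, Complex.norm_real, Real.norm_eq_abs,
    abs_of_pos Real.pi_pos]

theorem pi_div_mem_slitPlane {s : ℂ} (hs : 0 < s.re) : (Real.pi : ℂ) / s ∈ Complex.slitPlane := by
  left
  rw [Complex.div_re]
  have h : 0 < Complex.normSq s := Complex.normSq_pos.2 fun h => by simp [h] at hs
  simp only [Complex.ofReal_re, Complex.ofReal_im, zero_mul, zero_div, add_zero]
  have := Real.pi_pos
  positivity

theorem hasDerivAt_gaussMass {s : ℂ} (hs : 0 < s.re) :
    HasDerivAt gaussMass (-(gaussMass s / (2 * s))) s := by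
  have hs0 : s ≠ 0 := fun h => by simp [h] at hs
  have hpi : (Real.pi : ℂ) ≠ 0 := by exact_mod_cast Real.pi_ne_zero
  have h1 : HasDerivAt (fun s : ℂ => (Real.pi : ℂ) / s) (-(Real.pi : ℂ) / s ^ 2) s := by
    convert! (hasDerivAt_const s (Real.pi : ℂ)).div (hasDerivAt_id s) hs0 using 1
    simp
  have h2 := h1.cpow_const (c := (1 / 2 : ℂ)) (pi_div_mem_slitPlane hs)
  convert! h2 using 1
  rw [Complex.cpow_sub _ _ (div_ne_zero hpi hs0), Complex.cpow_one, gaussMass]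
  field_simp

theorem gaussMass_conj {s : ℂ} (hs : 0 < s.re) :
    gaussMass ((starRingEnd ℂ) s) = (starRingEnd ℂ) (gaussMass s) := by
  have h := Complex.slitPlane_arg_ne_pi (pi_div_mem_slitPlane hs)
  have h2 := Complex.conj_cpow ((Real.pi : ℂ) / s) (1 / 2) h
  simp only [map_div₀, Complex.conj_ofReal, map_one, map_ofNat] at h2
  rw [gaussMass, gaussMass, h2]

theorem integrable_pow_mul_exp_neg_mul_sq {c : ℝ} (hc : 0 < c) (k : ℕ) :
    Integrable fun x : ℝ => x ^ k * Real.exp (-c * x ^ 2) := by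
  have := integrable_rpow_mul_exp_neg_mul_sq hc (s := k) (by
    have : (0 : ℝ) ≤ k := k.cast_nonneg
    linarith)
  simpa only [Real.rpow_natCast] using this

theorem norm_cexp_neg_mul_sq_add (s : ℂ) (t x : ℝ) :
    ‖Complex.exp (-s * (x : ℂ) ^ 2 + Complex.I * t * x)‖ = Real.exp (-s.re * x ^ 2) := by
  rw [Complex.norm_exp]
  congr 1
  rw [← Complex.ofReal_pow]
  simp [-Complex.ofReal_pow]

theorem integrable_pow_mul_cexp {s : ℂ} (hs : 0 < s.re) (t : ℝ) (k : ℕ) :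
    Integrable fun x : ℝ =>
      (x : ℂ) ^ k * Complex.exp (-s * (x : ℂ) ^ 2 + Complex.I * t * x) := by
  refine Integrable.mono (integrable_pow_mul_exp_neg_mul_sq hs k)
    (by fun_prop : Continuous _).aestronglyMeasurable (ae_of_all _ fun x => le_of_eq ?_)
  rw [norm_mul, norm_mul, norm_cexp_neg_mul_sq_add, norm_pow, norm_pow, Complex.norm_real,
    Real.norm_eq_abs (Real.exp _), abs_of_pos (Real.exp_pos _)]

theorem integrable_pow_mul_cexp_neg_sq {s : ℂ} (hs : 0 < s.re) (k : ℕ) :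
    Integrable fun x : ℝ => (x : ℂ) ^ k * Complex.exp (-s * (x : ℂ) ^ 2) := by
  simpa using integrable_pow_mul_cexp hs 0 k

theorem tendsto_pow_mul_cexp {s : ℂ} (hs : 0 < s.re) (t : ℝ) (k : ℕ) :
    Tendsto (fun x : ℝ => (x : ℂ) ^ k * Complex.exp (-s * (x : ℂ) ^ 2 + Complex.I * t * x))
      atTop (𝓝 0) := by
  have h1 := (rpow_mul_exp_neg_mul_sq_isLittleO_exp_neg hs k).trans_tendsto
    (Real.tendsto_exp_neg_atTop_nhds_zero.comp
      (tendsto_id.const_mul_atTop (by norm_num : (0 : ℝ) < 1 / 2)) |>.congr fun x => by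
        simp only [Function.comp, id]; congr 1; ring)
  refine squeeze_zero_norm' ?_ h1
  filter_upwards [eventually_ge_atTop 0] with x hx
  rw [norm_mul, norm_cexp_neg_mul_sq_add, norm_pow, Complex.norm_real, Real.norm_eq_abs,
    abs_of_nonneg hx, Real.rpow_natCast]

/-- The constant in the Gaussian moment of order `k`. -/
noncomputable def momentConst (k : ℕ) : ℝ :=
  Real.Gamma (((k : ℝ) + 1) / 2) / Real.pi ^ (((k : ℝ) + 1) / 2)

theorem momentConst_pos (k : ℕ) : 0 < momentConst k :=
  div_pos (Real.Gamma_pos_of_pos (by positivity)) (Real.rpow_pos_of_pos Real.pi_pos _)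

theorem integral_Ioi_pow_mul_cexp_add_two {s : ℂ} (hs : 0 < s.re) (k : ℕ) :
    ∫ x in Ioi (0 : ℝ), (x : ℂ) ^ (k + 2) * Complex.exp (-s * (x : ℂ) ^ 2) =
      (k + 1) / (2 * s) * ∫ x in Ioi (0 : ℝ), (x : ℂ) ^ k * Complex.exp (-s * (x : ℂ) ^ 2) := by
  have hs0 : s ≠ 0 := fun h => by simp [h] at hs
  have hd : ∀ x ∈ Ici (0 : ℝ), HasDerivAt
      (fun x : ℝ => (x : ℂ) ^ (k + 1) * Complex.exp (-s * (x : ℂ) ^ 2))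
      ((k + 1) * ((x : ℂ) ^ k * Complex.exp (-s * (x : ℂ) ^ 2)) -
        2 * s * ((x : ℂ) ^ (k + 2) * Complex.exp (-s * (x : ℂ) ^ 2))) x := fun x _ => by
    have h1 : HasDerivAt (fun z : ℂ => z ^ (k + 1) * Complex.exp (-s * z ^ 2))
        ((k + 1) * ((x : ℂ) ^ k * Complex.exp (-s * (x : ℂ) ^ 2)) -
        2 * s * ((x : ℂ) ^ (k + 2) * Complex.exp (-s * (x : ℂ) ^ 2))) (x : ℂ) := by
      convert! (hasDerivAt_pow (k + 1) (x : ℂ)).mul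
        (((hasDerivAt_pow 2 (x : ℂ)).const_mul (-s)).cexp) using 1
      push_cast
      ring
    exact h1.comp_ofReal
  have hi1 := (integrable_pow_mul_cexp_neg_sq hs k).integrableOn (s := Ioi 0)
  have hi2 := (integrable_pow_mul_cexp_neg_sq hs (k + 2)).integrableOn (s := Ioi 0)
  have ht : Tendsto (fun x : ℝ => (x : ℂ) ^ (k + 1) * Complex.exp (-s * (x : ℂ) ^ 2))
      atTop (𝓝 0) := by simpa using tendsto_pow_mul_cexp hs 0 (k + 1)
  have h := integral_Ioi_of_hasDerivAt_of_tendsto' hd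
    ((hi1.const_mul _).sub (hi2.const_mul _)) ht
  rw [integral_sub (hi1.const_mul _) (hi2.const_mul _), integral_const_mul,
    integral_const_mul] at h
  simp only [Complex.ofReal_zero, ne_eq, Nat.add_eq_zero_iff, one_ne_zero, and_false,
    not_false_eq_true, zero_pow, zero_mul, sub_zero] at h
  rw [div_mul_eq_mul_div, eq_div_iff (by simpa using hs0)]
  linear_combination -h

theorem momentConst_add_two (k : ℕ) :
    momentConst (k + 2) * Real.pi = (k + 1) / 2 * momentConst k := by
  have h1 : (((k + 2 : ℕ) : ℝ) + 1) / 2 = ((k : ℝ) + 1) / 2 + 1 := by push_cast; ring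
  rw [momentConst, momentConst, h1, Real.Gamma_add_one (by positivity),
    Real.rpow_add Real.pi_pos, Real.rpow_one]
  have := Real.pi_pos
  field_simp

theorem integral_Ioi_pow_mul_cexp {s : ℂ} (hs : 0 < s.re) : ∀ k : ℕ,
    2 * ∫ x in Ioi (0 : ℝ), (x : ℂ) ^ k * Complex.exp (-s * (x : ℂ) ^ 2) =
      momentConst k * gaussMass s ^ (k + 1)
  | 0 => by
    have h := integral_gaussian_complex_Ioi hs
    have h2 : momentConst 0 = 1 := by
      rw [momentConst]
      norm_num
      rw [Real.Gamma_one_half_eq, Real.sqrt_eq_rpow,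
        div_self]
      exact (Real.rpow_pos_of_pos Real.pi_pos _).ne'
    simp only [pow_zero, one_mul, h2, zero_add, pow_one, Complex.ofReal_one]
    rw [h, gaussMass]; ring
  | 1 => by
    have h := integral_mul_cexp_neg_mul_sq hs
    have h2 : momentConst 1 = Real.pi⁻¹ := by
      rw [momentConst]; norm_num
    have hs0 : s ≠ 0 := fun h => by simp [h] at hs
    have hpi : (Real.pi : ℂ) ≠ 0 := by exact_mod_cast Real.pi_ne_zero
    simp only [pow_one, h, h2]
    rw [gaussMass_sq, Complex.ofReal_inv]
    field_simp
  | k + 2 => by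
    have hs0 : s ≠ 0 := fun h => by simp [h] at hs
    have hpi : (Real.pi : ℂ) ≠ 0 := by exact_mod_cast Real.pi_ne_zero
    rw [integral_Ioi_pow_mul_cexp_add_two hs k,
      show k + 2 + 1 = (k + 1) + 2 by ring, pow_add, gaussMass_sq]
    have h := integral_Ioi_pow_mul_cexp hs k
    have h2 : (momentConst (k + 2) : ℂ) * Real.pi = (k + 1) / 2 * momentConst k := by
      have := congrArg (Complex.ofReal) (momentConst_add_two k)
      push_cast at this
      exact this
    generalize (∫ x in Ioi (0 : ℝ), (x : ℂ) ^ k * Complex.exp (-s * (x : ℂ) ^ 2)) = J at h ⊢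
    field_simp
    linear_combination ((k : ℂ) + 1) / 2 * h - gaussMass s ^ (k + 1) * h2

end

section

open MeasureTheory Set Filter Topology

/-- A symbol estimate at a point: both `f` and `s` times its derivative are bounded by `B`. -/
def SymbolBoundAt (f : ℂ → ℂ) (s : ℂ) (B : ℝ) : Prop :=
  ‖f s‖ ≤ B ∧ ∃ f' : ℂ, HasDerivAt f f' s ∧ ‖s‖ * ‖f'‖ ≤ B

namespace SymbolBoundAt

variable {f g : ℂ → ℂ} {s : ℂ} {B B' : ℝ}

theorem nonneg (h : SymbolBoundAt f s B) : 0 ≤ B := (norm_nonneg _).trans h.1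

theorem mono (h : SymbolBoundAt f s B) (hB : B ≤ B') : SymbolBoundAt f s B' :=
  ⟨h.1.trans hB, h.2.imp fun _ h' => ⟨h'.1, h'.2.trans hB⟩⟩

theorem const (c s : ℂ) : SymbolBoundAt (fun _ => c) s ‖c‖ :=
  ⟨le_rfl, 0, hasDerivAt_const s c, by simp⟩

theorem add (hf : SymbolBoundAt f s B) (hg : SymbolBoundAt g s B') :
    SymbolBoundAt (fun z => f z + g z) s (B + B') := by
  obtain ⟨h1, f', hf', h2⟩ := hf
  obtain ⟨h3, g', hg', h4⟩ := hg
  refine ⟨(norm_add_le _ _).trans (add_le_add h1 h3), f' + g', hf'.add hg', ?_⟩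
  calc ‖s‖ * ‖f' + g'‖ ≤ ‖s‖ * (‖f'‖ + ‖g'‖) := by gcongr; exact norm_add_le _ _
    _ ≤ B + B' := by rw [mul_add]; exact add_le_add h2 h4

theorem mul (hf : SymbolBoundAt f s B) (hg : SymbolBoundAt g s B') :
    SymbolBoundAt (fun z => f z * g z) s (2 * (B * B')) := by
  have hB := hf.nonneg
  have hB' := hg.nonneg
  obtain ⟨h1, f', hf', h2⟩ := hf
  obtain ⟨h3, g', hg', h4⟩ := hg
  refine ⟨?_, f' * g s + f s * g', hf'.mul hg', ?_⟩
  · rw [norm_mul]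
    calc ‖f s‖ * ‖g s‖ ≤ B * B' := by gcongr
      _ ≤ 2 * (B * B') := by nlinarith [mul_nonneg hB hB']
  · calc ‖s‖ * ‖f' * g s + f s * g'‖ ≤ ‖s‖ * (‖f'‖ * ‖g s‖ + ‖f s‖ * ‖g'‖) := by
          gcongr
          refine (norm_add_le _ _).trans ?_
          rw [norm_mul, norm_mul]
      _ = (‖s‖ * ‖f'‖) * ‖g s‖ + ‖f s‖ * (‖s‖ * ‖g'‖) := by ring
      _ ≤ B * B' + B * B' := by gcongr
      _ = _ := by ring

theorem const_mul (c : ℂ) (hf : SymbolBoundAt f s B) :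
    SymbolBoundAt (fun z => c * f z) s (‖c‖ * B) := by
  obtain ⟨h1, f', hf', h2⟩ := hf
  refine ⟨by rw [norm_mul]; gcongr, c * f', hf'.const_mul c, ?_⟩
  rw [norm_mul, mul_left_comm]
  gcongr

theorem prod {ι : Type*} (t : Finset ι) {F : ι → ℂ → ℂ} {b : ι → ℝ}
    (h : ∀ i ∈ t, SymbolBoundAt (F i) s (b i)) :
    SymbolBoundAt (fun z => ∏ i ∈ t, F i z) s (2 ^ t.card * ∏ i ∈ t, b i) := by
  classical
  induction t using Finset.induction_on with
  | empty => simpa using const 1 s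
  | insert i t hi ih =>
    simp only [Finset.prod_insert hi, Finset.card_insert_of_notMem hi]
    refine ((h i (Finset.mem_insert_self _ _)).mul
      (ih fun j hj => h j (Finset.mem_insert_of_mem hj))).mono (le_of_eq ?_)
    rw [pow_succ]; ring

theorem inv (hs : s ≠ 0) : SymbolBoundAt (fun z => z⁻¹) s ‖s‖⁻¹ := by
  refine ⟨by simp, -(s ^ 2)⁻¹, hasDerivAt_inv hs, ?_⟩
  rw [norm_neg, norm_inv, norm_pow]
  have := norm_pos_iff.2 hs
  apply le_of_eq
  field_simp

end SymbolBoundAt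

theorem symbolBoundAt_gaussMass {s : ℂ} (hs : 0 < s.re) :
    SymbolBoundAt gaussMass s (√Real.pi * (√‖s‖)⁻¹) := by
  have hs0 : s ≠ 0 := fun h => by simp [h] at hs
  have hn := norm_pos_iff.2 hs0
  have h1 : ‖gaussMass s‖ = √Real.pi * (√‖s‖)⁻¹ := by
    rw [← Real.sqrt_sq (norm_nonneg (gaussMass s)), norm_gaussMass_sq,
      Real.sqrt_div Real.pi_pos.le, div_eq_mul_inv]
  refine ⟨h1.le, _, hasDerivAt_gaussMass hs, ?_⟩
  rw [← h1, norm_neg, norm_div, norm_mul, Complex.norm_ofNat]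
  rw [mul_div_assoc', div_le_iff₀ (by positivity)]
  nlinarith [mul_nonneg hn.le (norm_nonneg (gaussMass s))]

/-- The polynomial factor in the Fourier transform of `x ^ k * exp (-s x²)`. -/
noncomputable def hermFactor (μ : ℂ) : ℕ → ℂ → ℂ
  | 0, _ => 1
  | 1, s => μ * s⁻¹
  | k + 2, s => μ * s⁻¹ * hermFactor μ (k + 1) s + ((k + 1 : ℕ) / 2 : ℂ) * s⁻¹ * hermFactor μ k s

theorem integral_deriv_pow_mul_cexp {s : ℂ} (hs : 0 < s.re) (t : ℝ) (k : ℕ) :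
    2 * s * ∫ x : ℝ, (x : ℂ) ^ (k + 1) * Complex.exp (-s * (x : ℂ) ^ 2 + Complex.I * t * x) =
      Complex.I * t * (∫ x : ℝ, (x : ℂ) ^ k * Complex.exp (-s * (x : ℂ) ^ 2 + Complex.I * t * x))
      + k * ∫ x : ℝ, (x : ℂ) ^ (k - 1) *
          Complex.exp (-s * (x : ℂ) ^ 2 + Complex.I * t * x) := by
  have hd : ∀ x : ℝ, HasDerivAt
      (fun x : ℝ => (x : ℂ) ^ k * Complex.exp (-s * (x : ℂ) ^ 2 + Complex.I * t * x))
      (k * ((x : ℂ) ^ (k - 1) * Complex.exp (-s * (x : ℂ) ^ 2 + Complex.I * t * x)) +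
        Complex.I * t * ((x : ℂ) ^ k * Complex.exp (-s * (x : ℂ) ^ 2 + Complex.I * t * x)) -
        2 * s * ((x : ℂ) ^ (k + 1) *
          Complex.exp (-s * (x : ℂ) ^ 2 + Complex.I * t * x))) x := fun x => by
    refine HasDerivAt.comp_ofReal (e := fun z : ℂ => z ^ k * Complex.exp (-s * z ^ 2 +
      Complex.I * t * z)) ?_
    convert! (hasDerivAt_pow k (x : ℂ)).mul
      ((((hasDerivAt_pow 2 (x : ℂ)).const_mul (-s)).add
        ((hasDerivAt_id (x : ℂ)).const_mul (Complex.I * t))).cexp) using 1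
    simp
    ring
  have hi0 := integrable_pow_mul_cexp hs t (k - 1)
  have hi1 := integrable_pow_mul_cexp hs t k
  have hi2 := integrable_pow_mul_cexp hs t (k + 1)
  have hi01 : Integrable fun x : ℝ =>
      (k : ℂ) * ((x : ℂ) ^ (k - 1) * Complex.exp (-s * (x : ℂ) ^ 2 + Complex.I * t * x)) +
        Complex.I * t * ((x : ℂ) ^ k * Complex.exp (-s * (x : ℂ) ^ 2 + Complex.I * t * x)) :=
    (hi0.const_mul _).add (hi1.const_mul _)
  have h := integral_eq_zero_of_hasDerivAt_of_integrable hd (hi01.sub (hi2.const_mul _)) hi1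
  rw [integral_sub hi01 (hi2.const_mul _),
    integral_add (hi0.const_mul _) (hi1.const_mul _), integral_const_mul, integral_const_mul,
    integral_const_mul] at h
  linear_combination -h

theorem integral_pow_mul_cexp {s : ℂ} (hs : 0 < s.re) (t : ℝ) : ∀ k : ℕ,
    ∫ x : ℝ, (x : ℂ) ^ k * Complex.exp (-s * (x : ℂ) ^ 2 + Complex.I * t * x) =
      gaussMass s * Complex.exp (-(t : ℂ) ^ 2 / (4 * s)) * hermFactor (Complex.I * t / 2) k s
  | 0 => by
    rw [hermFactor, mul_one, gaussMass, ← fourierIntegral_gaussian hs]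
    refine integral_congr_ae (ae_of_all _ fun x => ?_)
    simp only [pow_zero, one_mul]
    rw [← Complex.exp_add]
    ring_nf
  | 1 => by
    have hs0 : s ≠ 0 := fun h => by simp [h] at hs
    have h := integral_deriv_pow_mul_cexp hs t 0
    have h0 := integral_pow_mul_cexp hs t 0
    rw [hermFactor, mul_one] at h0
    rw [zero_add, h0, Nat.cast_zero, zero_mul, add_zero] at h
    rw [hermFactor, ← mul_right_inj' (mul_ne_zero two_ne_zero hs0), h]
    field_simp
  | k + 2 => by
    have hs0 : s ≠ 0 := fun h => by simp [h] at hs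
    have h := integral_deriv_pow_mul_cexp hs t (k + 1)
    rw [integral_pow_mul_cexp hs t (k + 1), Nat.add_sub_cancel,
      integral_pow_mul_cexp hs t k] at h
    rw [hermFactor, ← mul_right_inj' (mul_ne_zero two_ne_zero hs0), h]
    field_simp

theorem symbolBoundAt_hermFactor (k : ℕ) : ∃ C > 0, ∀ (R m : ℝ) (μ s : ℂ), 1 ≤ R → 0 ≤ m →
    ‖μ‖ ≤ 4 * m → s ≠ 0 → (R ^ 2)⁻¹ ≤ ‖s‖ →
    SymbolBoundAt (hermFactor μ k) s (C * (R + m / ‖s‖) ^ k) := by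
  induction k using Nat.twoStepInduction with
  | zero =>
    refine ⟨1, one_pos, fun R m μ s _ _ _ _ _ => ?_⟩
    simpa [hermFactor] using SymbolBoundAt.const 1 s
  | one =>
    refine ⟨4, by norm_num, fun R m μ s hR hm hμ hs _ => ?_⟩
    refine ((SymbolBoundAt.inv hs).const_mul μ).mono ?_
    rw [pow_one, ← div_eq_mul_inv]
    calc ‖μ‖ / ‖s‖ ≤ 4 * m / ‖s‖ := by gcongr
      _ ≤ 4 * (R + m / ‖s‖) := by rw [mul_div_assoc]; linarith
  | more k ih1 ih2 =>
    obtain ⟨C1, hC1, h1⟩ := ih1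
    obtain ⟨C2, hC2, h2⟩ := ih2
    refine ⟨2 * (4 * C2) + 2 * ((k + 1) * C1), by positivity, fun R m μ s hR hm hμ hs hRs => ?_⟩
    have hn := norm_pos_iff.2 hs
    have hΛ : R ≤ R + m / ‖s‖ := by
      have : 0 ≤ m / ‖s‖ := by positivity
      linarith
    have hμs : ‖μ‖ * ‖s‖⁻¹ ≤ 4 * (R + m / ‖s‖) := by
      rw [← div_eq_mul_inv]
      calc ‖μ‖ / ‖s‖ ≤ 4 * m / ‖s‖ := by gcongr
        _ ≤ 4 * (R + m / ‖s‖) := by rw [mul_div_assoc]; linarith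
    have hks : ‖((k + 1 : ℕ) / 2 : ℂ)‖ * ‖s‖⁻¹ ≤ (k + 1) * (R + m / ‖s‖) ^ 2 := by
      rw [norm_div, Complex.norm_natCast, Complex.norm_ofNat]
      have h3 : ‖s‖⁻¹ ≤ R ^ 2 := inv_le_of_inv_le₀ (by positivity) hRs
      have h4 : R ^ 2 ≤ (R + m / ‖s‖) ^ 2 := by gcongr
      push_cast
      have h5 : (0 : ℝ) ≤ k := k.cast_nonneg
      exact mul_le_mul (by linarith) (h3.trans h4) (by positivity) (by positivity)
    refine (SymbolBoundAt.add
      ((((SymbolBoundAt.inv hs).const_mul μ).mono hμs).mul (h2 R m μ s hR hm hμ hs hRs))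
      ((((SymbolBoundAt.inv hs).const_mul _).mono hks).mul (h1 R m μ s hR hm hμ hs hRs))).mono
      (le_of_eq ?_)
    ring

end

section

open MeasureTheory Set Filter Topology

/-- Two integrations by parts in a half-line Gaussian integral with linear phase. -/
theorem norm_integral_Ioi_pow_succ_mul_cexp_le {s : ℂ} (hs : 0 < s.re) (hs' : 0 ≤ s.im) {t : ℝ}
    (ht : t < 0) (j : ℕ) {κ : ℝ → ℝ} (hκ : IntegrableOn κ (Ioi 0))
    (hb : ∀ x, 0 < x → ∀ P : ℝ, |t| ≤ P → 2 * ‖s‖ * x ≤ P → 4 * ‖s‖ ^ 2 * x ^ 2 + t ^ 2 ≤ P ^ 2 →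
      ((j + 1) * j * x ^ (j - 1) / P ^ 2 + 6 * (j + 1) * (‖s‖ * x ^ j / P ^ 3)
        + 12 * (‖s‖ ^ 2 * x ^ (j + 1) / P ^ 4)) * Real.exp (-s.re * x ^ 2) ≤ κ x) :
    ‖∫ x in Ioi (0 : ℝ), (x : ℂ) ^ (j + 1) *
        Complex.exp (-s * (x : ℂ) ^ 2 + Complex.I * t * x)‖
      ≤ (t ^ 2)⁻¹ * 0 ^ j + ∫ x in Ioi (0 : ℝ), κ x := by
  have hs0 : s ≠ 0 := fun h => by simp [h] at hs
  set p : ℝ → ℂ := fun x => 2 * s * x - Complex.I * t with hp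
  set E : ℝ → ℂ := fun x => Complex.exp (-s * (x : ℂ) ^ 2 + Complex.I * t * x) with hE
  have hnE : ∀ x, ‖E x‖ = Real.exp (-s.re * x ^ 2) := fun x => norm_cexp_neg_mul_sq_add s t x
  have hpn : ∀ x, 0 ≤ x → 4 * ‖s‖ ^ 2 * x ^ 2 + t ^ 2 ≤ ‖p x‖ ^ 2 := fun x hx => by
    rw [← Complex.normSq_eq_norm_sq, ← Complex.normSq_eq_norm_sq, Complex.normSq_apply,
      Complex.normSq_apply]
    have hre : (p x).re = 2 * s.re * x := by simp [hp]
    have him : (p x).im = 2 * s.im * x - t := by simp [hp]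
    rw [hre, him]
    nlinarith [mul_nonneg (mul_nonneg hs' hx) (neg_nonneg.2 ht.le)]
  have hp1 : ∀ x, 0 ≤ x → |t| ≤ ‖p x‖ := fun x hx =>
    abs_le_of_sq_le_sq (by nlinarith [hpn x hx, mul_nonneg (sq_nonneg ‖s‖) (sq_nonneg x)])
      (norm_nonneg _)
  have hp2 : ∀ x, 0 ≤ x → 2 * ‖s‖ * x ≤ ‖p x‖ := fun x hx =>
    le_of_abs_le <| abs_le_of_sq_le_sq (by nlinarith [hpn x hx, sq_nonneg t]) (norm_nonneg _)
  have ht0 : 0 < |t| := abs_pos.2 ht.ne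
  have hp0 : ∀ x, 0 ≤ x → p x ≠ 0 := fun x hx => norm_pos_iff.1 (ht0.trans_le (hp1 x hx))
  set G : ℝ → ℂ := fun x => ((j + 1) * j * (x : ℂ) ^ (j - 1) / p x ^ 2
    - 6 * (j + 1) * (s * (x : ℂ) ^ j / p x ^ 3) + 12 * (s ^ 2 * (x : ℂ) ^ (j + 1) / p x ^ 4)) * E x
    with hG
  set F : ℝ → ℂ := fun x => ((x : ℂ) ^ (j + 1) / p x + (j + 1) * (x : ℂ) ^ j / p x ^ 2
    - 2 * s * (x : ℂ) ^ (j + 1) / p x ^ 3) * E x with hF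
  have hpd : ∀ x : ℝ, HasDerivAt (fun z : ℂ => 2 * s * z - Complex.I * t) (2 * s) (x : ℂ) :=
    fun x => by
    simpa using ((hasDerivAt_id (x : ℂ)).const_mul (2 * s)).sub_const (Complex.I * t)
  have hFd : ∀ x ∈ Ici (0 : ℝ), HasDerivAt F (G x - (x : ℂ) ^ (j + 1) * E x) x := fun x hx => by
    have hpx := hp0 x hx
    simp only [hp] at hpx
    refine HasDerivAt.comp_ofReal (e := fun z : ℂ => (z ^ (j + 1) / (2 * s * z - Complex.I * t) +
      (j + 1) * z ^ j / (2 * s * z - Complex.I * t) ^ 2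
      - 2 * s * z ^ (j + 1) / (2 * s * z - Complex.I * t) ^ 3) *
        Complex.exp (-s * z ^ 2 + Complex.I * t * z)) ?_
    convert! (((((hasDerivAt_pow (j + 1) (x : ℂ)).div (hpd x) hpx).add
      (((hasDerivAt_pow j (x : ℂ)).const_mul ((j : ℂ) + 1)).div ((hpd x).pow 2)
        (pow_ne_zero 2 hpx))).sub
      (((hasDerivAt_pow (j + 1) (x : ℂ)).const_mul (2 * s)).div ((hpd x).pow 3)
        (pow_ne_zero 3 hpx))).mul
      ((((hasDerivAt_pow 2 (x : ℂ)).const_mul (-s)).add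
        ((hasDerivAt_id (x : ℂ)).const_mul (Complex.I * t))).cexp)) using 1
    simp only [hG, hE, hp, Nat.add_sub_cancel, Nat.cast_add, Nat.cast_one, Nat.cast_ofNat,
      Pi.add_apply, Pi.sub_apply, Pi.div_apply, Pi.pow_apply, id]
    generalize Complex.exp (-s * (x : ℂ) ^ 2 + Complex.I * t * x) = e
    have hPe : ∃ P : ℂ, P = 2 * s * x - Complex.I * t := ⟨_, rfl⟩
    obtain ⟨P, hP⟩ := hPe
    have hIt : Complex.I * t = 2 * s * x - P := by rw [hP]; ring
    rw [← hP] at hpx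
    rw [← hP, hIt]
    field_simp
    ring
  have hGb : ∀ x, 0 < x → ‖G x‖ ≤ κ x := fun x hx => by
    refine le_trans ?_ (hb x hx ‖p x‖ (hp1 x hx.le) (hp2 x hx.le) (hpn x hx.le))
    simp only [hG]
    rw [norm_mul, hnE]
    refine mul_le_mul_of_nonneg_right ?_ (Real.exp_pos _).le
    have hj : ‖((j : ℂ) + 1)‖ = j + 1 := by
      exact_mod_cast Complex.norm_natCast (j + 1)
    refine (norm_add_le _ _).trans (add_le_add ((norm_sub_le _ _).trans (add_le_add ?_ ?_)) ?_)
    all_goals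
      simp only [norm_mul, norm_div, norm_pow, Complex.norm_real, Real.norm_eq_abs,
        abs_of_pos hx, hj, Complex.norm_natCast, Complex.norm_ofNat, le_refl]
  have hpc : Continuous p := by fun_prop
  have hEc : Continuous E := by fun_prop
  have hcp : ∀ k : ℕ, ContinuousOn (fun x => p x ^ k) (Ioi 0) := fun k =>
    (hpc.pow k).continuousOn
  have hGc : ContinuousOn G (Ioi 0) := by
    have hne : ∀ k : ℕ, ∀ x ∈ Ioi (0 : ℝ), p x ^ k ≠ 0 := fun k x hx => pow_ne_zero k (hp0 x
      (le_of_lt hx))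
    refine ContinuousOn.mul (ContinuousOn.add (ContinuousOn.sub ?_ ?_) ?_) hEc.continuousOn
    · exact ContinuousOn.div (by fun_prop) (hcp 2) (hne 2)
    · exact continuousOn_const.mul (ContinuousOn.div (by fun_prop) (hcp 3) (hne 3))
    · exact continuousOn_const.mul (ContinuousOn.div (by fun_prop) (hcp 4) (hne 4))
  have hGi : IntegrableOn G (Ioi 0) := Integrable.mono' hκ
    (hGc.aestronglyMeasurable measurableSet_Ioi) (by
      filter_upwards [ae_restrict_mem measurableSet_Ioi] with x hx using hGb x hx)
  have hui := (integrable_pow_mul_cexp hs t (j + 1)).integrableOn (s := Ioi 0)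
  have hFl : Tendsto F atTop (𝓝 0) := by
    have h1 := (tendsto_pow_mul_cexp hs t (j + 1)).norm
    have h0 := (tendsto_pow_mul_cexp hs t j).norm
    have h2 := ((h1.const_mul (|t|⁻¹)).add (h0.const_mul ((j + 1) * (|t| ^ 2)⁻¹))).add
      (h1.const_mul (2 * ‖s‖ * (|t| ^ 3)⁻¹))
    simp only [norm_zero, mul_zero, add_zero] at h2
    refine squeeze_zero_norm' ?_ h2
    filter_upwards [eventually_ge_atTop 0] with x hx
    have hpx := hp1 x hx
    have hP0 := ht0.trans_le hpx
    have hj : ‖((j : ℂ) + 1)‖ = j + 1 := by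
      exact_mod_cast Complex.norm_natCast (j + 1)
    simp only [hF]
    rw [norm_mul]
    have h3 : ‖(x : ℂ) ^ (j + 1) / p x + (j + 1) * (x : ℂ) ^ j / p x ^ 2
        - 2 * s * (x : ℂ) ^ (j + 1) / p x ^ 3‖ ≤ x ^ (j + 1) / ‖p x‖ +
        (j + 1) * x ^ j / ‖p x‖ ^ 2 + 2 * ‖s‖ * x ^ (j + 1) / ‖p x‖ ^ 3 := by
      refine (norm_sub_le _ _).trans (add_le_add ((norm_add_le _ _).trans (add_le_add ?_ ?_)) ?_)
      all_goals
        simp only [norm_mul, norm_div, norm_pow, Complex.norm_real, Real.norm_eq_abs,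
          abs_of_nonneg hx, hj, Complex.norm_ofNat, le_refl]
    simp only [norm_mul, norm_pow, Complex.norm_real, Real.norm_eq_abs, abs_of_nonneg hx]
    refine (mul_le_mul_of_nonneg_right h3 (norm_nonneg _)).trans ?_
    have h4 : x ^ (j + 1) / ‖p x‖ + (j + 1) * x ^ j / ‖p x‖ ^ 2 +
        2 * ‖s‖ * x ^ (j + 1) / ‖p x‖ ^ 3 ≤ x ^ (j + 1) / |t| + (j + 1) * x ^ j / |t| ^ 2 +
        2 * ‖s‖ * x ^ (j + 1) / |t| ^ 3 := by gcongr
    refine (mul_le_mul_of_nonneg_right h4 (norm_nonneg _)).trans (le_of_eq ?_)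
    simp only [hE]
    ring
  have h := integral_Ioi_of_hasDerivAt_of_tendsto' hFd (hGi.sub hui) hFl
  rw [integral_sub hGi hui] at h
  have hF0 : ‖F 0‖ = (t ^ 2)⁻¹ * 0 ^ j := by
    simp only [hF, hp, hE]
    have hI : (-(Complex.I * (t : ℂ))) ^ 2 = -(t : ℂ) ^ 2 := by
      rw [neg_sq, mul_pow, Complex.I_sq]; ring
    rcases Nat.eq_zero_or_pos j with rfl | hj
    · simp [hI]
    · simp [hj.ne']
  have hu : (∫ x in Ioi (0 : ℝ), (x : ℂ) ^ (j + 1) * E x) = F 0 + ∫ x in Ioi (0 : ℝ), G x := by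
    linear_combination -h
  rw [hu]
  refine (norm_add_le _ _).trans (add_le_add hF0.le ?_)
  refine norm_integral_le_of_norm_le hκ ?_
  filter_upwards [ae_restrict_mem measurableSet_Ioi] with x hx using hGb x hx

/-- The half-line Gaussian moments with a linear phase decay quadratically in the phase. -/
theorem exists_norm_integral_Ioi_pow_mul_cexp_le (j : ℕ) : ∃ C > 0, ∀ (R : ℝ) (s : ℂ) (t : ℝ),
    0 < R → s.re = (R ^ 2)⁻¹ → 0 ≤ s.im → t < 0 →
      ‖∫ x in Ioi (0 : ℝ), (x : ℂ) ^ (j + 1) *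
        Complex.exp (-s * (x : ℂ) ^ 2 + Complex.I * t * x)‖ ≤ C * R ^ j * (t ^ 2)⁻¹ := by
  rcases Nat.eq_zero_or_pos j with rfl | hj
  · refine ⟨1 + 3 * Real.pi, by positivity, fun R s t hR hs hs' ht => ?_⟩
    have hsre : 0 < s.re := by rw [hs]; positivity
    have hn : 0 < ‖s‖ := norm_pos_iff.2 fun h => by simp [h] at hsre
    have ht' : 0 < |t| := abs_pos.2 ht.ne
    set a : ℝ := 2 * ‖s‖ / |t| with ha
    have ha0 : 0 < a := by positivity
    have hi : IntegrableOn (fun x : ℝ => 12 * ‖s‖ * (|t| ^ 3)⁻¹ * (1 + (a * x) ^ 2)⁻¹) (Ioi 0) :=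
      ((integrable_inv_one_add_sq.comp_mul_left' ha0.ne').const_mul _).integrableOn
    refine (norm_integral_Ioi_pow_succ_mul_cexp_le hsre hs' ht 0 hi fun x hx P h1 h2 h3 => ?_).trans
      ?_
    · have hP : 0 < P := ht'.trans_le h1
      have hexp : Real.exp (-s.re * x ^ 2) ≤ 1 := Real.exp_le_one_iff.2 (by
        have := mul_nonneg hsre.le (sq_nonneg x); linarith)
      have h4 : 12 * ‖s‖ * (|t| ^ 3)⁻¹ * (1 + (a * x) ^ 2)⁻¹
          = 12 * ‖s‖ / (|t| * (4 * ‖s‖ ^ 2 * x ^ 2 + t ^ 2)) := by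
        rw [ha, ← sq_abs t]
        field_simp
        ring
      rw [h4]
      refine (mul_le_of_le_one_right (by positivity) hexp).trans ?_
      have h5 : 12 * ‖s‖ / (|t| * P ^ 2) ≤
          12 * ‖s‖ / (|t| * (4 * ‖s‖ ^ 2 * x ^ 2 + t ^ 2)) := by gcongr
      refine le_trans (le_of_eq_of_le
        (b := 6 * ‖s‖ / P ^ 3 + 6 * ‖s‖ * (2 * ‖s‖ * x) / P ^ 4) ?_ ?_) h5
      · simp only [Nat.cast_zero, zero_add, pow_zero, mul_one, mul_zero, zero_mul, zero_div, pow_one]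
        ring
      · calc 6 * ‖s‖ / P ^ 3 + 6 * ‖s‖ * (2 * ‖s‖ * x) / P ^ 4
            ≤ 6 * ‖s‖ / P ^ 3 + 6 * ‖s‖ * P / P ^ 4 := by gcongr
          _ = 12 * ‖s‖ / (P * P ^ 2) := by field_simp; ring
          _ ≤ 12 * ‖s‖ / (|t| * P ^ 2) := by gcongr
    · have h6 := integral_comp_mul_left_Ioi (fun y : ℝ => (1 + y ^ 2)⁻¹) 0 ha0
      rw [mul_zero, integral_Ioi_inv_one_add_sq] at h6
      simp only [Real.arctan_zero, sub_zero, smul_eq_mul] at h6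
      rw [integral_const_mul, h6, ha, ← sq_abs t]
      apply le_of_eq
      field_simp
      ring
  · set K : ℝ := (j + 1) * j + 3 * (j + 1) + 3 with hK
    have hK0 : 0 < K := by positivity
    set J : ℝ := ∫ x in Ioi (0 : ℝ), x ^ (j - 1) * Real.exp (-1 * x ^ 2) with hJ
    have hJ0 : 0 ≤ J := setIntegral_nonneg measurableSet_Ioi fun x hx => by
      have : 0 < x := hx
      positivity
    refine ⟨K * J + 1, by positivity, fun R s t hR hs hs' ht => ?_⟩
    have hsre : 0 < s.re := by rw [hs]; positivity
    have ht' : 0 < |t| := abs_pos.2 ht.ne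
    have hi : IntegrableOn (fun x : ℝ => K * (t ^ 2)⁻¹ *
        (x ^ (j - 1) * Real.exp (-s.re * x ^ 2))) (Ioi 0) :=
      ((integrable_pow_mul_exp_neg_mul_sq hsre (j - 1)).const_mul _).integrableOn
    refine (norm_integral_Ioi_pow_succ_mul_cexp_le hsre hs' ht j hi fun x hx P h1 h2 h3 => ?_).trans
      ?_
    · have hP : 0 < P := ht'.trans_le h1
      rw [← mul_assoc]
      refine mul_le_mul_of_nonneg_right ?_ (Real.exp_pos _).le
      obtain ⟨i, rfl⟩ : ∃ i, j = i + 1 := ⟨j - 1, by omega⟩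
      simp only [Nat.add_sub_cancel] at *
      have e1 : 6 * (((i + 1 : ℕ) : ℝ) + 1) * (‖s‖ * x ^ (i + 1) / P ^ 3) ≤
          3 * (((i + 1 : ℕ) : ℝ) + 1) * (x ^ i / P ^ 2) := by
        calc _ = 3 * (((i + 1 : ℕ) : ℝ) + 1) * ((2 * ‖s‖ * x) * x ^ i / P ^ 3) := by ring
          _ ≤ 3 * (((i + 1 : ℕ) : ℝ) + 1) * (P * x ^ i / P ^ 3) := by gcongr
          _ = _ := by field_simp
      have e2 : 12 * (‖s‖ ^ 2 * x ^ (i + 1 + 1) / P ^ 4) ≤ 3 * (x ^ i / P ^ 2) := by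
        calc _ = 3 * ((2 * ‖s‖ * x) ^ 2 * x ^ i / P ^ 4) := by ring
          _ ≤ 3 * (P ^ 2 * x ^ i / P ^ 4) := by gcongr
          _ = _ := by field_simp
      have e3 : (P ^ 2)⁻¹ ≤ (t ^ 2)⁻¹ := by
        rw [← sq_abs t]
        gcongr
      calc _ ≤ (((i + 1 : ℕ) : ℝ) + 1) * ((i + 1 : ℕ) : ℝ) * x ^ i / P ^ 2 +
            3 * (((i + 1 : ℕ) : ℝ) + 1) * (x ^ i / P ^ 2) + 3 * (x ^ i / P ^ 2) := by gcongr
        _ = K * (P ^ 2)⁻¹ * x ^ i := by rw [hK]; ring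
        _ ≤ _ := by gcongr
    · have h6 := integral_comp_mul_left_Ioi (fun y : ℝ => y ^ (j - 1) * Real.exp (-1 * y ^ 2)) 0
        (inv_pos.2 hR)
      rw [mul_zero, ← hJ, inv_inv, smul_eq_mul] at h6
      have h7 : (∫ x in Ioi (0 : ℝ), K * (t ^ 2)⁻¹ * (x ^ (j - 1) * Real.exp (-s.re * x ^ 2)))
          = K * (t ^ 2)⁻¹ * (R ^ j * J) := by
        rw [integral_const_mul]
        congr 1
        have hRj : R ^ j = R ^ (j - 1) * R := by
          rw [← pow_succ]; congr 1; omega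
        rw [hRj, mul_assoc, ← h6, ← integral_const_mul]
        refine integral_congr_ae (Eventually.of_forall fun x => ?_)
        simp only [hs]
        rw [mul_pow, inv_pow, mul_pow, inv_pow]
        field_simp
      rw [h7, zero_pow hj.ne']
      nlinarith [mul_nonneg (pow_pos hR j).le (inv_nonneg.2 (sq_nonneg t))]

end

section

open MeasureTheory Set Filter Topology

theorem integral_eq_Ioi_add_comp_neg {φ : ℝ → ℂ} (hφ : Integrable φ) :
    ∫ x, φ x = (∫ x in Ioi (0 : ℝ), φ x) + ∫ x in Ioi (0 : ℝ), φ (-x) := by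
  rw [integral_comp_neg_Ioi, neg_zero, add_comm,
    intervalIntegral.integral_Iic_add_Ioi hφ.integrableOn hφ.integrableOn]

/-- The half-line Gaussian moment `∫_0^∞ x^k e^{-s x² + i t x} dx`. -/
noncomputable def halfMoment (k : ℕ) (s : ℂ) (t : ℝ) : ℂ :=
  ∫ x in Ioi (0 : ℝ), (x : ℂ) ^ k * Complex.exp (-s * (x : ℂ) ^ 2 + Complex.I * t * x)

theorem halfMoment_neg_add {s : ℂ} (hs : 0 < s.re) (k : ℕ) (t : ℝ) :
    halfMoment k s t + halfMoment k s (-t) =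
      (-1) ^ k * (gaussMass s * Complex.exp (-(t : ℂ) ^ 2 / (4 * s)) *
        hermFactor (Complex.I * t / 2) k s) + (1 - (-1) ^ k) * halfMoment k s t := by
  rw [← integral_pow_mul_cexp hs t k, integral_eq_Ioi_add_comp_neg (integrable_pow_mul_cexp hs t k)]
  have h : (∫ x in Ioi (0 : ℝ), ((-x : ℝ) : ℂ) ^ k *
      Complex.exp (-s * ((-x : ℝ) : ℂ) ^ 2 + Complex.I * t * ((-x : ℝ) : ℂ)))
      = (-1) ^ k * halfMoment k s (-t) := by
    rw [halfMoment, ← integral_const_mul]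
    refine integral_congr_ae (ae_of_all _ fun x => ?_)
    simp only
    rw [← mul_assoc, ← mul_pow]
    push_cast
    congr 2 <;> ring
  have h1 : ((-1 : ℂ) ^ k) * (-1) ^ k = 1 := by rw [← mul_pow]; simp
  rw [h, ← halfMoment]
  linear_combination (-halfMoment k s (-t)) * h1

theorem integrable_abs_pow_mul_cexp {s : ℂ} (hs : 0 < s.re) (t : ℝ) (k : ℕ) :
    Integrable fun x : ℝ =>
      ((|x| : ℝ) : ℂ) ^ k * Complex.exp (-s * (x : ℂ) ^ 2 + Complex.I * t * x) := by
  refine Integrable.mono (integrable_pow_mul_cexp hs t k)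
    (by fun_prop : Continuous _).aestronglyMeasurable (ae_of_all _ fun x => le_of_eq ?_)
  simp

open FourierTransform in
theorem fourier_abs_pow_mul_cexp {s : ℂ} (hs : 0 < s.re) (k : ℕ) (v : ℝ) :
    𝓕 (fun x : ℝ => ((|x| : ℝ) : ℂ) ^ k * Complex.exp (-s * (x : ℂ) ^ 2)) v =
      halfMoment k s (-2 * Real.pi * v) + halfMoment k s (-(-2 * Real.pi * v)) := by
  rw [Real.fourier_real_eq_integral_exp_smul]
  have h : ∀ x : ℝ, Complex.exp (((-2 * Real.pi * x * v : ℝ) : ℂ) * Complex.I) •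
      (((|x| : ℝ) : ℂ) ^ k * Complex.exp (-s * (x : ℂ) ^ 2)) = ((|x| : ℝ) : ℂ) ^ k *
        Complex.exp (-s * (x : ℂ) ^ 2 + Complex.I * ((-2 * Real.pi * v : ℝ) : ℂ) * x) := fun x => by
    rw [smul_eq_mul, Complex.exp_add]
    have : (((-2 * Real.pi * x * v : ℝ) : ℂ) * Complex.I)
      = Complex.I * ((-2 * Real.pi * v : ℝ) : ℂ) * x := by push_cast; ring
    rw [this]
    ring
  simp_rw [h]
  rw [integral_eq_Ioi_add_comp_neg (integrable_abs_pow_mul_cexp hs _ k)]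
  congr 1 <;> rw [halfMoment] <;> refine setIntegral_congr_fun measurableSet_Ioi fun x hx => ?_
  · simp only [abs_of_pos (show (0 : ℝ) < x from hx)]
  · simp only [abs_neg, abs_of_pos (show (0 : ℝ) < x from hx)]
    push_cast
    congr 2
    ring

theorem norm_cexp_neg_ofReal_div (q : ℝ) (s : ℂ) :
    ‖Complex.exp (-(q : ℂ) / s)‖ = Real.exp (-(q * s.re / ‖s‖ ^ 2)) := by
  rw [Complex.norm_exp]
  congr 1
  rw [← Complex.normSq_eq_norm_sq, Complex.div_re]
  simp
  ring

/-- Terms with polynomially growing amplitude and Gaussian decay in `m / (R ‖s‖)`. -/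
theorem exists_mul_norm_cexp_le (P L : ℕ) : ∃ K > 0, ∀ (R m : ℝ) (s : ℂ), 0 < R →
    s.re = (R ^ 2)⁻¹ → 0 ≤ m →
    (R + m / ‖s‖) ^ P * ‖Complex.exp (-((Real.pi ^ 2 * m ^ 2 : ℝ) : ℂ) / s)‖
      ≤ K * R ^ P * ((1 + m / (R * ‖s‖)) ^ L)⁻¹ := by
  refine ⟨(P + L).factorial * Real.exp 2, by positivity, fun R m s hR hs hm => ?_⟩
  have hn : 0 < ‖s‖ := norm_pos_iff.2 fun h => by
    rw [h, Complex.zero_re] at hs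
    have : 0 < (R ^ 2)⁻¹ := by positivity
    linarith
  set u : ℝ := m / (R * ‖s‖) with hu
  have hu0 : 0 ≤ u := by positivity
  have h := one_add_pow_mul_exp_neg_le (P + L) hu0
  rw [norm_cexp_neg_ofReal_div, hs]
  have e1 : Real.pi ^ 2 * m ^ 2 * (R ^ 2)⁻¹ / ‖s‖ ^ 2 = Real.pi ^ 2 * u ^ 2 := by
    rw [hu]; field_simp
  have e2 : R + m / ‖s‖ = R * (1 + u) := by rw [hu]; field_simp
  rw [e1, e2, mul_pow]
  have h1 : 0 < (1 + u) ^ L := by positivity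
  rw [← div_eq_mul_inv, le_div_iff₀ h1]
  calc R ^ P * (1 + u) ^ P * Real.exp (-(Real.pi ^ 2 * u ^ 2)) * (1 + u) ^ L
      = R ^ P * ((1 + u) ^ (P + L) * Real.exp (-(Real.pi ^ 2 * u ^ 2))) := by ring
    _ ≤ R ^ P * ((P + L).factorial * Real.exp 2) := by gcongr
    _ = _ := by ring

theorem summable_inv_one_add_mul_sq {a : ℝ} (ha : 0 < a) :
    Summable fun m : ℕ => ((1 + (m : ℝ) * a) ^ 2)⁻¹ := by
  have h : Summable fun m : ℕ => (a ^ 2)⁻¹ * ((m : ℝ) ^ 2)⁻¹ :=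
    (Real.summable_nat_pow_inv.2 one_lt_two).mul_left _
  rw [← summable_nat_add_iff 1] at h ⊢
  refine Summable.of_nonneg_of_le (fun m => by positivity) (fun m => ?_) h
  rw [← mul_inv, ← mul_pow]
  refine inv_anti₀ (by positivity) (pow_le_pow_left₀ (by positivity) ?_ 2)
  linarith

theorem abs_pow_mul_cexp_isBigO {s : ℂ} (hs : 0 < s.re) (k : ℕ) (ε : ℝ) :
    (fun x : ℝ => ((|ε + x| : ℝ) : ℂ) ^ k * Complex.exp (-s * ((ε + x : ℝ) : ℂ) ^ 2))
      =O[cocompact ℝ] fun x : ℝ => |x| ^ (-2 : ℝ) := by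
  have h := (cexp_neg_quadratic_isLittleO_abs_rpow_cocompact (a := -s) (by simpa using hs)
    (-s * (2 * ε)) (-2 - k)).isBigO.const_mul_left (Complex.exp (-s * ε ^ 2))
  have hev : ∀ᶠ x : ℝ in cocompact ℝ, 1 ≤ |x| :=
    (tendsto_norm_cocompact_atTop (E := ℝ)).eventually_ge_atTop 1
  have h1 : (fun x : ℝ => ((|ε + x| : ℝ) : ℂ) ^ k) =O[cocompact ℝ] fun x : ℝ => |x| ^ k := by
    refine Asymptotics.IsBigO.of_bound ((|ε| + 1) ^ k) ?_
    filter_upwards [hev] with x hx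
    simp only [norm_pow, Complex.norm_real, Real.norm_eq_abs, abs_abs]
    rw [← mul_pow]
    refine pow_le_pow_left₀ (abs_nonneg _) ((abs_add_le _ _).trans ?_) k
    nlinarith [abs_nonneg ε]
  refine ((h1.mul h).congr_left fun x => ?_).trans ?_
  · rw [← Complex.exp_add]
    push_cast
    congr 2
    ring
  · refine Asymptotics.IsBigO.of_bound 1 ?_
    filter_upwards [hev] with x hx
    have hx0 : 0 < |x| := one_pos.trans_le hx
    simp only [norm_mul, norm_pow, Real.norm_eq_abs, abs_abs]
    rw [abs_of_pos (Real.rpow_pos_of_pos hx0 _), abs_of_pos (Real.rpow_pos_of_pos hx0 _),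
      ← Real.rpow_natCast, ← Real.rpow_add hx0, one_mul]
    apply le_of_eq
    congr 1
    ring

theorem exists_norm_halfMoment_le (k : ℕ) : ∃ C > 0, ∀ (R : ℝ) (s : ℂ) (m : ℕ), 0 < R →
    s.re = (R ^ 2)⁻¹ → 0 ≤ s.im → m ≠ 0 →
    ‖(1 - (-1) ^ k) * halfMoment k s (-2 * Real.pi * m)‖ ≤
      C * (R ^ (k + 1) / R ^ 2) * ((m : ℝ) ^ 2)⁻¹ := by
  rcases k with _ | j
  · refine ⟨1, one_pos, fun R s m hR _ _ _ => ?_⟩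
    simp only [pow_zero, sub_self, zero_mul, norm_zero]
    positivity
  · obtain ⟨C, hC, h⟩ := exists_norm_integral_Ioi_pow_mul_cexp_le j
    refine ⟨2 * C, by positivity, fun R s m hR hs hs' hm => ?_⟩
    have hm' : (0 : ℝ) < m := by exact_mod_cast Nat.pos_of_ne_zero hm
    have ht : -2 * Real.pi * (m : ℝ) < 0 := by
      have := mul_pos Real.pi_pos hm'
      linarith
    have h2 : ‖(1 - (-1) ^ (j + 1) : ℂ)‖ ≤ 2 := (norm_sub_le _ _).trans (by simp; norm_num)
    have h3 := h R s _ hR hs hs' ht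
    have h4 : ((-2 * Real.pi * (m : ℝ)) ^ 2)⁻¹ ≤ ((m : ℝ) ^ 2)⁻¹ := by
      refine inv_anti₀ (by positivity) ?_
      have h5 : (1 : ℝ) ≤ Real.pi ^ 2 := by nlinarith [Real.pi_gt_three]
      nlinarith [sq_nonneg (m : ℝ)]
    rw [norm_mul]
    calc _ ≤ 2 * (C * R ^ j * ((-2 * Real.pi * (m : ℝ)) ^ 2)⁻¹) := by
          gcongr
          exact h3
      _ ≤ 2 * (C * R ^ j * ((m : ℝ) ^ 2)⁻¹) := by gcongr
      _ = _ := by field_simp; ring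

end

section

open MeasureTheory Set Filter Topology

/-- `θ` is, on the closed upper half of the right half-plane, a sum of oscillatory terms
`g_m(s) e^{-π² m²/s}` with explicit leading term `g_0(s) = (π/s)^{d/2} q(s)`, up to an error which
is smaller than the main term by a factor `R²`, where `Re s = R⁻²`. -/
def ThetaExpansion (d : ℕ) (a : ℝ) (θ : ℂ → ℂ) : Prop :=
  ∃ (C : ℝ) (q : Polynomial ℂ) (g : ℕ → ℂ → ℂ) (E : ℂ → ℂ), 0 < C ∧ 2 * q.natDegree + 1 ≤ d ∧
    q.coeff 0 = a ∧ (∀ s, g 0 s = gaussMass s ^ d * q.eval s) ∧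
    (∀ s : ℂ, 0 < s.re → 0 ≤ s.im → HasSum
      (fun m : ℕ => g m s * Complex.exp (-((Real.pi ^ 2 * (m : ℝ) ^ 2 : ℝ) : ℂ) / s))
      (θ s - E s)) ∧
    (∀ (R : ℝ) (s : ℂ) (m : ℕ), 1 ≤ R → 0 < s.re → (R ^ 2)⁻¹ ≤ ‖s‖ →
      SymbolBoundAt (g m) s (C * ((√‖s‖)⁻¹ * (R + m / ‖s‖) ^ (d - 1)))) ∧
    ∀ (R : ℝ) (s : ℂ), 1 ≤ R → s.re = (R ^ 2)⁻¹ → 0 ≤ s.im → ‖E s‖ ≤ C * (R ^ d / R ^ 2)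

namespace ThetaExpansion

variable {d : ℕ} {a b : ℝ} {θ φ : ℂ → ℂ}

theorem const_mul (c : ℝ) (h : ThetaExpansion d a θ) :
    ThetaExpansion d (c * a) fun s => c * θ s := by
  obtain ⟨C, q, g, E, hC, hq, ha, hg0, hsum, hsym, hE⟩ := h
  have hcC : |c| * C ≤ (|c| + 1) * C := by nlinarith
  refine ⟨(|c| + 1) * C, Polynomial.C (c : ℂ) * q, fun m s => c * g m s, fun s => c * E s,
    by positivity, ?_, by simp [ha], fun s => by simp [hg0]; ring, fun s hs hs' => ?_,
    fun R s m hR hs hsR => ?_, fun R s hR hs hs' => ?_⟩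
  · have := Polynomial.natDegree_C_mul_le (c : ℂ) q
    omega
  · simpa only [mul_sub, mul_assoc] using (hsum s hs hs').mul_left (c : ℂ)
  · refine ((hsym R s m hR hs hsR).const_mul (c : ℂ)).mono ?_
    rw [Complex.norm_real, Real.norm_eq_abs, ← mul_assoc]
    gcongr
  · rw [norm_mul, Complex.norm_real, Real.norm_eq_abs]
    calc _ ≤ |c| * (C * (R ^ d / R ^ 2)) := by gcongr; exact hE R s hR hs hs'
      _ = |c| * C * (R ^ d / R ^ 2) := by ring
      _ ≤ _ := by gcongr

theorem add (h : ThetaExpansion d a θ) (h' : ThetaExpansion d b φ) :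
    ThetaExpansion d (a + b) fun s => θ s + φ s := by
  obtain ⟨C, q, g, E, hC, hq, ha, hg0, hsum, hsym, hE⟩ := h
  obtain ⟨C', q', g', E', hC', hq', ha', hg0', hsum', hsym', hE'⟩ := h'
  refine ⟨C + C', q + q', fun m s => g m s + g' m s, fun s => E s + E' s,
    by positivity, ?_, by simp [ha, ha'], fun s => by simp [hg0, hg0']; ring, fun s hs hs' => ?_,
    fun R s m hR hs hsR => ?_, fun R s hR hs hs' => ?_⟩
  · have := Polynomial.natDegree_add_le q q'
    omega
  · have := (hsum s hs hs').add (hsum' s hs hs')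
    simp only [← add_mul] at this
    convert! this using 1
    ring
  · rw [add_mul]
    exact (hsym R s m hR hs hsR).add (hsym' R s m hR hs hsR)
  · rw [add_mul]
    exact (norm_add_le _ _).trans (add_le_add (hE R s hR hs hs') (hE' R s hR hs hs'))

theorem add_two (h : ThetaExpansion d a θ) : ThetaExpansion (d + 2) 0 θ := by
  obtain ⟨C, q, g, E, hC, hq, ha, hg0, hsum, hsym, hE⟩ := h
  refine ⟨C, Polynomial.C ((Real.pi : ℂ)⁻¹) * q * Polynomial.X, g, E, hC, ?_, by simp,
    fun s => ?_, hsum, fun R s m hR hs hsR => ?_, fun R s hR hs hs' => ?_⟩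
  · have h1 := Polynomial.natDegree_mul_le (p := Polynomial.C ((Real.pi : ℂ)⁻¹) * q)
      (q := Polynomial.X)
    have h2 := Polynomial.natDegree_C_mul_le ((Real.pi : ℂ)⁻¹) q
    have h3 := Polynomial.natDegree_X_le (R := ℂ)
    omega
  · have hpi : (Real.pi : ℂ) ≠ 0 := by exact_mod_cast Real.pi_ne_zero
    rw [hg0, pow_add, gaussMass_sq]
    simp only [Polynomial.eval_mul, Polynomial.eval_C, Polynomial.eval_X]
    rcases eq_or_ne s 0 with rfl | hs
    · have : gaussMass 0 = 0 := by
        have := gaussMass_sq 0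
        simpa using this
      rw [this, zero_pow (by omega)]
      simp
    · field_simp
  · refine (hsym R s m hR hs hsR).mono ?_
    have h1 : 1 ≤ R + m / ‖s‖ := hR.trans (le_add_of_nonneg_right (by positivity))
    gcongr 2
    exact pow_le_pow_right₀ h1 (by omega)
  · refine (hE R s hR hs hs').trans ?_
    gcongr 2
    exact pow_le_pow_right₀ hR (by omega)

end ThetaExpansion

theorem symbolBoundAt_gaussMass_pow (k : ℕ) {R : ℝ} {s : ℂ} (hR : 1 ≤ R)
    (hs : 0 < s.re) (hsR : (R ^ 2)⁻¹ ≤ ‖s‖) :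
    SymbolBoundAt (fun z => gaussMass z ^ (k + 1)) s
      ((2 * √Real.pi) ^ (k + 1) * ((√‖s‖)⁻¹ * R ^ k)) := by
  have hn : 0 < ‖s‖ := norm_pos_iff.2 fun h => by simp [h] at hs
  have h := SymbolBoundAt.prod (Finset.range (k + 1)) (F := fun _ => gaussMass)
    (fun _ _ => symbolBoundAt_gaussMass hs)
  simp only [Finset.prod_const, Finset.card_range] at h
  refine h.mono ?_
  have h1 : (√‖s‖)⁻¹ ≤ R := by
    rw [← Real.sqrt_inv]
    exact Real.sqrt_le_iff.2 ⟨by positivity, by rw [← inv_inv (R ^ 2)]; gcongr⟩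
  calc (2 : ℝ) ^ (k + 1) * (√Real.pi * (√‖s‖)⁻¹) ^ (k + 1)
      = (2 * √Real.pi) ^ (k + 1) * ((√‖s‖)⁻¹ * ((√‖s‖)⁻¹) ^ k) := by ring
    _ ≤ _ := by gcongr

theorem exists_symbolBoundAt_gaussMass_mul_hermFactor (k : ℕ) : ∃ C > 0, ∀ (R m : ℝ) (μ s : ℂ),
    1 ≤ R → 0 ≤ m → ‖μ‖ ≤ 4 * m → 0 < s.re → (R ^ 2)⁻¹ ≤ ‖s‖ →
    SymbolBoundAt (fun z => gaussMass z * hermFactor μ k z) s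
      (C * ((√‖s‖)⁻¹ * (R + m / ‖s‖) ^ k)) := by
  obtain ⟨C, hC, h⟩ := symbolBoundAt_hermFactor k
  refine ⟨2 * (√Real.pi * C), by positivity, fun R m μ s hR hm hμ hs hsR => ?_⟩
  have hs0 : s ≠ 0 := fun h => by simp [h] at hs
  refine ((symbolBoundAt_gaussMass hs).mul (h R m μ s hR hm hμ hs0 hsR)).mono (le_of_eq ?_)
  ring

theorem summable_pow_mul_norm_cexp {s : ℂ} (hs : 0 < s.re) (P : ℕ) {R : ℝ} (hR : 0 ≤ R) :
    Summable fun m : ℕ => (R + m / ‖s‖) ^ P *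
      ‖Complex.exp (-((Real.pi ^ 2 * (m : ℝ) ^ 2 : ℝ) : ℂ) / s)‖ := by
  obtain ⟨K, hK, hexp⟩ := exists_mul_norm_cexp_le P 2
  have hn : 0 < ‖s‖ := norm_pos_iff.2 fun h => by simp [h] at hs
  set r : ℝ := (√s.re)⁻¹ with hr
  have hr0 : 0 < r := by positivity
  have hrs : s.re = (r ^ 2)⁻¹ := by rw [hr, inv_pow, inv_inv, Real.sq_sqrt hs.le]
  have h := ((summable_inv_one_add_mul_sq (a := (r * ‖s‖)⁻¹) (by positivity)).mul_left
    ((1 + R / r) ^ P * (K * r ^ P)))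
  refine Summable.of_nonneg_of_le (fun m => by positivity) (fun m => ?_) h
  have h1 : R + m / ‖s‖ ≤ (1 + R / r) * (r + m / ‖s‖) := by
    have : (1 + R / r) * (r + m / ‖s‖) = (R + m / ‖s‖) + (r + R / r * (m / ‖s‖)) := by
      field_simp
      ring
    rw [this]
    exact le_add_of_nonneg_right (by positivity)
  calc _ ≤ ((1 + R / r) * (r + m / ‖s‖)) ^ P *
        ‖Complex.exp (-((Real.pi ^ 2 * (m : ℝ) ^ 2 : ℝ) : ℂ) / s)‖ := by gcongr
    _ = (1 + R / r) ^ P * ((r + m / ‖s‖) ^ P *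
        ‖Complex.exp (-((Real.pi ^ 2 * (m : ℝ) ^ 2 : ℝ) : ℂ) / s)‖) := by rw [mul_pow, mul_assoc]
    _ ≤ (1 + R / r) ^ P * (K * r ^ P * ((1 + m / (r * ‖s‖)) ^ 2)⁻¹) :=
        mul_le_mul_of_nonneg_left (hexp r m s hr0 hrs m.cast_nonneg) (by positivity)
    _ = _ := by rw [← mul_assoc, div_eq_mul_inv (m : ℝ)]

open FourierTransform in
/-- Poisson summation for the shifted lattice sum of `|x|^k e^{-s x²}`. -/
theorem exists_thetaExpansion_lattice (k : ℕ) (ε : ℝ) : ∃ θ : ℂ → ℂ,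
    (∀ s : ℂ, 0 < s.re → HasSum (fun n : ℤ => ((|ε + n| : ℝ) : ℂ) ^ k *
      Complex.exp (-s * ((ε + n : ℝ) : ℂ) ^ 2)) (θ s)) ∧
    ThetaExpansion (k + 1) (momentConst k) θ := by
  obtain ⟨C₁, hC₁, hG⟩ := exists_symbolBoundAt_gaussMass_mul_hermFactor k
  obtain ⟨C₂, hC₂, hH⟩ := exists_norm_halfMoment_le k
  set γ : ℕ → ℂ := fun m => fourier (m : ℤ) (ε : UnitAddCircle) +
    fourier (-(m : ℤ)) (ε : UnitAddCircle) with hγ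
  have hf1 : ∀ m : ℤ, ‖(fourier m (ε : UnitAddCircle) : ℂ)‖ = 1 := fun m => by
    rw [fourier_apply]; exact Circle.norm_coe _
  have hγ2 : ∀ m, ‖γ m‖ ≤ 2 := fun m => by
    refine (norm_add_le _ _).trans ?_
    rw [hf1, hf1]; norm_num
  set f : ℂ → ℝ → ℂ := fun s x => ((|x| : ℝ) : ℂ) ^ k * Complex.exp (-s * (x : ℂ) ^ 2) with hf
  set μ : ℕ → ℂ := fun m => Complex.I * ((-2 * Real.pi * m : ℝ) : ℂ) / 2 with hμ
  have hμn : ∀ m, ‖μ m‖ ≤ 4 * m := fun m => by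
    simp only [hμ, norm_mul, norm_div, Complex.norm_I, Complex.norm_real, Complex.norm_ofNat,
      Real.norm_eq_abs, abs_neg, abs_two, abs_of_pos Real.pi_pos, Nat.abs_cast]
    nlinarith [Real.pi_lt_four, (Nat.cast_nonneg m : (0 : ℝ) ≤ m)]
  set A : ℕ → ℂ → ℂ := fun m s => gaussMass s * hermFactor (μ m) k s with hA
  set e : ℕ → ℂ → ℂ := fun m s =>
    Complex.exp (-((Real.pi ^ 2 * (m : ℝ) ^ 2 : ℝ) : ℂ) / s) with he
  set H : ℕ → ℂ → ℂ := fun m s => (1 - (-1) ^ k) * halfMoment k s (-2 * Real.pi * m) with hHd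
  have hF : ∀ s : ℂ, 0 < s.re → ∀ m : ℕ, 𝓕 (f s) (m : ℝ) = (-1) ^ k * (A m s * e m s) + H m s :=
    fun s hs m => by
    have hs0 : s ≠ 0 := fun h => by simp [h] at hs
    rw [hf, fourier_abs_pow_mul_cexp hs, halfMoment_neg_add hs]
    simp only [hA, he, hHd, hμ]
    have : -(((-2 * Real.pi * m : ℝ) : ℂ)) ^ 2 / (4 * s)
        = -((Real.pi ^ 2 * (m : ℝ) ^ 2 : ℝ) : ℂ) / s := by
      push_cast
      field_simp
      ring
    rw [this]
    ring
  have hFneg : ∀ s : ℂ, 0 < s.re → ∀ v : ℝ, 𝓕 (f s) (-v) = 𝓕 (f s) v := fun s hs v => by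
    rw [hf, fourier_abs_pow_mul_cexp hs, fourier_abs_pow_mul_cexp hs, add_comm]
    congr 2 <;> ring
  have hF0 : ∀ s : ℂ, 0 < s.re → 𝓕 (f s) 0 = momentConst k * gaussMass s ^ (k + 1) :=
    fun s hs => by
    rw [hf, fourier_abs_pow_mul_cexp hs, ← integral_Ioi_pow_mul_cexp hs k]
    simp [halfMoment]
    ring
  set g : ℕ → ℂ → ℂ := fun m s => if m = 0 then momentConst k * gaussMass s ^ (k + 1)
    else γ m * (-1) ^ k * A m s with hg
  set E : ℕ → ℂ → ℂ := fun m s => if m = 0 then 0 else γ m * H m s with hEd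
  have hRs : ∀ s : ℂ, 0 < s.re → 0 < (√s.re)⁻¹ ∧ s.re = ((√s.re)⁻¹ ^ 2)⁻¹ := fun s hs =>
    ⟨by positivity, by rw [inv_pow, inv_inv, Real.sq_sqrt hs.le]⟩
  have hEb : ∀ (R : ℝ) (s : ℂ) (m : ℕ), 0 < R → s.re = (R ^ 2)⁻¹ → 0 ≤ s.im →
      ‖E m s‖ ≤ 2 * C₂ * (R ^ (k + 1) / R ^ 2) * ((m : ℝ) ^ 2)⁻¹ := fun R s m hR hs hs' => by
    simp only [hEd]
    split_ifs with hm
    · rw [norm_zero]; positivity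
    · rw [norm_mul]
      calc _ ≤ 2 * (C₂ * (R ^ (k + 1) / R ^ 2) * ((m : ℝ) ^ 2)⁻¹) :=
            mul_le_mul (hγ2 m) (hH R s m hR hs hs' hm) (norm_nonneg _) zero_le_two
        _ = _ := by ring
  have hsq : Summable fun m : ℕ => ((m : ℝ) ^ 2)⁻¹ := Real.summable_nat_pow_inv.2 one_lt_two
  have hEsum : ∀ s : ℂ, 0 < s.re → 0 ≤ s.im → Summable fun m => ‖E m s‖ := fun s hs hs' => by
    obtain ⟨hr, hrs⟩ := hRs s hs
    exact Summable.of_nonneg_of_le (fun m => norm_nonneg _) (fun m => hEb _ s m hr hrs hs')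
      (hsq.mul_left _)
  have hEle : ∀ (R : ℝ) (s : ℂ), 0 < R → s.re = (R ^ 2)⁻¹ → 0 ≤ s.im →
      ‖∑' m, E m s‖ ≤ 2 * C₂ * (∑' m : ℕ, ((m : ℝ) ^ 2)⁻¹) * (R ^ (k + 1) / R ^ 2) :=
    fun R s hR hs hs' => by
    refine (tsum_of_norm_bounded (hsq.hasSum.mul_left _)
      fun m => hEb R s m hR hs hs').trans (le_of_eq ?_)
    ring
  have hAsum : ∀ s : ℂ, 0 < s.re → Summable fun m => ‖A m s * e m s‖ := fun s hs => by
    obtain ⟨hr, hrs⟩ := hRs s hs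
    set R := max 1 (√s.re)⁻¹ with hR
    have hR1 : 1 ≤ R := le_max_left _ _
    have hRn : (R ^ 2)⁻¹ ≤ ‖s‖ := by
      refine le_trans ?_ ((le_of_eq hrs.symm).trans (Complex.re_le_norm s))
      gcongr
      exact le_max_right _ _
    refine Summable.of_nonneg_of_le (fun m => norm_nonneg _) (fun m => ?_)
      ((summable_pow_mul_norm_cexp hs k (zero_le_one.trans hR1)).mul_left (C₁ * (√‖s‖)⁻¹))
    rw [norm_mul, ← mul_assoc, mul_assoc C₁]
    exact mul_le_mul_of_nonneg_right (hG R m (μ m) s hR1 m.cast_nonneg (hμn m) hs hRn).1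
      (norm_nonneg _)
  have hgsum : ∀ s : ℂ, 0 < s.re → Summable fun m => ‖g m s * e m s‖ := fun s hs => by
    rw [← summable_nat_add_iff 1]
    refine Summable.of_nonneg_of_le (fun m => norm_nonneg _) (fun m => ?_)
      (((summable_nat_add_iff 1).2 (hAsum s hs)).mul_left 2)
    simp only [hg, Nat.succ_ne_zero, if_false, norm_mul, norm_pow, norm_neg, norm_one, one_pow,
      mul_assoc, one_mul]
    exact mul_le_mul_of_nonneg_right (hγ2 _) (by positivity)
  have hterm : ∀ s : ℂ, 0 < s.re → ∀ m : ℕ, g m s * e m s + E m s =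
      𝓕 (f s) (m : ℝ) * γ m - if m = 0 then 𝓕 (f s) 0 else 0 := fun s hs m => by
    simp only [hg, hEd]
    split_ifs with hm
    · rw [hm, Nat.cast_zero, hF0 s hs]
      simp [he, hγ]
      ring
    · rw [hF s hs m]
      ring
  have hFnat : ∀ s : ℂ, 0 < s.re → 0 ≤ s.im → Summable fun n : ℕ => 𝓕 (f s) (n : ℝ) :=
    fun s hs hs' => by
    obtain ⟨hr, hrs⟩ := hRs s hs
    rw [← summable_nat_add_iff 1]
    have h1 : Summable fun m : ℕ => ‖A m s * e m s‖ + C₂ * ((√s.re)⁻¹ ^ (k + 1) / (√s.re)⁻¹ ^ 2) *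
        ((m : ℝ) ^ 2)⁻¹ := (hAsum s hs).add (hsq.mul_left _)
    refine Summable.of_norm_bounded ((summable_nat_add_iff 1).2 h1) fun m => ?_
    rw [hF s hs]
    refine (norm_add_le _ _).trans (add_le_add (le_of_eq ?_)
      (hH _ s (m + 1) hr hrs hs' m.succ_ne_zero))
    rw [norm_mul, norm_pow, norm_neg, norm_one, one_pow, one_mul]
  have hFsum : ∀ s : ℂ, 0 < s.re → 0 ≤ s.im → Summable fun n : ℤ => 𝓕 (f s) n :=
    fun s hs hs' => by
    refine Summable.of_nat_of_neg ?_ ?_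
    · simpa using hFnat s hs hs'
    · simpa [hFneg s hs] using hFnat s hs hs'
  refine ⟨fun s => ∑' n : ℤ, f s (ε + n), fun s hs => ?_,
    max (max ((‖(momentConst k : ℂ)‖ * (2 * √Real.pi) ^ (k + 1))) (2 * C₁))
      (2 * C₂ * (∑' m : ℕ, ((m : ℝ) ^ 2)⁻¹)), Polynomial.C (momentConst k : ℂ), g,
    fun s => ∑' m, E m s, lt_max_of_lt_left (lt_max_of_lt_right (by positivity)), by simp, by simp,
    fun s => ?_, fun s hs hs' => ?_, fun R s m hR hs hsR => ?_, fun R s hR hs hs' => ?_⟩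
  · have h := (abs_pow_mul_cexp_isBigO hs k ε).comp_tendsto Int.tendsto_coe_cofinite
    exact (summable_of_isBigO (Real.summable_abs_int_rpow (by norm_num)) h).hasSum
  · simp [hg, mul_comm]
  · have hP : ∑' n : ℤ, f s (ε + n) = ∑' n : ℤ, 𝓕 (f s) n * fourier n (ε : UnitAddCircle) :=
      Real.tsum_eq_tsum_fourier_of_rpow_decay_of_summable (by fun_prop) one_lt_two
        (by simpa [hf] using abs_pow_mul_cexp_isBigO hs k 0) (hFsum s hs hs') ε
    have hs2 : Summable fun n : ℤ => 𝓕 (f s) n * fourier n (ε : UnitAddCircle) := by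
      refine Summable.of_norm ?_
      simpa only [norm_mul, hf1, mul_one] using (hFsum s hs hs').norm
    have h1 := hs2.hasSum.nat_add_neg
    have h2 := h1.sub (hasSum_ite_eq 0 (𝓕 (f s) 0))
    have h3 := h2.sub (hEsum s hs hs').of_norm.hasSum
    rw [← hP] at h3
    convert! h3 using 1
    · funext m
      have h4 := hterm s hs m
      simp only [Int.cast_neg, Int.cast_natCast, hFneg s hs]
      linear_combination h4
    · simp
  · have hRm : R ≤ R + m / ‖s‖ := le_add_of_nonneg_right (by positivity)
    simp only [Nat.add_sub_cancel]
    rcases eq_or_ne m 0 with rfl | hm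
    · have hg0 : g 0 = fun z => momentConst k * gaussMass z ^ (k + 1) := by
        funext z; simp only [hg, if_true]
      rw [hg0]
      refine ((symbolBoundAt_gaussMass_pow k hR hs hsR).const_mul (momentConst k : ℂ)).mono ?_
      rw [← mul_assoc]
      exact mul_le_mul ((le_max_left _ _).trans (le_max_left _ _)) (by gcongr) (by positivity)
        (by positivity)
    · have hgm : g m = fun z => γ m * (-1) ^ k * A m z := by
        funext z; simp only [hg, hm, if_false]
      rw [hgm]
      refine ((hG R m (μ m) s hR m.cast_nonneg (hμn m) hs hsR).const_mul
        (γ m * (-1) ^ k)).mono ?_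
      have : ‖γ m * (-1) ^ k‖ ≤ 2 := by simpa using hγ2 m
      rw [← mul_assoc]
      refine mul_le_mul_of_nonneg_right (le_trans ?_ ((le_max_right _ _).trans (le_max_left _ _)))
        (by positivity)
      gcongr
  · refine (hEle R s (by positivity) hs hs').trans ?_
    gcongr
    exact le_max_right _ _

end

section

open MeasureTheory Set Filter Topology

/-- The multiplicity of the `k`-th eigenvalue of the sphere `S^d`. -/
noncomputable def sphereMult (d k : ℕ) : ℝ :=
  ((d + k).choose d : ℝ) - ((d + k - 2).choose d : ℝ)

theorem sphereMult_nonneg (d k : ℕ) : 0 ≤ sphereMult d k :=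
  sub_nonneg.2 (by exact_mod_cast Nat.choose_le_choose d (by omega))

theorem sphereMult_mul_factorial (d k N : ℕ) (h : k + d = N + 1) :
    sphereMult (d + 1) k * (k.factorial * d.factorial) = (2 * k + d) * N.factorial := by
  rw [sphereMult]
  obtain _ | _ | k := k
  · obtain rfl : d = N + 1 := by omega
    rw [Nat.choose_eq_zero_of_lt (by omega : N + 1 + 1 + 0 - 2 < N + 1 + 1)]
    simp [Nat.factorial_succ]
  · obtain rfl : d = N := by omega
    rw [Nat.choose_eq_zero_of_lt (by omega : d + 1 + (0 + 1) - 2 < d + 1)]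
    simp
    left
    ring
  · obtain rfl : N = k + (d + 1) := by omega
    have h1 := Nat.add_choose_mul_factorial_mul_factorial (k + 2) (d + 1)
    have h2 := Nat.add_choose_mul_factorial_mul_factorial k (d + 1)
    rw [show d + 1 + (k + 1 + 1) = k + 2 + (d + 1) by ring,
      show k + 2 + (d + 1) - 2 = k + (d + 1) by omega]
    rw [show k + 2 + (d + 1) = k + (d + 1) + 1 + 1 by ring] at h1 ⊢
    have h1' := congrArg (Nat.cast : ℕ → ℝ) h1
    have h2' := congrArg (Nat.cast : ℕ → ℝ) h2
    simp only [Nat.factorial_succ (k + (d + 1)), Nat.factorial_succ (k + (d + 1) + 1),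
      Nat.factorial_succ d, Nat.factorial_succ k, Nat.factorial_succ (k + 1), Nat.cast_mul,
      Nat.cast_add, Nat.cast_one] at h1' h2' ⊢
    have hd : ((d : ℝ) + 1) ≠ 0 := by positivity
    refine mul_right_cancel₀ hd ?_
    linear_combination h1' - ((k : ℝ) + 1 + 1) * (k + 1) * h2'

theorem sphereMult_add_two (e k : ℕ) :
    sphereMult (e + 3) k * ((e + 1) * (e + 2)) =
      sphereMult (e + 1) (k + 1) * ((k + 1) * (k + e + 1)) := by
  have h1 := sphereMult_mul_factorial (e + 2) k (k + e + 1) (by ring)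
  have h2 := sphereMult_mul_factorial e (k + 1) (k + e) (by ring)
  have hk : (0 : ℝ) < k.factorial := by exact_mod_cast k.factorial_pos
  have he : (0 : ℝ) < e.factorial := by exact_mod_cast e.factorial_pos
  simp only [Nat.factorial_succ, Nat.cast_mul, Nat.cast_add, Nat.cast_one, Nat.cast_ofNat] at h1 h2
  refine mul_right_cancel₀ (mul_pos hk he).ne' ?_
  linear_combination h1 - (k + e + 1 : ℝ) * h2

theorem exists_thetaExpansion_sphere (e : ℕ) : ∀ j : ℕ, ∃ θ : ℂ → ℂ,
    (∀ s : ℂ, 0 < s.re → HasSum (fun k : ℕ => ((sphereMult (e + 1) k : ℝ) : ℂ) *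
      (((k + e / 2 : ℝ) : ℂ) ^ (2 * j) * Complex.exp (-s * ((k + e / 2 : ℝ) : ℂ) ^ 2))) (θ s)) ∧
    ThetaExpansion (e + 1 + 2 * j) (momentConst (e + 2 * j) / e.factorial) θ := by
  induction e using Nat.twoStepInduction with
  | zero =>
    intro j
    obtain ⟨θ, h1, h2⟩ := exists_thetaExpansion_lattice (2 * j) 0
    refine ⟨θ, fun s hs => ?_, by simpa [add_comm] using h2⟩
    have h3 := (h1 s hs).nat_add_neg.sub (hasSum_ite_eq 0 ((((|(0 : ℝ) + ((0 : ℤ) : ℝ)| : ℝ) : ℂ) ^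
      (2 * j) * Complex.exp (-s * (((0 : ℝ) + ((0 : ℤ) : ℝ) : ℝ) : ℂ) ^ 2))))
    rw [add_sub_cancel_right] at h3
    convert! h3 using 1
    funext k
    have hev : ∀ x : ℝ, ((|x| : ℝ) : ℂ) ^ (2 * j) = (x : ℂ) ^ (2 * j) := fun x => by
      rw [pow_mul, pow_mul, ← Complex.ofReal_pow, sq_abs, Complex.ofReal_pow]
    simp only [hev]
    rcases k with _ | k
    · simp [sphereMult]
    · have hm : sphereMult (0 + 1) (k + 1) = 2 := by
        have : 0 + 1 + (k + 1) - 2 = k := by omega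
        rw [sphereMult, this]
        simp
        ring
      rw [hm, if_neg k.succ_ne_zero]
      simp [pow_mul]
      ring_nf
  | one =>
    intro j
    obtain ⟨θ, h1, h2⟩ := exists_thetaExpansion_lattice (2 * j + 1) (1 / 2)
    refine ⟨θ, fun s hs => ?_, by
      rw [show 1 + 1 + 2 * j = 2 * j + 1 + 1 by ring, show 1 + 2 * j = 2 * j + 1 by ring]
      simpa using h2⟩
    have h3 := (h1 s hs).nat_add_neg_add_one
    convert! h3 using 1
    funext k
    have hm : sphereMult (1 + 1) k = 2 * (k + 1 / 2) := by
      have h := sphereMult_mul_factorial 1 k k rfl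
      have hk : (k.factorial : ℝ) ≠ 0 := by positivity
      refine mul_right_cancel₀ hk ?_
      rw [Nat.factorial_one, Nat.cast_one, mul_one] at h
      rw [h]
      ring
    have h4 : ∀ x : ℝ, 0 ≤ x → ((|-x| : ℝ) : ℂ) = x := fun x hx => by rw [abs_neg, abs_of_nonneg hx]
    have h5 : (1 / 2 : ℝ) + ((-((k : ℤ) + 1) : ℤ) : ℝ) = -(k + 1 / 2) := by push_cast; ring
    have h6 : (1 / 2 : ℝ) + ((k : ℤ) : ℝ) = k + 1 / 2 := by push_cast; ring
    rw [hm, h5, h6, h4 _ (by positivity), abs_of_nonneg (by positivity)]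
    simp only [Nat.cast_one]
    generalize ((k : ℝ) + 1 / 2) = x
    push_cast
    rw [neg_sq]
    ring
  | more e ih _ =>
    intro j
    obtain ⟨θ₁, h1, h1'⟩ := ih (j + 1)
    obtain ⟨θ₀, h0, h0'⟩ := ih j
    refine ⟨fun s => ((((e + 1) * (e + 2) : ℝ)⁻¹ : ℝ) : ℂ) *
      (θ₁ s + ((-(e / 2) ^ 2 : ℝ) : ℂ) * θ₀ s), fun s hs => ?_, ?_⟩
    · have h2 := (((h1 s hs).add ((h0 s hs).mul_left ((-(e / 2) ^ 2 : ℝ) : ℂ))).mul_left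
        ((((e + 1) * (e + 2) : ℝ)⁻¹ : ℝ) : ℂ))
      rw [← hasSum_nat_add_iff' 1] at h2
      convert! h2 using 1
      · funext k
        have hr := sphereMult_add_two e k
        have hr' : (sphereMult (e + 3) k : ℂ) = ((((e + 1) * (e + 2) : ℝ)⁻¹ : ℝ) : ℂ) *
            ((sphereMult (e + 1) (k + 1) : ℂ) * ((k + 1) * (k + e + 1))) := by
          have h5 : ((e : ℝ) + 1) * (e + 2) ≠ 0 := by positivity
          have h6 : sphereMult (e + 3) k = ((e + 1) * (e + 2) : ℝ)⁻¹ *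
              (sphereMult (e + 1) (k + 1) * ((k + 1) * (k + e + 1))) := by
            rw [← hr]
            field_simp
          rw [h6]
          push_cast
          ring
        rw [hr']
        have hx : (((k : ℝ) + ((e + 2 : ℕ) : ℝ) / 2 : ℝ) : ℂ) =
          ((((k + 1 : ℕ) : ℝ) + (e : ℝ) / 2 : ℝ) : ℂ) := by push_cast; ring
        rw [hx]
        generalize Complex.exp _ = E
        push_cast
        ring
      · simp
        ring
    · have h3 := (h1'.add (h0'.const_mul (-(e / 2) ^ 2)).add_two).const_mul
        (((e + 1) * (e + 2) : ℝ)⁻¹)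
      convert! h3 using 1
      · ring
      · rw [Nat.factorial_succ, Nat.factorial_succ, show e + 2 + 2 * j = e + 2 * (j + 1) by ring]
        push_cast
        have : (e.factorial : ℝ) ≠ 0 := by positivity
        field_simp
        ring

end

section

open MeasureTheory Set Filter Topology

theorem norm_rpow_line {c δ : ℝ} (hc : 0 < c) (y : ℝ) :
    ‖(c : ℂ) + Complex.I * y‖ ^ (-(1 + δ)) =
      c ^ (-(1 + δ)) * (1 + ‖y / c‖ ^ 2) ^ (-(1 + δ) / 2) := by
  have h : ‖(c : ℂ) + Complex.I * y‖ = c * (1 + ‖y / c‖ ^ 2) ^ (1 / 2 : ℝ) := by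
    rw [← Real.sqrt_eq_rpow, mul_comm Complex.I, Complex.norm_add_mul_I, Real.norm_eq_abs, sq_abs]
    nth_rewrite 2 [← Real.sqrt_sq hc.le]
    rw [← Real.sqrt_mul (by positivity)]
    congr 1
    field_simp
  rw [h, Real.mul_rpow hc.le (by positivity), ← Real.rpow_mul (by positivity)]
  congr 2
  ring

theorem integrable_norm_line_rpow {c δ : ℝ} (hc : 0 < c) (hδ : 0 < δ) :
    Integrable fun y : ℝ => ‖(c : ℂ) + Complex.I * y‖ ^ (-(1 + δ)) := by
  have h := integrable_rpow_neg_one_add_norm_sq (E := ℝ) (μ := volume) (r := 1 + δ)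
    (by simp [hδ])
  exact ((h.comp_div hc.ne').const_mul (c ^ (-(1 + δ)))).congr
    (.of_forall fun y => (norm_rpow_line hc y).symm)

theorem integral_norm_line_rpow {c δ : ℝ} (hc : 0 < c) :
    ∫ y : ℝ, ‖(c : ℂ) + Complex.I * y‖ ^ (-(1 + δ)) =
      c ^ (-δ) * ∫ y : ℝ, (1 + ‖y‖ ^ 2) ^ (-(1 + δ) / 2) := by
  simp_rw [norm_rpow_line hc]
  rw [integral_const_mul, Measure.integral_comp_div
    (fun y : ℝ => (1 + ‖y‖ ^ 2) ^ (-(1 + δ) / 2)) c, smul_eq_mul, abs_of_pos hc, ← mul_assoc,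
    ← Real.rpow_add_one hc.ne']
  congr 2
  ring

theorem line_ne_zero {c : ℝ} (hc : 0 < c) (y : ℝ) : (c : ℂ) + Complex.I * y ≠ 0 := by
  intro h
  have := congrArg Complex.re h
  simp at this
  exact hc.ne' this

theorem integrable_inv_line_sq {c : ℝ} (hc : 0 < c) :
    Integrable fun y : ℝ => (((c : ℂ) + Complex.I * y) ^ 2)⁻¹ := by
  refine (integrable_norm_line_rpow hc one_pos).mono' ?_ (.of_forall fun y => ?_)
  · exact (Continuous.inv₀ (by fun_prop) fun y =>
      pow_ne_zero _ (line_ne_zero hc y)).aestronglyMeasurable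
  · rw [norm_inv, norm_pow, Real.rpow_neg (norm_nonneg _)]
    norm_num

theorem integral_Ioi_mul_cexp_neg {s : ℂ} (hs : 0 < s.re) :
    IntegrableOn (fun u : ℝ => (u : ℂ) * Complex.exp (-s * u)) (Ioi 0) ∧
      ∫ u in Ioi (0 : ℝ), (u : ℂ) * Complex.exp (-s * u) = (s ^ 2)⁻¹ := by
  have hs0 : s ≠ 0 := by rintro rfl; simp at hs
  have hnorm : ∀ u : ℝ, ‖Complex.exp (-s * u)‖ = Real.exp (-s.re * u) := fun u => by
    rw [Complex.norm_exp]; simp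
  have hint : IntegrableOn (fun u : ℝ => (u : ℂ) * Complex.exp (-s * u)) (Ioi 0) := by
    have h := integrableOn_rpow_mul_exp_neg_mul_rpow (p := 1) (s := 1) (b := s.re)
      (by norm_num) one_pos hs
    refine Integrable.mono' h (Continuous.aestronglyMeasurable (by fun_prop)) ?_
    filter_upwards [ae_restrict_mem measurableSet_Ioi] with u (hu : 0 < u)
    rw [norm_mul, hnorm]
    simp [abs_of_pos hu]
  refine ⟨hint, ?_⟩
  have hd : ∀ u : ℝ, HasDerivAt
      (fun u : ℝ => -((u : ℂ) * Complex.exp (-s * u)) / s - Complex.exp (-s * u) / s ^ 2)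
      ((u : ℂ) * Complex.exp (-s * u)) u := by
    intro u
    have h1 : HasDerivAt (fun u : ℝ => Complex.exp (-s * u)) (Complex.exp (-s * u) * (-s)) u := by
      have := ((hasDerivAt_id (u : ℂ)).const_mul (-s)).cexp.comp_ofReal
      simpa using this
    have h2 : HasDerivAt (fun u : ℝ => (u : ℂ)) 1 u := Complex.ofRealCLM.hasDerivAt
    convert! (((h2.mul h1).neg).div_const s).sub (h1.div_const (s ^ 2)) using 1
    field_simp
    ring
  have ht : Tendsto
      (fun u : ℝ => -((u : ℂ) * Complex.exp (-s * u)) / s - Complex.exp (-s * u) / s ^ 2)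
      atTop (𝓝 0) := by
    have h1 : Tendsto (fun u : ℝ => (u : ℂ) * Complex.exp (-s * u)) atTop (𝓝 0) := by
      rw [tendsto_zero_iff_norm_tendsto_zero]
      have := tendsto_rpow_mul_exp_neg_mul_atTop_nhds_zero 1 s.re hs
      refine this.congr' ?_
      filter_upwards [eventually_gt_atTop 0] with u hu
      rw [norm_mul, hnorm]
      simp [abs_of_pos hu]
    have h2 : Tendsto (fun u : ℝ => Complex.exp (-s * u)) atTop (𝓝 0) := by
      rw [tendsto_zero_iff_norm_tendsto_zero]
      have := tendsto_rpow_mul_exp_neg_mul_atTop_nhds_zero 0 s.re hs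
      refine this.congr fun u => ?_
      rw [hnorm]
      simp
    simpa using (h1.neg.div_const s).sub (h2.div_const (s ^ 2))
  have := integral_Ioi_of_hasDerivAt_of_tendsto' (fun u _ => hd u) hint ht
  rw [this]
  simp

/-- Laplace inversion for the ramp function. -/
theorem integral_line_cexp_div_sq {c : ℝ} (hc : 0 < c) (u : ℝ) :
    ∫ y : ℝ, Complex.exp (((c : ℂ) + Complex.I * y) * u) * (((c : ℂ) + Complex.I * y) ^ 2)⁻¹ =
      2 * Real.pi * (max u 0 : ℝ) := by
  set f : ℝ → ℂ := fun u => (max u 0 : ℝ) * Complex.exp (-c * u) with hf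
  have hfc : Continuous f := by fun_prop
  have hind : ∀ (z : ℂ), (fun u : ℝ => ((max u 0 : ℝ) : ℂ) * Complex.exp (-z * u)) =
      (Ioi (0 : ℝ)).indicator fun u : ℝ => (u : ℂ) * Complex.exp (-z * u) := by
    intro z
    ext u
    by_cases hu : 0 < u
    · simp [hu, hu.le]
    · simp [hu, not_lt.1 hu]
  have hfi : Integrable f := by
    rw [hf, hind, integrable_indicator_iff measurableSet_Ioi]
    exact (integral_Ioi_mul_cexp_neg (s := c) (by simpa)).1
  have hF : ∀ ξ : ℝ, FourierTransform.fourier f ξ =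
      (((c : ℂ) + Complex.I * (2 * Real.pi * ξ : ℝ)) ^ 2)⁻¹ := by
    intro ξ
    set z : ℂ := (c : ℂ) + Complex.I * (2 * Real.pi * ξ : ℝ) with hz
    rw [Real.fourier_eq', ← (integral_Ioi_mul_cexp_neg (s := z) (by simpa [hz] using hc)).2,
      ← integral_indicator measurableSet_Ioi, ← hind z]
    refine integral_congr_ae (.of_forall fun u => ?_)
    simp only [hf, hz, smul_eq_mul, inner, star_trivial, RCLike.re_to_real]
    rw [mul_left_comm, ← Complex.exp_add]
    congr 2
    push_cast
    ring
  have hFi : Integrable (FourierTransform.fourier f) := by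
    have := (integrable_inv_line_sq hc).comp_mul_left' (R := 2 * Real.pi) (by positivity)
    exact this.congr (.of_forall fun ξ => (hF ξ).symm)
  have hinv := congrFun (hfc.fourierInv_fourier_eq hfi hFi) u
  rw [Real.fourierInv_eq'] at hinv
  simp_rw [hF] at hinv
  have hcomp := Measure.integral_comp_mul_left (fun y : ℝ =>
    Complex.exp (((c : ℂ) + Complex.I * y) * u) * (((c : ℂ) + Complex.I * y) ^ 2)⁻¹)
    (2 * Real.pi)
  rw [abs_of_pos (by positivity)] at hcomp
  have h2 : ∫ ξ : ℝ, Complex.exp (((c : ℂ) + Complex.I * (2 * Real.pi * ξ : ℝ)) * u) *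
      (((c : ℂ) + Complex.I * (2 * Real.pi * ξ : ℝ)) ^ 2)⁻¹ = Complex.exp (c * u) * f u := by
    rw [← hinv, ← integral_const_mul]
    refine integral_congr_ae (.of_forall fun ξ => ?_)
    simp only [smul_eq_mul, inner, star_trivial, RCLike.re_to_real]
    rw [← mul_assoc, ← Complex.exp_add]
    congr 2
    push_cast
    ring
  have h3 : Complex.exp (c * u) * f u = (max u 0 : ℝ) := by
    rw [hf, mul_left_comm, ← Complex.exp_add]
    simp
  have hpi : (2 * Real.pi : ℂ) ≠ 0 := by exact_mod_cast Real.two_pi_pos.ne'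
  rw [← h3, ← h2, hcomp, Complex.real_smul, ← mul_assoc]
  push_cast
  rw [mul_inv_cancel₀ hpi, one_mul]

end

section

open MeasureTheory Set Filter Topology

/-- The average of `t ↦ exp (z t)` over `[0, 1]`. -/
noncomputable def avgExp (z : ℂ) : ℂ := (Complex.exp z - 1) / z

theorem integral_cexp_mul_eq_avgExp {z : ℂ} (hz : z ≠ 0) :
    ∫ v in (0 : ℝ)..1, Complex.exp (z * v) = avgExp z := by
  rw [integral_exp_mul_complex hz, avgExp]
  simp

theorem norm_cexp_le_of_re_le_one {z : ℂ} (hz : z.re ≤ 1) : ‖Complex.exp z‖ ≤ 3 := by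
  rw [Complex.norm_exp]
  exact (Real.exp_le_exp.2 hz).trans (Real.exp_one_lt_three.le)

theorem norm_avgExp_le {z : ℂ} (hz : z.re ≤ 1) : ‖avgExp z‖ ≤ 8 * (1 + ‖z‖)⁻¹ := by
  rw [avgExp, norm_div, ← div_eq_mul_inv]
  rcases eq_or_ne z 0 with rfl | h0
  · simp
  have hz0 : 0 < ‖z‖ := norm_pos_iff.2 h0
  rw [div_le_div_iff₀ hz0 (by positivity)]
  rcases le_total ‖z‖ 1 with h | h
  · have := Complex.norm_exp_sub_one_le h
    nlinarith [norm_nonneg (Complex.exp z - 1)]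
  · have : ‖Complex.exp z - 1‖ ≤ 4 := by
      refine (norm_sub_le _ _).trans ?_
      have := norm_cexp_le_of_re_le_one hz
      simp
      linarith
    nlinarith [norm_nonneg (Complex.exp z - 1)]

/-- The Laplace transform of the iterated averages of the Heaviside function. -/
noncomputable def smoothKernel (Y : ℝ) (j : ℕ) (s : ℂ) : ℂ := avgExp (s * Y) ^ (j + 1) / s

theorem norm_smoothKernel_le {Y : ℝ} (hY : 0 ≤ Y) (j : ℕ) {s : ℂ} (hs : s.re * Y ≤ 1) :
    ‖smoothKernel Y j s‖ ≤ 8 ^ (j + 1) * (‖s‖⁻¹ * ((1 + ‖s‖ * Y) ^ (j + 1))⁻¹) := by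
  have h := norm_avgExp_le (z := s * Y) (by simpa using hs)
  rw [norm_mul, Complex.norm_real, Real.norm_of_nonneg hY] at h
  rw [smoothKernel, norm_div, norm_pow, div_eq_inv_mul, mul_left_comm, ← inv_pow, ← mul_pow]
  gcongr

theorem exists_symbolBoundAt_smoothKernel (j : ℕ) :
    ∃ C > 0, ∀ (Y : ℝ) (s : ℂ), 0 < Y → 0 < s.re → s.re * Y ≤ 1 →
      SymbolBoundAt (smoothKernel Y j) s (C * (‖s‖⁻¹ * ((1 + ‖s‖ * Y) ^ j)⁻¹)) := by
  refine ⟨(j + 1) * 8 ^ j * 11 + 8 ^ (j + 1), by positivity, fun Y s hY hs hsY => ?_⟩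
  have hs0 : s ≠ 0 := by rintro rfl; simp at hs
  have hn : 0 < ‖s‖ := norm_pos_iff.2 hs0
  have hYc : (Y : ℂ) ≠ 0 := by exact_mod_cast hY.ne'
  have hB := norm_avgExp_le (z := s * Y) (by simpa using hsY)
  rw [norm_mul, Complex.norm_real, Real.norm_of_nonneg hY.le] at hB
  set q := (1 + ‖s‖ * Y)⁻¹ with hq
  have hq0 : 0 < q := by positivity
  have hq1 : q ≤ 1 := inv_le_one_of_one_le₀ (by nlinarith [mul_pos hn hY])
  have hB8 : ‖avgExp (s * Y)‖ ≤ 8 := hB.trans (by linarith)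
  have hK := norm_smoothKernel_le hY.le j hsY
  rw [← inv_pow, ← hq] at hK
  rw [← inv_pow, ← hq]
  have hpow : q ^ (j + 1) ≤ q ^ j := pow_le_pow_of_le_one hq0.le hq1 (by omega)
  have hd : HasDerivAt (fun z : ℂ => avgExp (z * Y))
      ((Complex.exp (s * Y) - avgExp (s * Y)) / s) s := by
    have h1 : HasDerivAt (fun z : ℂ => z * Y) (Y : ℂ) s := by
      simpa using (hasDerivAt_id s).mul_const (Y : ℂ)
    convert! ((h1.cexp.sub_const 1).div h1 (mul_ne_zero hs0 hYc)) using 1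
    rw [avgExp]
    field_simp
  have hdK : HasDerivAt (smoothKernel Y j) _ s := (hd.pow (j + 1)).div (hasDerivAt_id s) hs0
  refine ⟨hK.trans ?_, _, hdK, ?_⟩
  · have : 0 ≤ ((j : ℝ) + 1) * 8 ^ j * 11 * (‖s‖⁻¹ * q ^ j) := by positivity
    calc _ ≤ 8 ^ (j + 1) * (‖s‖⁻¹ * q ^ j) := by gcongr
      _ ≤ _ := by rw [add_mul]; linarith
  · set B := avgExp (s * Y) with hBdef
    have hE := norm_cexp_le_of_re_le_one (z := s * Y) (by simpa using hsY)
    have hEB : ‖Complex.exp (s * Y) - B‖ ≤ 11 := (norm_sub_le _ _).trans (by linarith)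
    rw [← norm_mul]
    have heq : s * ((((j + 1 : ℕ) : ℂ) * B ^ (j + 1 - 1) * ((Complex.exp (s * Y) - B) / s) * s -
        ((fun z : ℂ => avgExp (z * Y)) ^ (j + 1)) s * 1) / s ^ 2) =
        s⁻¹ * (((j : ℂ) + 1) * B ^ j * (Complex.exp (s * Y) - B) - B ^ (j + 1)) := by
      simp only [Pi.pow_apply, ← hBdef, add_tsub_cancel_right]
      push_cast
      field_simp
    rw [heq, norm_mul, norm_inv]
    have h1 : ‖B‖ ^ j ≤ 8 ^ j * q ^ j := by
      rw [← mul_pow]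
      exact pow_le_pow_left₀ (norm_nonneg _) hB j
    have h2 : ‖B‖ ^ (j + 1) ≤ 8 ^ (j + 1) * q ^ j := by
      calc ‖B‖ ^ (j + 1) ≤ (8 * q) ^ (j + 1) := pow_le_pow_left₀ (norm_nonneg _) hB _
        _ = 8 ^ (j + 1) * q ^ (j + 1) := mul_pow _ _ _
        _ ≤ _ := by gcongr
    have h3 : ‖((j : ℂ) + 1) * B ^ j * (Complex.exp (s * Y) - B) - B ^ (j + 1)‖ ≤
        ((j : ℝ) + 1) * (8 ^ j * q ^ j) * 11 + 8 ^ (j + 1) * q ^ j := by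
      refine (norm_sub_le _ _).trans (add_le_add ?_ (by rwa [norm_pow]))
      rw [norm_mul, norm_mul, norm_pow]
      have : ‖(j : ℂ) + 1‖ = (j : ℝ) + 1 := by
        rw [← Nat.cast_succ, Complex.norm_natCast, Nat.cast_succ]
      rw [this]
      gcongr
    calc _ ≤ ‖s‖⁻¹ * (((j : ℝ) + 1) * (8 ^ j * q ^ j) * 11 + 8 ^ (j + 1) * q ^ j) := by gcongr
      _ = _ := by ring

theorem exists_integral_norm_smoothKernel_le (j : ℕ) {δ : ℝ} (hδ : 0 < δ) (hδ1 : δ ≤ 1) :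
    ∃ C > 0, ∀ c Y : ℝ, 0 < c → 0 < Y → c * Y ≤ 1 →
      Integrable (fun y : ℝ => smoothKernel Y j ((c : ℂ) + Complex.I * y)) ∧
      ∫ y : ℝ, ‖smoothKernel Y j ((c : ℂ) + Complex.I * y)‖ ≤ C * (c * Y) ^ (-δ) := by
  set J := ∫ y : ℝ, (1 + ‖y‖ ^ 2) ^ (-(1 + δ) / 2) with hJ
  have hJ0 : 0 ≤ J := integral_nonneg fun y => by positivity
  refine ⟨8 ^ (j + 1) * J + 1, by positivity, fun c Y hc hY hcY => ?_⟩
  have hb : ∀ y : ℝ, ‖smoothKernel Y j ((c : ℂ) + Complex.I * y)‖ ≤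
      8 ^ (j + 1) * Y ^ (-δ) * ‖(c : ℂ) + Complex.I * y‖ ^ (-(1 + δ)) := by
    intro y
    have hn : 0 < ‖(c : ℂ) + Complex.I * y‖ := norm_pos_iff.2 (line_ne_zero hc y)
    refine (norm_smoothKernel_le hY.le j (by simpa using hcY)).trans ?_
    rw [mul_assoc]
    refine mul_le_mul_of_nonneg_left ?_ (by positivity)
    set t := ‖(c : ℂ) + Complex.I * y‖
    have h1 : ((1 + t * Y) ^ (j + 1))⁻¹ ≤ (t * Y) ^ (-δ) := by
      rw [Real.rpow_neg (by positivity)]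
      gcongr
      calc (t * Y) ^ δ ≤ (1 + t * Y) ^ δ := by gcongr; linarith
        _ ≤ (1 + t * Y) ^ (1 : ℝ) :=
          Real.rpow_le_rpow_of_exponent_le (by nlinarith [mul_pos hn hY]) hδ1
        _ = (1 + t * Y) ^ 1 := by simp
        _ ≤ _ := pow_le_pow_right₀ (by nlinarith [mul_pos hn hY]) (by omega)
    calc t⁻¹ * ((1 + t * Y) ^ (j + 1))⁻¹ ≤ t⁻¹ * (t * Y) ^ (-δ) := by gcongr
      _ = _ := by
        rw [Real.mul_rpow hn.le hY.le, neg_add, Real.rpow_add (x := t) hn, Real.rpow_neg_one]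
        ring
  have hint := (integrable_norm_line_rpow hc hδ).const_mul (8 ^ (j + 1) * Y ^ (-δ))
  have hcont : Continuous fun y : ℝ => smoothKernel Y j ((c : ℂ) + Complex.I * y) := by
    unfold smoothKernel avgExp
    refine Continuous.div (Continuous.pow (Continuous.div (by fun_prop) (by fun_prop) fun y => ?_) _)
      (by fun_prop) (line_ne_zero hc)
    exact mul_ne_zero (line_ne_zero hc y) (by exact_mod_cast hY.ne')
  have hK := hint.mono' hcont.aestronglyMeasurable (.of_forall hb)
  refine ⟨hK, ?_⟩
  calc _ ≤ ∫ y : ℝ, 8 ^ (j + 1) * Y ^ (-δ) * ‖(c : ℂ) + Complex.I * y‖ ^ (-(1 + δ)) :=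
        integral_mono hK.norm hint hb
    _ = 8 ^ (j + 1) * J * (c * Y) ^ (-δ) := by
        rw [integral_const_mul, integral_norm_line_rpow hc, Real.mul_rpow hc.le hY.le]
        ring
    _ ≤ _ := by gcongr; linarith

theorem integrable_smoothKernel {c Y : ℝ} (hc : 0 < c) (hY : 0 < Y) (hcY : c * Y ≤ 1) (j : ℕ) :
    Integrable fun y : ℝ => smoothKernel Y j ((c : ℂ) + Complex.I * y) := by
  obtain ⟨C, -, h⟩ := exists_integral_norm_smoothKernel_le j one_pos le_rfl
  exact (h c Y hc hY hcY).1

/-- Iterated averages of the Heaviside function. -/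
noncomputable def smoothStep (Y : ℝ) : ℕ → ℝ → ℝ
  | 0, u => (max (u + Y) 0 - max u 0) / Y
  | j + 1, u => ∫ v in (0 : ℝ)..1, smoothStep Y j (u + Y * v)

theorem continuous_smoothStep (Y : ℝ) (j : ℕ) : Continuous (smoothStep Y j) := by
  induction j with
  | zero =>
    change Continuous fun u => (max (u + Y) 0 - max u 0) / Y
    fun_prop
  | succ j ih =>
    exact intervalIntegral.continuous_parametric_intervalIntegral_of_continuous'
      (f := fun u v => smoothStep Y j (u + Y * v)) (by fun_prop) 0 1

theorem smoothStep_nonneg {Y : ℝ} (hY : 0 < Y) (j : ℕ) (u : ℝ) : 0 ≤ smoothStep Y j u := by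
  induction j generalizing u with
  | zero =>
    refine div_nonneg (sub_nonneg.2 ?_) hY.le
    gcongr
    linarith
  | succ j ih => exact intervalIntegral.integral_nonneg zero_le_one fun v _ => ih _

theorem smoothStep_le_one {Y : ℝ} (hY : 0 < Y) (j : ℕ) (u : ℝ) : smoothStep Y j u ≤ 1 := by
  induction j generalizing u with
  | zero =>
    rw [smoothStep, div_le_one hY, sub_le_iff_le_add]
    refine max_le ?_ ?_
    · linarith [le_max_left u 0]
    · linarith [le_max_right u 0]
  | succ j ih =>
    have := intervalIntegral.integral_mono_on (μ := volume) (a := 0) (b := 1) (f := fun v => smoothStep Y j (u + Y * v))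
      (g := fun _ => (1 : ℝ)) zero_le_one
      (((continuous_smoothStep Y j).comp (by fun_prop : Continuous fun v : ℝ => u + Y * v)).intervalIntegrable _ _)
      (by simp) (fun v _ => ih _)
    simpa [smoothStep] using this

theorem smoothStep_of_nonneg {Y : ℝ} (hY : 0 < Y) (j : ℕ) {u : ℝ} (hu : 0 ≤ u) :
    smoothStep Y j u = 1 := by
  induction j generalizing u with
  | zero =>
    rw [smoothStep, max_eq_left hu, max_eq_left (by linarith)]
    field_simp
    ring
  | succ j ih =>
    rw [smoothStep, intervalIntegral.integral_congr (g := fun _ => (1 : ℝ))]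
    · simp
    · intro v hv
      rw [uIcc_of_le zero_le_one] at hv
      exact ih (by nlinarith [hv.1])

theorem smoothStep_of_le {Y : ℝ} (hY : 0 < Y) (j : ℕ) {u : ℝ} (hu : u ≤ -((j + 1) * Y)) :
    smoothStep Y j u = 0 := by
  induction j generalizing u with
  | zero =>
    simp only [CharP.cast_eq_zero, zero_add, one_mul] at hu
    rw [smoothStep, max_eq_right (by linarith), max_eq_right (by linarith)]
    simp
  | succ j ih =>
    rw [smoothStep, intervalIntegral.integral_congr (g := fun _ => (0 : ℝ))]
    · simp
    · intro v hv
      rw [uIcc_of_le zero_le_one] at hv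
      push_cast at hu
      exact ih (by nlinarith [hv.2])

/-- Laplace inversion for the smoothed step function. -/
theorem integral_line_cexp_mul_smoothKernel {c Y : ℝ} (hc : 0 < c) (hY : 0 < Y) (hcY : c * Y ≤ 1)
    (j : ℕ) (u : ℝ) :
    ∫ y : ℝ, Complex.exp (((c : ℂ) + Complex.I * y) * u) *
      smoothKernel Y j ((c : ℂ) + Complex.I * y) = 2 * Real.pi * (smoothStep Y j u : ℝ) := by
  have hYc : (Y : ℂ) ≠ 0 := by exact_mod_cast hY.ne'
  have hexp : ∀ u y : ℝ, ‖Complex.exp (((c : ℂ) + Complex.I * y) * u)‖ = Real.exp (c * u) := by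
    intro u y
    rw [Complex.norm_exp]
    simp
  induction j generalizing u with
  | zero =>
    have hi : ∀ u : ℝ, Integrable fun y : ℝ => Complex.exp (((c : ℂ) + Complex.I * y) * u) *
        (((c : ℂ) + Complex.I * y) ^ 2)⁻¹ := fun u =>
      (integrable_inv_line_sq hc).bdd_mul (c := Real.exp (c * u))
        (Continuous.aestronglyMeasurable (by fun_prop)) (.of_forall fun y => (hexp u y).le)
    have h : ∀ y : ℝ, Complex.exp (((c : ℂ) + Complex.I * y) * u) *
        smoothKernel Y 0 ((c : ℂ) + Complex.I * y) = (Y : ℂ)⁻¹ *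
        (Complex.exp (((c : ℂ) + Complex.I * y) * (u + Y : ℝ)) * (((c : ℂ) + Complex.I * y) ^ 2)⁻¹ -
          Complex.exp (((c : ℂ) + Complex.I * y) * u) * (((c : ℂ) + Complex.I * y) ^ 2)⁻¹) := by
      intro y
      have := line_ne_zero hc y
      rw [smoothKernel, avgExp, Complex.ofReal_add, mul_add, Complex.exp_add, zero_add, pow_one]
      field_simp
    simp_rw [h]
    rw [integral_const_mul, integral_sub (hi _) (hi _), integral_line_cexp_div_sq hc,
      integral_line_cexp_div_sq hc, smoothStep]
    push_cast
    field_simp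
  | succ j ih =>
    have h : ∀ y : ℝ, Complex.exp (((c : ℂ) + Complex.I * y) * u) *
        smoothKernel Y (j + 1) ((c : ℂ) + Complex.I * y) = ∫ v in (0 : ℝ)..1,
          Complex.exp (((c : ℂ) + Complex.I * y) * (u + Y * v : ℝ)) *
            smoothKernel Y j ((c : ℂ) + Complex.I * y) := by
      intro y
      have hs := line_ne_zero hc y
      rw [intervalIntegral.integral_mul_const]
      have : ∀ v : ℝ, Complex.exp (((c : ℂ) + Complex.I * y) * (u + Y * v : ℝ)) =
          Complex.exp (((c : ℂ) + Complex.I * y) * u) *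
            Complex.exp (((c : ℂ) + Complex.I * y) * Y * v) := by
        intro v
        rw [← Complex.exp_add]
        congr 1
        push_cast
        ring
      simp_rw [this]
      rw [intervalIntegral.integral_const_mul, integral_cexp_mul_eq_avgExp (mul_ne_zero hs hYc),
        smoothKernel, smoothKernel]
      ring
    simp_rw [h]
    simp_rw [intervalIntegral.integral_of_le zero_le_one]
    rw [integral_integral_swap]
    · simp_rw [ih]
      rw [integral_const_mul, smoothStep, intervalIntegral.integral_of_le zero_le_one,
        integral_complex_ofReal]
    · have hK : Integrable (fun p : ℝ × ℝ => smoothKernel Y j ((c : ℂ) + Complex.I * p.1))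
          (volume.prod (volume.restrict (Ioc (0 : ℝ) 1))) :=
        (integrable_smoothKernel hc hY hcY j).comp_fst _
      refine hK.bdd_mul (c := Real.exp (c * (|u| + Y)))
        (Continuous.aestronglyMeasurable (by fun_prop)) ?_
      filter_upwards [Measure.quasiMeasurePreserving_snd.ae
        (ae_restrict_mem (measurableSet_Ioc : MeasurableSet (Ioc (0 : ℝ) 1)))] with p hp
      rw [hexp]
      have h1 := le_abs_self u
      gcongr
      nlinarith [hp.2]

end

section

open MeasureTheory Set Filter Topology

section Laplace

variable {X : Type*} [MeasurableSpace X] {μ : Measure X} {w v : X → ℝ} {c Y : ℝ}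

theorem integrable_line_smoothKernel_prod (hv : Measurable v) (hc : 0 < c)
    (hY : 0 < Y) (hcY : c * Y ≤ 1) (hi : Integrable (fun x => w x * Real.exp (-c * v x)) μ)
    (j : ℕ) (T : ℝ) :
    Integrable (fun p : ℝ × X => Complex.exp (((c : ℂ) + Complex.I * p.1) * T) *
      smoothKernel Y j ((c : ℂ) + Complex.I * p.1) *
      ((w p.2 : ℂ) * Complex.exp (-((c : ℂ) + Complex.I * p.1) * v p.2)))
      ((volume : Measure ℝ).prod μ) := by
  have hic : Integrable (fun x => (w x : ℂ) * Complex.exp (-c * v x)) μ := by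
    refine (hi.ofReal (𝕜 := ℂ)).congr (.of_forall fun x => ?_)
    simp
  have h := ((integrable_smoothKernel hc hY hcY j).mul_prod hic).bdd_mul
    (f := fun p : ℝ × X => Complex.exp (((c : ℂ) + Complex.I * p.1) * T) *
      Complex.exp (-(Complex.I * p.1) * v p.2)) (c := Real.exp (c * T)) (by
        refine Measurable.aestronglyMeasurable ?_
        fun_prop) (.of_forall fun p => by
        rw [← Complex.exp_add, Complex.norm_exp]
        simp)
  refine h.congr (.of_forall fun p => ?_)
  have : Complex.exp (-((c : ℂ) + Complex.I * p.1) * v p.2) =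
      Complex.exp (-(Complex.I * p.1) * v p.2) * Complex.exp (-c * v p.2) := by
    rw [← Complex.exp_add]
    congr 1
    ring
  simp only [this]
  ring

theorem integrable_line_smoothKernel_laplace [SFinite μ] (hv : Measurable v) (hc : 0 < c)
    (hY : 0 < Y) (hcY : c * Y ≤ 1) (hi : Integrable (fun x => w x * Real.exp (-c * v x)) μ)
    (j : ℕ) (T : ℝ) :
    Integrable fun y : ℝ => Complex.exp (((c : ℂ) + Complex.I * y) * T) *
      smoothKernel Y j ((c : ℂ) + Complex.I * y) *
      ∫ x, (w x : ℂ) * Complex.exp (-((c : ℂ) + Complex.I * y) * v x) ∂μ := by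
  refine (integrable_line_smoothKernel_prod hv hc hY hcY hi j T).integral_prod_left.congr
    (.of_forall fun y => ?_)
  simp only
  rw [integral_const_mul]

/-- Laplace inversion of a smoothed weighted count. -/
theorem integral_line_smoothKernel_laplace [SFinite μ] (hv : Measurable v) (hc : 0 < c)
    (hY : 0 < Y) (hcY : c * Y ≤ 1) (hi : Integrable (fun x => w x * Real.exp (-c * v x)) μ)
    (j : ℕ) (T : ℝ) :
    ∫ y : ℝ, Complex.exp (((c : ℂ) + Complex.I * y) * T) *
      smoothKernel Y j ((c : ℂ) + Complex.I * y) *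
      ∫ x, (w x : ℂ) * Complex.exp (-((c : ℂ) + Complex.I * y) * v x) ∂μ =
    2 * Real.pi * ((∫ x, w x * smoothStep Y j (T - v x) ∂μ : ℝ) : ℂ) := by
  simp_rw [← integral_const_mul]
  rw [integral_integral_swap (integrable_line_smoothKernel_prod hv hc hY hcY hi j T),
    ← integral_complex_ofReal, ← integral_const_mul]
  refine integral_congr_ae (.of_forall fun x => ?_)
  have := integral_line_cexp_mul_smoothKernel hc hY hcY j (T - v x)
  simp only
  rw [Complex.ofReal_mul, mul_left_comm, ← this, ← integral_const_mul]
  refine integral_congr_ae (.of_forall fun y => ?_)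
  simp only
  have : Complex.exp (((c : ℂ) + Complex.I * y) * (T - v x : ℝ)) =
      Complex.exp (((c : ℂ) + Complex.I * y) * T) *
        Complex.exp (-((c : ℂ) + Complex.I * y) * v x) := by
    rw [← Complex.exp_add]
    congr 1
    push_cast
    ring
  rw [this]
  ring

end Laplace

theorem gaussMass_pow_eq_integral {s : ℂ} (hs : 0 < s.re) (k : ℕ) :
    gaussMass s ^ (k + 1) = ((2 / momentConst k : ℝ) : ℂ) *
      ∫ x in Ioi (0 : ℝ), ((x ^ k : ℝ) : ℂ) * Complex.exp (-s * (x ^ 2 : ℝ)) := by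
  have hm := integral_Ioi_pow_mul_cexp hs k
  have : (momentConst k : ℂ) ≠ 0 := by exact_mod_cast (momentConst_pos k).ne'
  push_cast
  rw [div_mul_eq_mul_div, hm, mul_div_cancel_left₀ _ this]

theorem integrable_line_gaussMass_pow {c Y : ℝ} (hc : 0 < c) (hY : 0 < Y) (hcY : c * Y ≤ 1)
    (j k : ℕ) (T : ℝ) :
    Integrable fun y : ℝ => Complex.exp (((c : ℂ) + Complex.I * y) * T) *
      smoothKernel Y j ((c : ℂ) + Complex.I * y) *
        gaussMass ((c : ℂ) + Complex.I * y) ^ (k + 1) := by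
  have h := (integrable_line_smoothKernel_laplace (μ := volume.restrict (Ioi (0 : ℝ)))
    (w := fun x => x ^ k) (v := fun x => x ^ 2) (by fun_prop) hc hY hcY
    (integrable_pow_mul_exp_neg_mul_sq hc k).integrableOn j T).const_mul
    ((2 / momentConst k : ℝ) : ℂ)
  refine h.congr (.of_forall fun y => ?_)
  simp only
  rw [gaussMass_pow_eq_integral (by simpa using hc)]
  ring

theorem integral_line_gaussMass_pow {c Y : ℝ} (hc : 0 < c) (hY : 0 < Y) (hcY : c * Y ≤ 1)
    (j k : ℕ) (T : ℝ) :
    ∫ y : ℝ, Complex.exp (((c : ℂ) + Complex.I * y) * T) *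
      smoothKernel Y j ((c : ℂ) + Complex.I * y) *
        gaussMass ((c : ℂ) + Complex.I * y) ^ (k + 1) =
    2 * Real.pi * ((2 / momentConst k *
      ∫ x in Ioi (0 : ℝ), x ^ k * smoothStep Y j (T - x ^ 2) : ℝ) : ℂ) := by
  have h := integral_line_smoothKernel_laplace (μ := volume.restrict (Ioi (0 : ℝ)))
    (w := fun x => x ^ k) (v := fun x => x ^ 2) (by fun_prop) hc hY hcY
    (integrable_pow_mul_exp_neg_mul_sq hc k).integrableOn j T
  rw [Complex.ofReal_mul, mul_left_comm, ← h, ← integral_const_mul]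
  refine integral_congr_ae (.of_forall fun y => ?_)
  simp only
  rw [gaussMass_pow_eq_integral (by simpa using hc)]
  ring

theorem integral_Ioc_zero_pow (k : ℕ) {a : ℝ} (ha : 0 ≤ a) :
    ∫ x in Ioc (0 : ℝ) a, x ^ k = a ^ (k + 1) / (k + 1) := by
  rw [← intervalIntegral.integral_of_le ha, integral_pow]
  simp

theorem sub_mul_pow_le {a b : ℝ} (ha : 0 ≤ a) (hab : a ≤ b) (m : ℕ) :
    b ^ (m + 2) - a ^ (m + 2) ≤ (m + 2) * b ^ m * (b ^ 2 - a ^ 2) := by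
  have h := abs_pow_sub_pow_le b a (m + 2)
  rw [abs_of_nonneg (sub_nonneg.2 (pow_le_pow_left₀ ha hab _)), abs_of_nonneg (sub_nonneg.2 hab),
    abs_of_nonneg ha, abs_of_nonneg (ha.trans hab), max_eq_left hab] at h
  refine h.trans ?_
  have hb := ha.trans hab
  have : 0 ≤ ((m : ℝ) + 2) * b ^ m * (b - a) * a :=
    mul_nonneg (mul_nonneg (by positivity) (sub_nonneg.2 hab)) ha
  have h1 : m + 2 - 1 = m + 1 := by omega
  rw [h1]
  push_cast
  calc (b - a) * (m + 2) * b ^ (m + 1) ≤ (b - a) * (m + 2) * b ^ (m + 1) +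
        (m + 2) * b ^ m * (b - a) * a := le_add_of_nonneg_right this
    _ = _ := by ring

/-- The smoothed moment of order `m + 1` is close to the sharp one. -/
theorem abs_smoothMoment_sub_le (m j : ℕ) {R T Y : ℝ} (hR : 0 < R) (hY : 0 < Y)
    (hYR : (j + 1) * Y ≤ R ^ 2) (hT : R ^ 2 - (j + 1) * Y ≤ T) (hTR : T ≤ R ^ 2) :
    |(∫ x in Ioi (0 : ℝ), x ^ (m + 1) * smoothStep Y j (T - x ^ 2)) - R ^ (m + 2) / (m + 2)| ≤
      (j + 1) * 2 ^ m * (R ^ m * Y) := by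
  have hm2 : (((m + 1 : ℕ) : ℝ) + 1) = m + 2 := by push_cast; ring
  set a := √(R ^ 2 - (j + 1) * Y) with ha
  set b := √(R ^ 2 + (j + 1) * Y) with hb
  have hjY : 0 ≤ (j + 1) * Y := by positivity
  have ha2 : a ^ 2 = R ^ 2 - (j + 1) * Y := Real.sq_sqrt (by linarith)
  have hb2 : b ^ 2 = R ^ 2 + (j + 1) * Y := Real.sq_sqrt (by positivity)
  have ha0 : 0 ≤ a := Real.sqrt_nonneg _
  have hb0 : 0 ≤ b := Real.sqrt_nonneg _
  have haR : a ≤ R := by nlinarith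
  have hRb : R ≤ b := by nlinarith
  have hb2R : b ≤ 2 * R := by nlinarith
  have hW := continuous_smoothStep Y j
  have hcont : Continuous fun x : ℝ => x ^ (m + 1) * smoothStep Y j (T - x ^ 2) := by fun_prop
  have hsupp : ∫ x in Ioi (0 : ℝ), x ^ (m + 1) * smoothStep Y j (T - x ^ 2) =
      ∫ x in Ioc 0 b, x ^ (m + 1) * smoothStep Y j (T - x ^ 2) := by
    refine setIntegral_eq_of_subset_of_forall_sdiff_eq_zero measurableSet_Ioi Ioc_subset_Ioi_self
      fun x hx => ?_
    have hbx : b < x := not_le.1 fun h => hx.2 ⟨hx.1, h⟩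
    rw [smoothStep_of_le hY j (by nlinarith), mul_zero]
  have hup : ∫ x in Ioc 0 b, x ^ (m + 1) * smoothStep Y j (T - x ^ 2) ≤ b ^ (m + 2) / (m + 2) := by
    rw [← hm2, ← integral_Ioc_zero_pow (m + 1) hb0]
    refine setIntegral_mono_on hcont.integrableOn_Ioc (continuous_pow _).integrableOn_Ioc
      measurableSet_Ioc fun x hx => ?_
    exact mul_le_of_le_one_right (pow_nonneg hx.1.le _) (smoothStep_le_one hY j _)
  have hlo : a ^ (m + 2) / (m + 2) ≤ ∫ x in Ioc 0 b, x ^ (m + 1) * smoothStep Y j (T - x ^ 2) := by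
    rw [← hm2, ← integral_Ioc_zero_pow (m + 1) ha0]
    calc ∫ x in Ioc 0 a, x ^ (m + 1) =
        ∫ x in Ioc 0 a, x ^ (m + 1) * smoothStep Y j (T - x ^ 2) := by
          refine setIntegral_congr_fun measurableSet_Ioc fun x hx => ?_
          rw [smoothStep_of_nonneg hY j, mul_one]
          nlinarith [hx.1, hx.2]
      _ ≤ _ := by
          refine setIntegral_mono_set hcont.integrableOn_Ioc ?_
            (Ioc_subset_Ioc_right (haR.trans hRb)).eventuallyLE
          filter_upwards [ae_restrict_mem measurableSet_Ioc] with x hx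
          exact mul_nonneg (pow_nonneg hx.1.le _) (smoothStep_nonneg hY j _)
  have h1 := sub_mul_pow_le ha0 haR m
  have h2 := sub_mul_pow_le hR.le hRb m
  rw [ha2] at h1
  rw [hb2] at h2
  have hbm : b ^ m ≤ 2 ^ m * R ^ m := by
    rw [← mul_pow]
    exact pow_le_pow_left₀ hb0 hb2R m
  have hpos : (0 : ℝ) < m + 2 := by positivity
  rw [hsupp, abs_le]
  constructor
  · have : (R ^ (m + 2) - a ^ (m + 2)) / (m + 2) ≤ (j + 1) * 2 ^ m * (R ^ m * Y) := by
      rw [div_le_iff₀ hpos]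
      refine h1.trans ?_
      have : (1 : ℝ) ≤ 2 ^ m := one_le_pow₀ (by norm_num)
      have h3 : 0 ≤ ((m : ℝ) + 2) * R ^ m * ((j + 1) * Y) := by positivity
      nlinarith
    rw [sub_div] at this
    linarith
  · have : (b ^ (m + 2) - R ^ (m + 2)) / (m + 2) ≤ (j + 1) * 2 ^ m * (R ^ m * Y) := by
      rw [div_le_iff₀ hpos]
      refine h2.trans ?_
      have h3 : 0 ≤ ((m : ℝ) + 2) * ((j + 1) * Y) := by positivity
      nlinarith
    rw [sub_div] at this
    linarith

end

section

open MeasureTheory Set Filter Topology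

theorem pi_count_eq_count {ι : Type*} [Fintype ι] :
    Measure.pi (fun _ : ι => (Measure.count : Measure ℕ)) = Measure.count := by
  refine Measure.ext_of_singleton fun m => ?_
  rw [Measure.pi_singleton]
  simp

theorem summable_norm_pi_prod {ι 𝕜 : Type*} [Fintype ι] [RCLike 𝕜] {f : ι → ℕ → 𝕜}
    (hf : ∀ i, Summable fun k => ‖f i k‖) : Summable fun m : ι → ℕ => ‖∏ i, f i (m i)‖ := by
  rw [← integrable_count_iff, ← pi_count_eq_count]
  exact Integrable.fintype_prod fun i => integrable_count_iff.2 (hf i)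

theorem integral_count_eq_tsum {α E : Type*} [Countable α] [MeasurableSpace α]
    [MeasurableSingletonClass α] [NormedAddCommGroup E] [NormedSpace ℝ E] [CompleteSpace E]
    {f : α → E} (hf : Summable fun a => ‖f a‖) : ∫ a, f a ∂Measure.count = ∑' a, f a := by
  rw [integral_countable (integrable_count_iff.2 hf)]
  simp [measureReal_def]

theorem tsum_pi_prod {ι 𝕜 : Type*} [Fintype ι] [RCLike 𝕜] {f : ι → ℕ → 𝕜}
    (hf : ∀ i, Summable fun k => ‖f i k‖) :
    ∑' m : ι → ℕ, ∏ i, f i (m i) = ∏ i, ∑' k, f i k := by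
  rw [← integral_count_eq_tsum (f := fun m : ι → ℕ => ∏ i, f i (m i)) (summable_norm_pi_prod hf),
    ← pi_count_eq_count,
    integral_fintype_prod_eq_prod]
  exact Finset.prod_congr rfl fun i _ => integral_count_eq_tsum (f := f i) (hf i)

theorem hasSum_pi_prod {ι 𝕜 : Type*} [Fintype ι] [RCLike 𝕜] {f : ι → ℕ → 𝕜} {a : ι → 𝕜}
    (hf : ∀ i, Summable fun k => ‖f i k‖) (ha : ∀ i, HasSum (f i) (a i)) :
    HasSum (fun m : ι → ℕ => ∏ i, f i (m i)) (∏ i, a i) := by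
  have h := (summable_norm_pi_prod hf).of_norm.hasSum
  rw [tsum_pi_prod hf] at h
  simp_rw [fun i => (ha i).tsum_eq] at h
  exact h

theorem norm_prod_sub_prod_le {ι : Type*} (t : Finset ι) {x y : ι → ℂ} {b : ι → ℝ} {ε : ℝ}
    (hx : ∀ i, ‖x i‖ ≤ b i) (hy : ∀ i, ‖y i‖ ≤ b i) (hxy : ∀ i, ‖x i - y i‖ ≤ ε * b i) :
    ‖∏ i ∈ t, x i - ∏ i ∈ t, y i‖ ≤ t.card * ε * ∏ i ∈ t, b i := by
  classical
  have hb : ∀ i, 0 ≤ b i := fun i => (norm_nonneg _).trans (hx i)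
  induction t using Finset.induction_on with
  | empty => simp
  | insert i t hi ih =>
    rw [Finset.prod_insert hi, Finset.prod_insert hi, Finset.prod_insert hi,
      Finset.card_insert_of_notMem hi]
    have hyt : ‖∏ i ∈ t, y i‖ ≤ ∏ i ∈ t, b i := by
      rw [norm_prod]
      exact Finset.prod_le_prod (fun _ _ => norm_nonneg _) fun i _ => hy i
    calc ‖x i * ∏ i ∈ t, x i - y i * ∏ i ∈ t, y i‖
        = ‖x i * (∏ i ∈ t, x i - ∏ i ∈ t, y i) + (x i - y i) * ∏ i ∈ t, y i‖ := by ring_nf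
      _ ≤ ‖x i‖ * ‖∏ i ∈ t, x i - ∏ i ∈ t, y i‖ + ‖x i - y i‖ * ‖∏ i ∈ t, y i‖ := by
        refine (norm_add_le _ _).trans ?_
        rw [norm_mul, norm_mul]
      _ ≤ b i * (t.card * ε * ∏ i ∈ t, b i) + ε * b i * ∏ i ∈ t, b i :=
        add_le_add (mul_le_mul (hx i) ih (norm_nonneg _) (hb i))
          (mul_le_mul (hxy i) hyt (norm_nonneg _) ((norm_nonneg _).trans (hxy i)))
      _ = _ := by push_cast; ring

theorem add_one_rpow_mul_le_sub {b N : ℝ} (hb : 0 < b) (hb1 : b ≤ 1) (hN : 0 < N) (k : ℕ) :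
    ((k : ℝ) + 1) ^ (b - 1) * ((1 + (k + 1) / N) ^ 2)⁻¹ ≤
      (((k : ℝ) + 1) / (1 + (k + 1) / N)) ^ b / b - ((k : ℝ) / (1 + k / N)) ^ b / b := by
  have hk : (0 : ℝ) ≤ k := k.cast_nonneg
  have hden : ∀ x : ℝ, 0 ≤ x → 0 < 1 + x / N := fun x hx => by positivity
  obtain ⟨x, hx, hslope⟩ := exists_hasDerivAt_eq_slope
    (fun x : ℝ => (x / (1 + x / N)) ^ b / b)
    (fun x : ℝ => (x / (1 + x / N)) ^ (b - 1) * ((1 + x / N) ^ 2)⁻¹)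
    (show (k : ℝ) < k + 1 by linarith) (by
      refine ContinuousOn.div_const (ContinuousOn.rpow_const (ContinuousOn.div (by fun_prop)
        (by fun_prop) fun x hx => (hden x (hk.trans hx.1)).ne') fun x _ => Or.inr hb.le) _)
    fun x hx => by
      have hx0 : 0 < x := hk.trans_lt hx.1
      have hd := hden x hx0.le
      have h1 : HasDerivAt (fun x : ℝ => x / (1 + x / N)) (((1 + x / N) ^ 2)⁻¹) x := by
        convert! (hasDerivAt_id x).div (((hasDerivAt_id x).div_const N).const_add 1) hd.ne' using 1
        simp only [id]
        field_simp
        ring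
      convert! (h1.rpow_const (p := b) (Or.inl (by positivity))).div_const b using 1
      field_simp
  have hx0 : 0 < x := hk.trans_lt hx.1
  have hd := hden x hx0.le
  simp only [add_sub_cancel_left, div_one] at hslope
  rw [← hslope]
  refine mul_le_mul ?_ ?_ (by positivity) (by positivity)
  · refine Real.rpow_le_rpow_of_nonpos (by positivity) ?_ (by linarith)
    refine (div_le_self hx0.le ?_).trans hx.2.le
    linarith [div_nonneg hx0.le hN.le]
  · have := hx.2.le
    gcongr

theorem exists_tsum_shifted_le {b : ℝ} (hb : 0 < b) (hb1 : b ≤ 1) : ∃ C > 0, ∀ N : ℝ, 0 < N →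
    Summable (fun k : ℕ => ((k : ℝ) + 1) ^ (b - 1) * ((1 + (k + 1) / N) ^ 2)⁻¹) ∧
    ∑' k : ℕ, ((k : ℝ) + 1) ^ (b - 1) * ((1 + (k + 1) / N) ^ 2)⁻¹ ≤ C * N ^ b := by
  refine ⟨b⁻¹, by positivity, fun N hN => ?_⟩
  have hnn : ∀ k : ℕ, 0 ≤ ((k : ℝ) + 1) ^ (b - 1) * ((1 + (k + 1) / N) ^ 2)⁻¹ := fun k => by
    positivity
  have hsum : ∀ n : ℕ, ∑ k ∈ Finset.range n,
      ((k : ℝ) + 1) ^ (b - 1) * ((1 + (k + 1) / N) ^ 2)⁻¹ ≤ b⁻¹ * N ^ b := by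
    intro n
    calc _ ≤ ∑ k ∈ Finset.range n, ((((k + 1 : ℕ) : ℝ) / (1 + ((k + 1 : ℕ) : ℝ) / N)) ^ b / b -
          ((k : ℝ) / (1 + k / N)) ^ b / b) := by
          refine Finset.sum_le_sum fun k _ => ?_
          push_cast
          exact add_one_rpow_mul_le_sub hb hb1 hN k
      _ = ((n : ℝ) / (1 + n / N)) ^ b / b := by
          rw [Finset.sum_range_sub (fun k : ℕ => ((k : ℝ) / (1 + k / N)) ^ b / b)]
          simp [Real.zero_rpow hb.ne']
      _ ≤ _ := by
          rw [div_eq_inv_mul]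
          gcongr
          rw [div_le_iff₀ (by positivity)]
          field_simp
          linarith
  exact ⟨summable_of_sum_range_le hnn hsum, Real.tsum_le_of_sum_range_le hnn hsum⟩

end

section

open MeasureTheory Set Filter Topology

section DualSum

variable {ι : Type*} [Fintype ι]

/-- The Euclidean length of a vector of natural numbers. -/
noncomputable def latticeNorm (m : ι → ℕ) : ℝ := √(∑ i, (m i : ℝ) ^ 2)

theorem latticeNorm_sq (m : ι → ℕ) : latticeNorm m ^ 2 = ∑ i, (m i : ℝ) ^ 2 :=
  Real.sq_sqrt (Finset.sum_nonneg fun _ _ => sq_nonneg _)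

theorem le_latticeNorm (m : ι → ℕ) (i : ι) : (m i : ℝ) ≤ latticeNorm m :=
  Real.le_sqrt_of_sq_le
    (Finset.single_le_sum (f := fun i => (m i : ℝ) ^ 2) (fun _ _ => sq_nonneg _)
      (Finset.mem_univ i))

theorem one_le_latticeNorm {m : ι → ℕ} (hm : m ≠ 0) : 1 ≤ latticeNorm m := by
  obtain ⟨i, hi⟩ := Function.ne_iff.1 hm
  refine le_trans ?_ (le_latticeNorm m i)
  exact_mod_cast Nat.one_le_iff_ne_zero.2 hi

theorem dual_term_le {m : ι → ℕ} (hm : m ≠ 0) {M : ℝ} (hM : 0 < M)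
    {b : ℝ} (hb : b ≤ 1) :
    latticeNorm m ^ (Fintype.card ι * (b - 1)) *
      ((1 + latticeNorm m / M) ^ (2 * Fintype.card ι))⁻¹ ≤
    ∏ i, (2 ^ (1 - b) * (((m i : ℝ) + 1) ^ (b - 1) * ((1 + (m i + 1) / (2 * M)) ^ 2)⁻¹)) := by
  set r := latticeNorm m with hr
  have hr1 : 1 ≤ r := one_le_latticeNorm hm
  have hr0 : 0 < r := by linarith
  have h1 : r ^ (Fintype.card ι * (b - 1)) * ((1 + r / M) ^ (2 * Fintype.card ι))⁻¹ =
      ∏ _i : ι, (r ^ (b - 1) * ((1 + r / M) ^ 2)⁻¹) := by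
    rw [Finset.prod_const, Finset.card_univ, mul_pow, ← Real.rpow_natCast (r ^ (b - 1)),
      ← Real.rpow_mul hr0.le, mul_comm (b - 1), inv_pow, pow_mul]
  rw [h1]
  refine Finset.prod_le_prod (fun i _ => by positivity) fun i _ => ?_
  have hmi : ((m i : ℝ) + 1) / 2 ≤ r := by
    have := le_latticeNorm m i
    linarith
  have h2 : (0 : ℝ) < m i + 1 := by positivity
  rw [← mul_assoc]
  refine mul_le_mul ?_ ?_ (by positivity) (by positivity)
  · calc r ^ (b - 1) ≤ (((m i : ℝ) + 1) / 2) ^ (b - 1) :=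
        Real.rpow_le_rpow_of_nonpos (by positivity) hmi (by linarith)
      _ = _ := by
        rw [Real.div_rpow h2.le zero_le_two, div_eq_mul_inv, ← Real.rpow_neg zero_le_two, neg_sub,
          mul_comm]
  · have : ((m i : ℝ) + 1) / (2 * M) ≤ r / M := by
      rw [← div_div]
      gcongr
    gcongr

theorem exists_tsum_dual_le (hn : 2 ≤ Fintype.card ι) : ∃ C > 0, ∀ M : ℝ, 0 < M →
    Summable (fun m : ι → ℕ => if m = 0 then 0 else
      latticeNorm m ^ (-((Fintype.card ι : ℝ) + 1) / 2) *
        ((1 + latticeNorm m / M) ^ (2 * Fintype.card ι))⁻¹) ∧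
    ∑' m : ι → ℕ, (if m = 0 then 0 else
      latticeNorm m ^ (-((Fintype.card ι : ℝ) + 1) / 2) *
        ((1 + latticeNorm m / M) ^ (2 * Fintype.card ι))⁻¹) ≤
      C * M ^ (((Fintype.card ι : ℝ) - 1) / 2) := by
  set n := Fintype.card ι with hn'
  have hn2 : (2 : ℝ) ≤ n := by exact_mod_cast hn
  set b : ℝ := ((n : ℝ) - 1) / (2 * n) with hb
  have hb0 : 0 < b := by apply div_pos <;> linarith
  have hb1 : b ≤ 1 := by rw [hb, div_le_one (by linarith)]; linarith
  have hexp : -((n : ℝ) + 1) / 2 = n * (b - 1) := by rw [hb]; field_simp; ring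
  have hexp2 : ((n : ℝ) - 1) / 2 = b * n := by rw [hb]; field_simp
  obtain ⟨C, hC, h⟩ := exists_tsum_shifted_le hb0 hb1
  refine ⟨(2 ^ (1 - b) * (C * 2 ^ b)) ^ n, by positivity, fun M hM => ?_⟩
  obtain ⟨hs, ht⟩ := h (2 * M) (by positivity)
  set f : ι → ℕ → ℝ := fun _ k =>
    2 ^ (1 - b) * (((k : ℝ) + 1) ^ (b - 1) * ((1 + (k + 1) / (2 * M)) ^ 2)⁻¹) with hf
  have hf0 : ∀ i k, 0 ≤ f i k := fun i k => by positivity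
  have hfs : ∀ i, Summable fun k => ‖f i k‖ := fun i => (hs.mul_left _).norm
  have hS := (summable_norm_pi_prod hfs).of_norm
  rw [hexp]
  have hle : ∀ m : ι → ℕ, (if m = 0 then 0 else latticeNorm m ^ (n * (b - 1)) *
      ((1 + latticeNorm m / M) ^ (2 * n))⁻¹) ≤ ∏ i, f i (m i) := by
    intro m
    split_ifs with hm
    · exact Finset.prod_nonneg fun i _ => hf0 i _
    · exact dual_term_le hm hM hb1
  have h0 : ∀ m : ι → ℕ, 0 ≤ (if m = 0 then 0 else latticeNorm m ^ (n * (b - 1)) *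
      ((1 + latticeNorm m / M) ^ (2 * n))⁻¹) := by
    intro m
    have : 0 ≤ latticeNorm m := Real.sqrt_nonneg _
    split_ifs <;> positivity
  have hsum := Summable.of_nonneg_of_le h0 hle hS
  refine ⟨hsum, (hsum.tsum_le_tsum hle hS).trans ?_⟩
  rw [tsum_pi_prod hfs]
  simp only [hf, tsum_mul_left, Finset.prod_const, Finset.card_univ]
  rw [← hn', hexp2, Real.rpow_mul hM.le, Real.rpow_natCast, ← mul_pow]
  refine pow_le_pow_left₀ (mul_nonneg (by positivity) (tsum_nonneg fun k => by positivity)) ?_ n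
  calc _ ≤ 2 ^ (1 - b) * (C * (2 * M) ^ b) := by gcongr
    _ = _ := by rw [Real.mul_rpow zero_le_two hM.le]; ring

end DualSum

section DualTerm

variable {ι : Type*} [Fintype ι] {d : ι → ℕ} {g : ι → ℕ → ℂ → ℂ} {C : ℝ}

theorem symbolBoundAt_prod_dual (m : ι → ℕ) {R : ℝ} {s : ℂ} (hR : 1 ≤ R) (hs0 : 0 < ‖s‖)
    (hg : ∀ i m, SymbolBoundAt (g i m) s
      (C * ((√‖s‖)⁻¹ * (R + m / ‖s‖) ^ (d i - 1)))) (hC : 0 ≤ C) :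
    SymbolBoundAt (fun z => ∏ i, g i (m i) z) s
      ((2 * C) ^ Fintype.card ι * (((√‖s‖)⁻¹) ^ Fintype.card ι *
        (R + latticeNorm m / ‖s‖) ^ (∑ i, (d i - 1)))) := by
  refine (SymbolBoundAt.prod Finset.univ fun i _ => hg i (m i)).mono ?_
  have h0 : 0 ≤ R := by linarith
  calc _ ≤ 2 ^ Fintype.card ι * ∏ i, (C * ((√‖s‖)⁻¹ * (R + latticeNorm m / ‖s‖) ^ (d i - 1))) := by
        rw [Finset.card_univ]
        refine mul_le_mul_of_nonneg_left (Finset.prod_le_prod (fun i _ => by positivity)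
          fun i _ => ?_) (by positivity)
        have := le_latticeNorm m i
        gcongr
    _ = _ := by
        rw [Finset.prod_mul_distrib, Finset.prod_mul_distrib, Finset.prod_const,
          Finset.prod_const, Finset.card_univ, Finset.prod_pow_eq_pow_sum]
        ring

end DualTerm

end

section

open MeasureTheory Set Filter Topology

section DualIntegral

variable {ι : Type*} [Fintype ι] {d : ι → ℕ} {g : ι → ℕ → ℂ → ℂ} {C : ℝ}

theorem re_line (c y : ℝ) : ((c : ℂ) + Complex.I * y).re = c := by simp

theorem im_line (c y : ℝ) : ((c : ℂ) + Complex.I * y).im = y := by simp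

theorem prod_dual_cexp (m : ι → ℕ) (s : ℂ) :
    ∏ i, Complex.exp (-((Real.pi ^ 2 * (m i : ℝ) ^ 2 : ℝ) : ℂ) / s) =
      Complex.exp (-((Real.pi ^ 2 * latticeNorm m ^ 2 : ℝ) : ℂ) / s) := by
  rw [← Complex.exp_sum, latticeNorm_sq, ← Finset.sum_div, Finset.sum_neg_distrib]
  push_cast
  rw [Finset.mul_sum]

theorem exists_norm_integral_dual_le (hn : 2 ≤ Fintype.card ι) (j : ℕ) (hC : 0 < C)
    (hg : ∀ i, ∀ (R : ℝ) (s : ℂ) (m : ℕ), 1 ≤ R → 0 < s.re → (R ^ 2)⁻¹ ≤ ‖s‖ →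
      SymbolBoundAt (g i m) s (C * ((√‖s‖)⁻¹ * (R + m / ‖s‖) ^ (d i - 1)))) :
    ∃ C' > 0, ∀ R T Y : ℝ, 1 ≤ R → 0 ≤ T → T ≤ R ^ 2 → 0 < Y → Y ≤ R ^ 2 →
      ∀ m : ι → ℕ, m ≠ 0 → ∀ s : ℝ → ℂ, (∀ y, s y = (((R ^ 2)⁻¹ : ℝ) : ℂ) + Complex.I * y) →
      ‖∫ y in Ioi (0 : ℝ), Complex.exp (s y * T) * (smoothKernel Y j (s y) *
        ∏ i, (g i (m i) (s y) * Complex.exp (-((Real.pi ^ 2 * (m i : ℝ) ^ 2 : ℝ) : ℂ) / s y)))‖ ≤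
      C' * R ^ (∑ i, (d i - 1)) * (R ^ (((Fintype.card ι : ℝ) - 1) / 2) *
        (latticeNorm m ^ (-((Fintype.card ι : ℝ) + 1) / 2) *
          ((1 + latticeNorm m / (R / Y)) ^ j)⁻¹)) := by
  set n := Fintype.card ι with hn'
  set L := ∑ i, (d i - 1) with hL
  have hn2 : (2 : ℝ) ≤ n := by exact_mod_cast hn
  obtain ⟨C₁, hC₁, hosc⟩ := norm_integral_osc_le (α := (n : ℝ) / 2) (by linarith) L j
  obtain ⟨C₂, hC₂, hK⟩ := exists_symbolBoundAt_smoothKernel j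
  refine ⟨C₁ * (2 * C₂ * (2 * C) ^ n), by positivity, fun R T Y hR hT hTR hY hYR m hm s hs => ?_⟩
  have hR0 : 0 < R := by linarith
  have hr : 0 < latticeNorm m := by linarith [one_le_latticeNorm hm]
  set r := latticeNorm m with hr'
  have hre : ∀ y, (s y).re = (R ^ 2)⁻¹ := fun y => by rw [hs, re_line]
  have hσ : ∀ y, (R ^ 2)⁻¹ ≤ ‖s y‖ := fun y => (hre y).symm.le.trans (Complex.re_le_norm _)
  have hσ0 : ∀ y, 0 < ‖s y‖ := fun y => lt_of_lt_of_le (by positivity) (hσ y)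
  have hre0 : ∀ y, 0 < (s y).re := fun y => by rw [hre]; positivity
  set A : ℝ := 2 * C₂ * (2 * C) ^ n * R ^ L with hA
  have hsym : ∀ y, SymbolBoundAt (fun z => smoothKernel Y j z * ∏ i, g i (m i) z) (s y)
      (A * ampl ((n : ℝ) / 2) L j (r / R) Y ‖s y‖) := by
    intro y
    have h1 := hK Y (s y) hY (hre0 y) (by
      rw [hre, inv_mul_le_iff₀ (by positivity), mul_one]; exact hYR)
    have h2 := symbolBoundAt_prod_dual m hR (hσ0 y)
      (fun i m => hg i R (s y) m hR (hre0 y) (hσ y)) hC.le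
    refine (h1.mul h2).mono (le_of_eq ?_)
    rw [← hn', ← hL, ← hr', hA, ampl]
    have e1 : ‖s y‖ ^ (-((n : ℝ) / 2) - 1) = ‖s y‖⁻¹ * ((√‖s y‖)⁻¹) ^ n := by
      rw [Real.sqrt_eq_rpow, ← Real.rpow_neg (hσ0 y).le, ← Real.rpow_natCast,
        ← Real.rpow_mul (hσ0 y).le, ← Real.rpow_neg_one, ← Real.rpow_add (hσ0 y)]
      congr 1; ring
    have e2 : (R + r / ‖s y‖) ^ L = R ^ L * (1 + r / R / ‖s y‖) ^ L := by
      rw [← mul_pow]; congr 1; field_simp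
    rw [e1, e2]; ring
  have hds : ∀ y, HasDerivAt s Complex.I y := by
    intro y
    have h0 : s = fun y : ℝ => (((R ^ 2)⁻¹ : ℝ) : ℂ) + Complex.I * y := funext hs
    rw [h0]
    simpa using ((Complex.ofRealCLM.hasDerivAt (x := y)).const_mul Complex.I).const_add
      (((R ^ 2)⁻¹ : ℝ) : ℂ)
  choose f' hf' hfb using fun y => (hsym y).2
  have h := hosc R T Y A r hR0 hT hTR hY.le (by positivity) hr s
    (fun y => smoothKernel Y j (s y) * ∏ i, g i (m i) (s y)) (fun y => f' y * Complex.I) hs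
    (fun y _ => (hf' y).comp y (hds y)) (fun y _ => (hsym y).1) (fun y _ => by
      rw [norm_mul, Complex.norm_I, mul_one, le_div_iff₀ (hσ0 y), mul_comm]
      exact hfb y)
  have e : ∀ y, Complex.exp (s y * T) * (smoothKernel Y j (s y) *
      ∏ i, (g i (m i) (s y) * Complex.exp (-((Real.pi ^ 2 * (m i : ℝ) ^ 2 : ℝ) : ℂ) / s y))) =
      Complex.exp (s y * T) * Complex.exp (-(Real.pi ^ 2 * r ^ 2 : ℝ) / s y) *
        (smoothKernel Y j (s y) * ∏ i, g i (m i) (s y)) := by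
    intro y
    rw [Finset.prod_mul_distrib, prod_dual_cexp]
    ring
  simp only [e]
  refine h.trans (le_of_eq ?_)
  have e3 : r⁻¹ * (r / R) ^ (1 / 2 - (n : ℝ) / 2) =
      R ^ (((n : ℝ) - 1) / 2) * r ^ (-((n : ℝ) + 1) / 2) := by
    rw [Real.div_rpow hr.le hR0.le, div_eq_mul_inv, ← Real.rpow_neg hR0.le, ← Real.rpow_neg_one,
      ← mul_assoc, ← Real.rpow_add hr, mul_comm]
    congr 2 <;> ring
  have e4 : r / R * Y = r / (R / Y) := by field_simp
  rw [← mul_assoc r⁻¹, e3, e4, hA]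
  ring

end DualIntegral

end

section

open MeasureTheory Set Filter Topology

section DualSwap

variable {ι : Type*} [Fintype ι] {d : ι → ℕ} {g : ι → ℕ → ℂ → ℂ} {θ E : ι → ℂ → ℂ} {C : ℝ}

theorem inv_one_add_div_le {t : ℝ} (ht : 0 < t) {m : ℝ} (hm : 0 ≤ m) :
    (1 + m / t)⁻¹ ≤ (1 + t) * (1 + m)⁻¹ := by
  rw [← div_eq_mul_inv, le_div_iff₀ (by positivity), inv_mul_le_iff₀ (by positivity)]
  have : (1 + m / t) * (1 + t) = 1 + m + (t + m / t) := by field_simp; ring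
  rw [this]
  have : 0 ≤ t + m / t := by positivity
  linarith

theorem exists_norm_dual_prod_le (hC : 0 < C)
    (hg : ∀ i, ∀ (R : ℝ) (s : ℂ) (m : ℕ), 1 ≤ R → 0 < s.re → (R ^ 2)⁻¹ ≤ ‖s‖ →
      SymbolBoundAt (g i m) s (C * ((√‖s‖)⁻¹ * (R + m / ‖s‖) ^ (d i - 1)))) :
    ∃ C' > 0, ∀ (R : ℝ) (s : ℂ), 1 ≤ R → s.re = (R ^ 2)⁻¹ → ∀ m : ι → ℕ,
      ‖∏ i, (g i (m i) s * Complex.exp (-((Real.pi ^ 2 * (m i : ℝ) ^ 2 : ℝ) : ℂ) / s))‖ ≤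
        C' * R ^ (∑ i, (d i - 1)) * (R * (1 + R * ‖s‖) ^ 2) ^ Fintype.card ι *
          ∏ i, ((1 + (m i : ℝ)) ^ 2)⁻¹ := by
  choose K hK hb using fun i => exists_mul_norm_cexp_le (d i - 1) 2
  refine ⟨∏ i, (C * K i), Finset.prod_pos fun i _ => by have := hK i; positivity,
    fun R s hR hs m => ?_⟩
  have hR0 : 0 < R := by linarith
  have hσ : (R ^ 2)⁻¹ ≤ ‖s‖ := hs.symm.le.trans (Complex.re_le_norm _)
  have hσ0 : 0 < ‖s‖ := lt_of_lt_of_le (by positivity) hσ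
  rw [← Finset.prod_pow_eq_pow_sum, ← Finset.card_univ, ← Finset.prod_const,
    ← Finset.prod_mul_distrib, ← Finset.prod_mul_distrib, ← Finset.prod_mul_distrib, norm_prod]
  refine Finset.prod_le_prod (fun i _ => norm_nonneg _) fun i _ => ?_
  have h1 := (hg i R s (m i) hR (by rw [hs]; positivity) hσ).1
  have h2 := hb i R (m i) s hR0 hs (Nat.cast_nonneg _)
  have h3 : (√‖s‖)⁻¹ ≤ R := by
    rw [inv_le_comm₀ (by positivity) hR0]
    refine Real.le_sqrt_of_sq_le ?_
    rwa [inv_pow]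
  have h4 := inv_one_add_div_le (t := R * ‖s‖) (by positivity) (m := m i) (Nat.cast_nonneg _)
  have hKi := hK i
  rw [norm_mul]
  calc _ ≤ C * ((√‖s‖)⁻¹ * (R + m i / ‖s‖) ^ (d i - 1)) *
        ‖Complex.exp (-((Real.pi ^ 2 * (m i : ℝ) ^ 2 : ℝ) : ℂ) / s)‖ := by gcongr
    _ = C * (√‖s‖)⁻¹ * ((R + m i / ‖s‖) ^ (d i - 1) *
        ‖Complex.exp (-((Real.pi ^ 2 * (m i : ℝ) ^ 2 : ℝ) : ℂ) / s)‖) := by ring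
    _ ≤ C * R * (K i * R ^ (d i - 1) * ((1 + m i / (R * ‖s‖))⁻¹) ^ 2) := by
        rw [inv_pow]
        gcongr
    _ ≤ C * R * (K i * R ^ (d i - 1) * ((1 + R * ‖s‖) * (1 + (m i : ℝ))⁻¹) ^ 2) := by gcongr
    _ = _ := by rw [mul_pow, inv_pow]; ring

theorem summable_prod_inv_sq : Summable fun m : ι → ℕ => ∏ i, ((1 + (m i : ℝ)) ^ 2)⁻¹ := by
  have h : Summable fun k : ℕ => ‖((1 + (k : ℝ)) ^ 2)⁻¹‖ := by
    simpa only [mul_one] using (summable_inv_one_add_mul_sq one_pos).norm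
  have h2 := summable_norm_pi_prod (𝕜 := ℝ) (ι := ι) (f := fun _ k => ((1 + (k : ℝ)) ^ 2)⁻¹)
    fun _ => h
  exact h2.of_norm

theorem exists_norm_integral_nonzero_dual_le (hn : 2 ≤ Fintype.card ι) (hC : 0 < C)
    (hg : ∀ i, ∀ (R : ℝ) (s : ℂ) (m : ℕ), 1 ≤ R → 0 < s.re → (R ^ 2)⁻¹ ≤ ‖s‖ →
      SymbolBoundAt (g i m) s (C * ((√‖s‖)⁻¹ * (R + m / ‖s‖) ^ (d i - 1))))
    (hsum : ∀ i, ∀ s : ℂ, 0 < s.re → 0 ≤ s.im → HasSum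
      (fun m : ℕ => g i m s * Complex.exp (-((Real.pi ^ 2 * (m : ℝ) ^ 2 : ℝ) : ℂ) / s))
      (θ i s - E i s)) :
    ∃ C' > 0, ∀ R T Y : ℝ, 1 ≤ R → 0 ≤ T → T ≤ R ^ 2 → 0 < Y → Y ≤ R ^ 2 →
      ∀ s : ℝ → ℂ, (∀ y, s y = (((R ^ 2)⁻¹ : ℝ) : ℂ) + Complex.I * y) →
      IntegrableOn (fun y : ℝ => Complex.exp (s y * T) *
        (smoothKernel Y (2 * Fintype.card ι) (s y) *
        (∏ i, (θ i (s y) - E i (s y)) - ∏ i, g i 0 (s y)))) (Ioi 0) ∧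
      ‖∫ y in Ioi (0 : ℝ), Complex.exp (s y * T) * (smoothKernel Y (2 * Fintype.card ι) (s y) *
        (∏ i, (θ i (s y) - E i (s y)) - ∏ i, g i 0 (s y)))‖ ≤
      C' * R ^ (∑ i, (d i - 1)) * (R ^ (((Fintype.card ι : ℝ) - 1) / 2) *
        (R / Y) ^ (((Fintype.card ι : ℝ) - 1) / 2)) := by
  classical
  set n := Fintype.card ι with hn'
  obtain ⟨C₁, hC₁, h1⟩ := exists_norm_integral_dual_le hn (2 * n) hC hg
  obtain ⟨C₂, hC₂, h2⟩ := exists_norm_dual_prod_le hC hg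
  obtain ⟨C₃, hC₃, h3⟩ := exists_tsum_dual_le (ι := ι) hn
  obtain ⟨C₄, hC₄, h4⟩ := exists_symbolBoundAt_smoothKernel (2 * n)
  refine ⟨C₁ * C₃, by positivity, fun R T Y hR hT hTR hY hYR s hs => ?_⟩
  have hR0 : 0 < R := by linarith
  have hre : ∀ y, (s y).re = (R ^ 2)⁻¹ := fun y => by rw [hs, re_line]
  have hσ : ∀ y, (R ^ 2)⁻¹ ≤ ‖s y‖ := fun y => (hre y).symm.le.trans (Complex.re_le_norm _)
  have hσ0 : ∀ y, 0 < ‖s y‖ := fun y => lt_of_lt_of_le (by positivity) (hσ y)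
  have hre0 : ∀ y, 0 < (s y).re := fun y => by rw [hre]; positivity
  have hreY : ∀ y, (s y).re * Y ≤ 1 := fun y => by
    rw [hre, inv_mul_le_iff₀ (by positivity), mul_one]; exact hYR
  have hsc : Continuous s := by
    rw [show s = fun y : ℝ => (((R ^ 2)⁻¹ : ℝ) : ℂ) + Complex.I * y from funext hs]
    fun_prop
  set F : (ι → ℕ) → ℝ → ℂ := fun m y => if m = 0 then 0 else
    Complex.exp (s y * T) * (smoothKernel Y (2 * n) (s y) *
        ∏ i, (g i (m i) (s y) * Complex.exp (-((Real.pi ^ 2 * (m i : ℝ) ^ 2 : ℝ) : ℂ) / s y)))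
    with hF
  set W : ℝ := Real.exp ((R ^ 2)⁻¹ * T) * (8 ^ (2 * n + 1) * (C₂ * R ^ (∑ i, (d i - 1)) *
    (R * (1 + R / Y) ^ 2) ^ n)) * Y⁻¹ with hW
  have hdom : ∀ m y, ‖F m y‖ ≤ W * ‖(s y ^ 2)⁻¹‖ * ∏ i, ((1 + (m i : ℝ)) ^ 2)⁻¹ := by
    intro m y
    simp only [hF]
    have hp : 0 ≤ ∏ i, ((1 + (m i : ℝ)) ^ 2)⁻¹ := Finset.prod_nonneg fun i _ => by positivity
    split_ifs with hm
    · rw [norm_zero]; positivity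
    have hk := norm_smoothKernel_le hY.le (2 * n) (hreY y)
    have hpr := h2 R (s y) hR (hre y) m
    have hexp : ‖Complex.exp (s y * T)‖ = Real.exp ((R ^ 2)⁻¹ * T) := by
      rw [Complex.norm_exp]; simp [hre]
    have ht : 1 + R * ‖s y‖ ≤ (1 + R / Y) * (1 + ‖s y‖ * Y) := by
      have : (1 + R / Y) * (1 + ‖s y‖ * Y) = 1 + R * ‖s y‖ + (R / Y + ‖s y‖ * Y) := by
        field_simp; ring
      rw [this]
      have : 0 ≤ R / Y + ‖s y‖ * Y := by positivity
      linarith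
    have hu : (1 + ‖s y‖ * Y)⁻¹ ≤ ‖s y‖⁻¹ * Y⁻¹ := by
      rw [← mul_inv]
      refine inv_anti₀ (by have := hσ0 y; positivity) (by linarith)
    have hv : 0 < 1 + ‖s y‖ * Y := by positivity
    rw [norm_mul, norm_mul, hexp]
    calc _ ≤ Real.exp ((R ^ 2)⁻¹ * T) *
          ((8 ^ (2 * n + 1) * (‖s y‖⁻¹ * ((1 + ‖s y‖ * Y) ^ (2 * n + 1))⁻¹)) *
          (C₂ * R ^ (∑ i, (d i - 1)) * (R * ((1 + R / Y) * (1 + ‖s y‖ * Y)) ^ 2) ^ n *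
          ∏ i, ((1 + (m i : ℝ)) ^ 2)⁻¹)) := by
          refine mul_le_mul_of_nonneg_left (mul_le_mul hk (hpr.trans ?_) (norm_nonneg _)
            (by positivity)) (Real.exp_nonneg _)
          gcongr
      _ = Real.exp ((R ^ 2)⁻¹ * T) * (8 ^ (2 * n + 1) * (C₂ * R ^ (∑ i, (d i - 1)) *
          (R * (1 + R / Y) ^ 2) ^ n)) * (‖s y‖⁻¹ * (1 + ‖s y‖ * Y)⁻¹) *
          ∏ i, ((1 + (m i : ℝ)) ^ 2)⁻¹ := by
          have : ((1 + ‖s y‖ * Y) ^ (2 * n + 1))⁻¹ * ((1 + ‖s y‖ * Y) ^ 2) ^ n =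
              (1 + ‖s y‖ * Y)⁻¹ := by
            rw [← pow_mul, pow_succ, mul_inv, mul_right_comm, inv_mul_cancel₀ (by positivity),
              one_mul]
          rw [← this]
          simp only [mul_pow]
          ring
      _ ≤ Real.exp ((R ^ 2)⁻¹ * T) * (8 ^ (2 * n + 1) * (C₂ * R ^ (∑ i, (d i - 1)) *
          (R * (1 + R / Y) ^ 2) ^ n)) * (‖s y‖⁻¹ * (‖s y‖⁻¹ * Y⁻¹)) *
          ∏ i, ((1 + (m i : ℝ)) ^ 2)⁻¹ := by gcongr
      _ = _ := by rw [norm_inv, norm_pow, hW]; ring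
  have hline : Integrable fun y : ℝ => ‖(s y ^ 2)⁻¹‖ := by
    simp only [hs]
    exact (integrable_inv_line_sq (by positivity)).norm
  have hcont : ∀ m, Continuous (F m) := by
    intro m
    simp only [hF]
    split_ifs
    · exact continuous_const
    refine ((hsc.mul continuous_const).cexp).mul (Continuous.mul ?_ ?_)
    · refine continuous_iff_continuousAt.2 fun y => ?_
      obtain ⟨_, f', hf', _⟩ := h4 Y (s y) hY (hre0 y) (hreY y)
      exact ContinuousAt.comp hf'.continuousAt hsc.continuousAt
    · refine continuous_finsetProd _ fun i _ => Continuous.mul ?_ ?_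
      · refine continuous_iff_continuousAt.2 fun y => ?_
        obtain ⟨_, f', hf', _⟩ := hg i R (s y) (m i) hR (hre0 y) (hσ y)
        exact ContinuousAt.comp hf'.continuousAt hsc.continuousAt
      · exact (Continuous.div continuous_const hsc fun y => norm_pos_iff.1 (hσ0 y)).cexp
  have hFi : ∀ m, IntegrableOn (F m) (Ioi 0) := fun m =>
    (((hline.const_mul W).mul_const _).mono' (hcont m).aestronglyMeasurable
      (.of_forall (hdom m))).integrableOn
  have hFs : Summable fun m => ∫ y in Ioi (0 : ℝ), ‖F m y‖ := by
    refine Summable.of_nonneg_of_le (fun m => integral_nonneg fun y => norm_nonneg _) (fun m => ?_)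
      (summable_prod_inv_sq.mul_left (∫ y in Ioi (0 : ℝ), W * ‖(s y ^ 2)⁻¹‖))
    rw [← integral_mul_const]
    exact integral_mono (hFi m).norm ((hline.const_mul W).mul_const _).integrableOn (hdom m)
  have hswap := hasSum_integral_of_summable_integral_norm hFi hFs
  have hval : ∀ y ∈ Ioi (0 : ℝ), Complex.exp (s y * T) * (smoothKernel Y (2 * n) (s y) *
        (∏ i, (θ i (s y) - E i (s y)) - ∏ i, g i 0 (s y))) = ∑' m, F m y := by
    intro y hy
    have him : 0 ≤ (s y).im := by
      rw [hs, im_line]; exact le_of_lt hy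
    have hP := hasSum_pi_prod (f := fun i k => g i k (s y) *
      Complex.exp (-((Real.pi ^ 2 * (k : ℝ) ^ 2 : ℝ) : ℂ) / s y)) (fun i =>
        (hsum i (s y) (hre0 y) him).summable.norm) (fun i => hsum i (s y) (hre0 y) him)
    have h0 := (hasSum_ite_sub_hasSum hP 0).mul_left
      (Complex.exp (s y * T) * smoothKernel Y (2 * n) (s y))
    rw [← mul_assoc]
    refine Eq.trans ?_ (h0.congr_fun ?_).tsum_eq.symm
    · simp
    · intro m
      simp only [hF]
      split_ifs <;> ring
  have htc : Continuous fun y => ∑' m, F m y := by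
    refine continuous_tsum hcont (summable_prod_inv_sq.mul_left (W * (R ^ 2) ^ 2))
      fun m y => (hdom m y).trans ?_
    refine mul_le_mul_of_nonneg_right (mul_le_mul_of_nonneg_left ?_ (by positivity))
      (Finset.prod_nonneg fun i _ => by positivity)
    rw [norm_inv, norm_pow, ← inv_pow]
    refine pow_le_pow_left₀ (by positivity) ?_ 2
    rw [inv_le_comm₀ (hσ0 y) (by positivity)]
    exact hσ y
  have hti : IntegrableOn (fun y => ∑' m, F m y) (Ioi 0) := by
    refine (((hline.const_mul W).mul_const (∑' m : ι → ℕ, ∏ i, ((1 + (m i : ℝ)) ^ 2)⁻¹)).mono'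
      htc.aestronglyMeasurable (.of_forall fun y => ?_)).integrableOn
    exact tsum_of_norm_bounded (summable_prod_inv_sq.hasSum.mul_left _) fun m => hdom m y
  refine ⟨hti.congr_fun (fun y hy => (hval y hy).symm) measurableSet_Ioi, ?_⟩
  rw [setIntegral_congr_fun measurableSet_Ioi hval]
  obtain ⟨hsm, htm⟩ := h3 (R / Y) (by positivity)
  rw [← hswap.tsum_eq]
  refine (tsum_of_norm_bounded ((hsm.hasSum.mul_left (C₁ * R ^ (∑ i, (d i - 1)) *
    R ^ (((n : ℝ) - 1) / 2)))) fun m => ?_).trans ?_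
  · by_cases hm : m = 0
    · simp [hF, hm]
    · simp only [hF, if_neg hm]
      refine (h1 R T Y hR hT hTR hY hYR m hm s hs).trans (le_of_eq (by ring))
  · calc _ ≤ C₁ * R ^ (∑ i, (d i - 1)) * R ^ (((n : ℝ) - 1) / 2) *
          (C₃ * (R / Y) ^ (((n : ℝ) - 1) / 2)) := by gcongr
      _ = _ := by ring

end DualSwap

end

section

open MeasureTheory Set Filter Topology

theorem norm_gaussMass_le {R : ℝ} (hR : 0 < R) {s : ℂ} (hs : s.re = (R ^ 2)⁻¹) :
    ‖gaussMass s‖ ≤ 2 * R := by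
  have hσ : (R ^ 2)⁻¹ ≤ ‖s‖ := hs.symm.le.trans (Complex.re_le_norm _)
  have hσ0 : 0 < ‖s‖ := lt_of_lt_of_le (by positivity) hσ
  refine le_of_sq_le_sq ?_ (by positivity)
  rw [norm_gaussMass_sq, div_eq_mul_inv]
  have h1 : ‖s‖⁻¹ ≤ R ^ 2 := by rw [inv_le_comm₀ hσ0 (by positivity)]; exact hσ
  nlinarith [Real.pi_lt_four, Real.pi_pos, inv_pos.2 hσ0]

theorem exists_norm_gaussMass_pow_mul_eval_sub_le {d : ℕ} {q : Polynomial ℂ}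
    (hq : 2 * q.natDegree + 1 ≤ d) : ∃ C > 0, ∀ (R : ℝ) (s : ℂ), 1 ≤ R → s.re = (R ^ 2)⁻¹ →
      ‖gaussMass s ^ d * q.eval s - q.coeff 0 * gaussMass s ^ d‖ ≤ C * (R ^ d / R ^ 2) := by
  refine ⟨∑ l ∈ Finset.range q.natDegree, ‖q.coeff (l + 1)‖ * (Real.pi ^ (l + 1) * 2 ^ d) + 1,
    by positivity, fun R s hR hs => ?_⟩
  have hR0 : 0 < R := by linarith
  have hs0 : s ≠ 0 := fun h => by
    rw [h, Complex.zero_re] at hs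
    have : 0 < (R ^ 2)⁻¹ := by positivity
    linarith
  rw [Polynomial.eval_eq_sum_range, Finset.sum_range_succ', pow_zero, mul_one, mul_add,
    mul_comm (gaussMass s ^ d) (q.coeff 0), add_sub_cancel_right, Finset.mul_sum, add_mul,
    Finset.sum_mul]
  refine (norm_sum_le _ _).trans (le_add_of_le_of_nonneg (Finset.sum_le_sum fun l hl => ?_)
    (by positivity))
  have hl' := Finset.mem_range.1 hl
  obtain ⟨k, rfl⟩ : ∃ k, d = 2 * (l + 1) + k := ⟨d - 2 * (l + 1), by omega⟩
  have e : gaussMass s ^ (2 * (l + 1) + k) * (q.coeff (l + 1) * s ^ (l + 1)) =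
      q.coeff (l + 1) * ((Real.pi : ℂ) ^ (l + 1) * gaussMass s ^ k) := by
    rw [pow_add, pow_mul, gaussMass_sq, div_pow]
    field_simp
  rw [e, norm_mul, norm_mul, norm_pow, norm_pow, Complex.norm_real,
    Real.norm_of_nonneg Real.pi_pos.le, mul_assoc, mul_assoc]
  refine mul_le_mul_of_nonneg_left (mul_le_mul_of_nonneg_left ?_ (by positivity)) (norm_nonneg _)
  calc ‖gaussMass s‖ ^ k ≤ (2 * R) ^ k := by gcongr; exact norm_gaussMass_le hR0 hs
    _ = 2 ^ k * (R ^ k * R ^ 2 / R ^ 2) := by field_simp; ring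
    _ ≤ 2 ^ (2 * (l + 1) + k) * (R ^ (2 * (l + 1) + k) / R ^ 2) := by
      rw [← pow_add]
      refine mul_le_mul (pow_le_pow_right₀ one_le_two (by omega)) ?_ (by positivity) (by positivity)
      exact div_le_div_of_nonneg_right (pow_le_pow_right₀ hR (by omega)) (by positivity)

theorem exists_norm_ofReal_le_of_thetaExpansion {d : ℕ} {a : ℝ} {θ : ℂ → ℂ} (hd : 1 ≤ d)
    (h : ThetaExpansion d a θ) : ∃ C > 0, ∀ R : ℝ, 1 ≤ R →
      ‖θ (((R ^ 2)⁻¹ : ℝ) : ℂ)‖ ≤ C * R ^ d := by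
  obtain ⟨C, q, g, E, hC, hq, ha, hg0, hsum, hsym, hE⟩ := h
  obtain ⟨K, hK, hb⟩ := exists_mul_norm_cexp_le (d - 1) 2
  have hS : Summable fun k : ℕ => ((1 + (k : ℝ)) ^ 2)⁻¹ := by
    simpa only [mul_one] using summable_inv_one_add_mul_sq one_pos
  have hS0 : 0 ≤ ∑' k : ℕ, ((1 + (k : ℝ)) ^ 2)⁻¹ := tsum_nonneg fun k => by positivity
  refine ⟨C * K * (∑' k : ℕ, ((1 + (k : ℝ)) ^ 2)⁻¹) + C, by positivity, fun R hR => ?_⟩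
  have hR0 : 0 < R := by linarith
  set s : ℂ := (((R ^ 2)⁻¹ : ℝ) : ℂ) with hs
  have hre : s.re = (R ^ 2)⁻¹ := Complex.ofReal_re _
  have hnorm : ‖s‖ = (R ^ 2)⁻¹ := by rw [hs, Complex.norm_real, Real.norm_of_nonneg (by positivity)]
  have him : 0 ≤ s.im := by rw [hs, Complex.ofReal_im]
  have h1 := hsum s (by rw [hre]; positivity) him
  have h2 : ‖θ s - E s‖ ≤ C * K * R ^ d * ∑' k : ℕ, ((1 + (k : ℝ)) ^ 2)⁻¹ := by
    refine h1.norm_le_of_bounded (hS.hasSum.mul_left _) fun m => ?_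
    have h3 := (hsym R s m hR (by rw [hre]; positivity) hnorm.ge).1
    have h4 := hb R m s hR0 hre (Nat.cast_nonneg _)
    have h5 : (√‖s‖)⁻¹ = R := by rw [hnorm, Real.sqrt_inv, inv_inv, Real.sqrt_sq hR0.le]
    have h6 : (1 + (m : ℝ)) ≤ 1 + m / (R * ‖s‖) := by
      have : (m : ℝ) / (R * ‖s‖) = m * R := by rw [hnorm]; field_simp
      rw [this]
      have := le_mul_of_one_le_right (Nat.cast_nonneg (α := ℝ) m) hR
      linarith
    rw [h5] at h3
    rw [norm_mul]
    calc _ ≤ C * (R * (R + m / ‖s‖) ^ (d - 1)) *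
          ‖Complex.exp (-((Real.pi ^ 2 * (m : ℝ) ^ 2 : ℝ) : ℂ) / s)‖ := by gcongr
      _ = C * R * ((R + m / ‖s‖) ^ (d - 1) *
          ‖Complex.exp (-((Real.pi ^ 2 * (m : ℝ) ^ 2 : ℝ) : ℂ) / s)‖) := by ring
      _ ≤ C * R * (K * R ^ (d - 1) * ((1 + m / (R * ‖s‖)) ^ 2)⁻¹) := by gcongr
      _ ≤ C * R * (K * R ^ (d - 1) * ((1 + (m : ℝ)) ^ 2)⁻¹) := by gcongr
      _ = C * K * (R * R ^ (d - 1)) * ((1 + (m : ℝ)) ^ 2)⁻¹ := by ring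
      _ = _ := by rw [← pow_succ', Nat.sub_add_cancel hd]
  have h3 : ‖E s‖ ≤ C * R ^ d := by
    refine (hE R s hR hre him).trans (mul_le_mul_of_nonneg_left ?_ hC.le)
    exact div_le_self (by positivity) (one_le_pow₀ hR)
  calc ‖θ s‖ = ‖(θ s - E s) + E s‖ := by rw [sub_add_cancel]
    _ ≤ _ := norm_add_le _ _
    _ ≤ C * K * R ^ d * (∑' k : ℕ, ((1 + (k : ℝ)) ^ 2)⁻¹) + C * R ^ d := add_le_add h2 h3
    _ = _ := by ring

section HalfLine

variable {ι : Type*} [Fintype ι] {d : ι → ℕ} {a : ι → ℝ} {θ : ι → ℂ → ℂ}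

theorem exists_norm_halfLine_integral_le (hn : 2 ≤ Fintype.card ι) (hd : ∀ i, 1 ≤ d i)
    (hθ : ∀ i, ThetaExpansion (d i) (a i) (θ i))
    (hdom : ∀ i, ∀ s : ℂ, 0 < s.re → ‖θ i s‖ ≤ ‖θ i (s.re : ℂ)‖) {δ : ℝ} (hδ : 0 < δ)
    (hδ1 : δ ≤ 1) :
    ∃ C > 0, ∀ R T Y : ℝ, 1 ≤ R → 0 ≤ T → T ≤ R ^ 2 → 0 < Y → Y ≤ R ^ 2 →
      ∀ s : ℝ → ℂ, (∀ y, s y = (((R ^ 2)⁻¹ : ℝ) : ℂ) + Complex.I * y) →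
      Integrable (fun y : ℝ => Complex.exp (s y * T) *
        (smoothKernel Y (2 * Fintype.card ι) (s y) *
          (∏ i, θ i (s y) - (∏ i, (a i : ℂ)) * gaussMass (s y) ^ (∑ i, d i)))) →
      ‖∫ y in Ioi (0 : ℝ), Complex.exp (s y * T) *
        (smoothKernel Y (2 * Fintype.card ι) (s y) *
          (∏ i, θ i (s y) - (∏ i, (a i : ℂ)) * gaussMass (s y) ^ (∑ i, d i)))‖ ≤
      C * (R ^ (∑ i, d i) / R ^ 2 * ((R ^ 2)⁻¹ * Y) ^ (-δ) +
        R ^ (∑ i, (d i - 1)) * (R ^ (((Fintype.card ι : ℝ) - 1) / 2) *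
          (R / Y) ^ (((Fintype.card ι : ℝ) - 1) / 2))) := by
  set n := Fintype.card ι with hn'
  choose C₁ hC₁ hgrow using fun i => exists_norm_ofReal_le_of_thetaExpansion (hd i) (hθ i)
  choose C₀ q g E hC₀ hq ha hg0 hsum hsym hE using hθ
  choose C₂ hC₂ hpoly using fun i => exists_norm_gaussMass_pow_mul_eval_sub_le (hq i)
  set C : ℝ := ∑ i, C₀ i + 1 with hC
  have hCi : ∀ i, C₀ i ≤ C := fun i =>
    (Finset.single_le_sum (fun i _ => (hC₀ i).le) (Finset.mem_univ i)).trans (by linarith)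
  have hCpos : 0 < C := by
    have : 0 ≤ ∑ i, C₀ i := Finset.sum_nonneg fun i _ => (hC₀ i).le
    linarith
  obtain ⟨C₃, hC₃, hdual⟩ := exists_norm_integral_nonzero_dual_le (θ := θ) (E := E) hn hCpos
    (fun i R s m hR hs hsR => (hsym i R s m hR hs hsR).mono (by
      have : 0 ≤ R := by linarith
      have := hCi i
      gcongr)) hsum
  obtain ⟨C₄, hC₄, hker⟩ := exists_integral_norm_smoothKernel_le (2 * n) hδ hδ1
  set b : ι → ℝ := fun i => C₁ i + C₀ i + C₂ i + |a i| * 2 ^ d i with hb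
  have hb0 : ∀ i, 0 < b i := fun i => by
    have := hC₁ i; have := hC₀ i; have := hC₂ i
    positivity
  set B : ℝ := 2 * n * ∏ i, b i with hB
  have hBpos : 0 ≤ B := mul_nonneg (by positivity) (Finset.prod_nonneg fun i _ => (hb0 i).le)
  refine ⟨Real.exp 1 * B * C₄ + C₃, by positivity, fun R T Y hR hT hTR hY hYR s hs hint => ?_⟩
  have hR0 : 0 < R := by linarith
  have hre : ∀ y, (s y).re = (R ^ 2)⁻¹ := fun y => by rw [hs, re_line]
  have hre0 : ∀ y, 0 < (s y).re := fun y => by rw [hre]; positivity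
  have hcY : (R ^ 2)⁻¹ * Y ≤ 1 := by
    rw [inv_mul_le_iff₀ (by positivity), mul_one]; exact hYR
  obtain ⟨hdi, hdb⟩ := hdual R T Y hR hT hTR hY hYR s hs
  obtain ⟨hki, hkb⟩ := hker (R ^ 2)⁻¹ Y (by positivity) hY hcY
  simp only [← hs] at hki hkb
  have hrest : ∀ y ∈ Ioi (0 : ℝ), ‖∏ i, θ i (s y) - (∏ i, (a i : ℂ)) * gaussMass (s y) ^ (∑ i, d i)
      - (∏ i, (θ i (s y) - E i (s y)) - ∏ i, g i 0 (s y))‖ ≤ B * (R ^ (∑ i, d i) / R ^ 2) := by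
    intro y hy
    have him : 0 ≤ (s y).im := by rw [hs, im_line]; exact le_of_lt hy
    have hθb : ∀ i, ‖θ i (s y)‖ ≤ C₁ i * R ^ d i := fun i =>
      (hdom i (s y) (hre0 y)).trans (by rw [hre]; exact hgrow i R hR)
    have hEb : ∀ i, ‖E i (s y)‖ ≤ C₀ i * (R ^ d i / R ^ 2) := fun i => hE i R (s y) hR (hre y) him
    have hωb : ∀ i, ‖(a i : ℂ) * gaussMass (s y) ^ d i‖ ≤ |a i| * 2 ^ d i * R ^ d i := fun i => by
      rw [norm_mul, norm_pow, Complex.norm_real, Real.norm_eq_abs, mul_assoc, ← mul_pow]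
      gcongr
      exact norm_gaussMass_le hR0 (hre y)
    have hgb : ∀ i, ‖g i 0 (s y) - a i * gaussMass (s y) ^ d i‖ ≤ C₂ i * (R ^ d i / R ^ 2) :=
      fun i => by
        have := hpoly i R (s y) hR (hre y)
        rwa [← hg0 i, ha i] at this
    have hRd : ∀ i, R ^ d i / R ^ 2 ≤ R ^ d i := fun i =>
      div_le_self (by positivity) (one_le_pow₀ hR)
    have hRp : ∀ i, 0 < R ^ d i := fun i => by positivity
    have h1 := norm_prod_sub_prod_le Finset.univ (x := fun i => θ i (s y))
      (y := fun i => θ i (s y) - E i (s y)) (b := fun i => b i * R ^ d i) (ε := (R ^ 2)⁻¹)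
      (fun i => ?_) (fun i => ?_) (fun i => ?_)
    have h2 := norm_prod_sub_prod_le Finset.univ (x := fun i => g i 0 (s y))
      (y := fun i => (a i : ℂ) * gaussMass (s y) ^ d i) (b := fun i => b i * R ^ d i)
      (ε := (R ^ 2)⁻¹) (fun i => ?_) (fun i => ?_) (fun i => ?_)
    · rw [Finset.prod_mul_distrib (f := fun i => (a i : ℂ)), Finset.prod_pow_eq_pow_sum] at h2
      rw [Finset.prod_mul_distrib, Finset.prod_pow_eq_pow_sum, Finset.card_univ, ← hn'] at h1 h2
      calc _ = ‖(∏ i, θ i (s y) - ∏ i, (θ i (s y) - E i (s y))) + (∏ i, g i 0 (s y) -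
            (∏ i, (a i : ℂ)) * gaussMass (s y) ^ (∑ i, d i))‖ := by congr 1; ring
        _ ≤ _ := norm_add_le _ _
        _ ≤ _ := add_le_add h1 h2
        _ = _ := by rw [hB]; ring
    all_goals
      have := hC₁ i
      have := hC₀ i
      have := hC₂ i
      have h0 : 0 ≤ |a i| * 2 ^ d i := by positivity
      have := hRp i
    · have : ‖g i 0 (s y)‖ ≤ C₂ i * R ^ d i + |a i| * 2 ^ d i * R ^ d i := by
        rw [← sub_add_cancel (g i 0 (s y)) (a i * gaussMass (s y) ^ d i)]
        exact (norm_add_le _ _).trans (add_le_add ((hgb i).trans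
          (mul_le_mul_of_nonneg_left (hRd i) (hC₂ i).le)) (hωb i))
      refine this.trans ?_
      rw [← add_mul]
      gcongr
      simp only [hb]; linarith
    · refine (hωb i).trans ?_
      gcongr
      simp only [hb]; linarith
    · refine (hgb i).trans (le_of_eq_of_le (by ring : _ = (R ^ 2)⁻¹ * (C₂ i * R ^ d i)) ?_)
      gcongr
      simp only [hb]; linarith
    · refine (hθb i).trans ?_
      gcongr
      simp only [hb]; linarith
    · refine (norm_sub_le _ _).trans ((add_le_add (hθb i) ((hEb i).trans
        (mul_le_mul_of_nonneg_left (hRd i) (hC₀ i).le))).trans ?_)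
      rw [← add_mul]
      gcongr
      simp only [hb]; linarith
    · rw [sub_sub_cancel]
      refine (hEb i).trans (le_of_eq_of_le (by ring : _ = (R ^ 2)⁻¹ * (C₀ i * R ^ d i)) ?_)
      gcongr
      simp only [hb]; linarith
  have hexp : ∀ y, ‖Complex.exp (s y * T)‖ ≤ Real.exp 1 := by
    intro y
    rw [Complex.norm_exp, Real.exp_le_exp]
    have : (s y * T).re = (R ^ 2)⁻¹ * T := by simp [hre]
    rw [this, inv_mul_le_iff₀ (by positivity), mul_one]
    exact hTR
  have hsplit := integral_sub hint.integrableOn hdi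
  set I₁ := ∫ y in Ioi (0 : ℝ), Complex.exp (s y * T) * (smoothKernel Y (2 * n) (s y) *
          (∏ i, θ i (s y) - (∏ i, (a i : ℂ)) * gaussMass (s y) ^ (∑ i, d i)))
  set I₂ := ∫ y in Ioi (0 : ℝ), Complex.exp (s y * T) * (smoothKernel Y (2 * n) (s y) *
        (∏ i, (θ i (s y) - E i (s y)) - ∏ i, g i 0 (s y)))
  have h3 : ‖I₁ - I₂‖ ≤ Real.exp 1 * B * C₄ *
      (R ^ (∑ i, d i) / R ^ 2 * ((R ^ 2)⁻¹ * Y) ^ (-δ)) := by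
    rw [← hsplit]
    have h4 : ∫ y in Ioi (0 : ℝ), ‖smoothKernel Y (2 * n) (s y)‖ ≤ C₄ * ((R ^ 2)⁻¹ * Y) ^ (-δ) :=
      (setIntegral_le_integral hki.norm (.of_forall fun y => norm_nonneg _)).trans hkb
    refine (norm_integral_le_of_norm_le ((hki.norm.integrableOn).const_mul
      (Real.exp 1 * (B * (R ^ (∑ i, d i) / R ^ 2))))
      ((ae_restrict_mem measurableSet_Ioi).mono fun y hy => ?_)).trans ?_
    · rw [← mul_sub, ← mul_sub, norm_mul, norm_mul, mul_comm ‖smoothKernel _ _ _‖, ← mul_assoc]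
      refine mul_le_mul_of_nonneg_right ?_ (norm_nonneg _)
      exact mul_le_mul (hexp y) (hrest y hy) (norm_nonneg _) (Real.exp_nonneg _)
    · rw [integral_const_mul]
      refine (mul_le_mul_of_nonneg_left h4 (by positivity)).trans (le_of_eq (by ring))
  set X₁ := R ^ (∑ i, d i) / R ^ 2 * ((R ^ 2)⁻¹ * Y) ^ (-δ) with hX₁
  set X₂ := R ^ (∑ i, (d i - 1)) * (R ^ (((n : ℝ) - 1) / 2) * (R / Y) ^ (((n : ℝ) - 1) / 2)) with hX₂
  have hX₁0 : 0 ≤ X₁ := by positivity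
  have hX₂0 : 0 ≤ X₂ := by positivity
  calc ‖I₁‖ = ‖(I₁ - I₂) + I₂‖ := by rw [sub_add_cancel]
    _ ≤ Real.exp 1 * B * C₄ * X₁ + C₃ * X₂ :=
      (norm_add_le _ _).trans (add_le_add h3 (hdb.trans (le_of_eq (by rw [hX₂]; ring))))
    _ ≤ _ := by
      have : 0 ≤ C₃ * X₁ + Real.exp 1 * B * C₄ * X₂ := by positivity
      nlinarith

end HalfLine

end

section

open MeasureTheory Set Filter Topology

theorem conj_line (c y : ℝ) :
    (starRingEnd ℂ) ((c : ℂ) + Complex.I * y) = (c : ℂ) + Complex.I * ((-y : ℝ) : ℂ) := by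
  simp

theorem smoothKernel_conj (Y : ℝ) (j : ℕ) (s : ℂ) :
    smoothKernel Y j ((starRingEnd ℂ) s) = (starRingEnd ℂ) (smoothKernel Y j s) := by
  simp [smoothKernel, avgExp, ← Complex.exp_conj]

theorem norm_integral_le_two_mul_of_conj {φ : ℝ → ℂ} (hφ : Integrable φ)
    (hc : ∀ y, φ (-y) = (starRingEnd ℂ) (φ y)) :
    ‖∫ y, φ y‖ ≤ 2 * ‖∫ y in Ioi (0 : ℝ), φ y‖ := by
  rw [integral_eq_Ioi_add_comp_neg hφ]
  simp only [hc]
  rw [integral_conj, two_mul]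
  exact (norm_add_le _ _).trans_eq (by rw [RCLike.norm_conj])

section SphereTheta

variable {e : ℕ} {θ : ℂ → ℂ}

/-- The coordinate `k + e / 2`, whose square is a shifted eigenvalue of the sphere `S^{e+1}`. -/
noncomputable def sphereCoord (e k : ℕ) : ℝ := k + e / 2

theorem norm_le_norm_ofReal_re_of_hasSum (h : ∀ s : ℂ, 0 < s.re → HasSum (fun k : ℕ =>
      ((sphereMult (e + 1) k : ℝ) : ℂ) * Complex.exp (-s * ((sphereCoord e k ^ 2 : ℝ) : ℂ)))
      (θ s)) {s : ℂ} (hs : 0 < s.re) : ‖θ s‖ ≤ ‖θ (s.re : ℂ)‖ := by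
  have h1 := Complex.hasSum_re (h (s.re : ℂ) (by simpa using hs))
  refine ((h s hs).norm_le_of_bounded h1 fun k => le_of_eq ?_).trans
    (Complex.re_le_norm _)
  rw [norm_mul, Complex.norm_real, Real.norm_of_nonneg (sphereMult_nonneg _ _), Complex.norm_exp,
    Complex.re_ofReal_mul, ← Complex.ofReal_neg, ← Complex.ofReal_mul, ← Complex.ofReal_exp,
    Complex.ofReal_re, Complex.re_mul_ofReal, Complex.neg_re]

theorem apply_conj_of_hasSum (h : ∀ s : ℂ, 0 < s.re → HasSum (fun k : ℕ =>
      ((sphereMult (e + 1) k : ℝ) : ℂ) * Complex.exp (-s * ((sphereCoord e k ^ 2 : ℝ) : ℂ)))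
      (θ s)) {s : ℂ} (hs : 0 < s.re) : θ ((starRingEnd ℂ) s) = (starRingEnd ℂ) (θ s) := by
  refine (h _ (by simpa using hs)).unique ?_
  have h1 := Complex.hasSum_conj'.2 (h s hs)
  refine h1.congr_fun fun k => ?_
  simp [← Complex.exp_conj]

theorem exists_sphereTheta (e : ℕ) : ∃ θ : ℂ → ℂ,
    (∀ s : ℂ, 0 < s.re → HasSum (fun k : ℕ =>
      ((sphereMult (e + 1) k : ℝ) : ℂ) * Complex.exp (-s * ((sphereCoord e k ^ 2 : ℝ) : ℂ)))
      (θ s)) ∧ ThetaExpansion (e + 1) (momentConst e / e.factorial) θ := by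
  obtain ⟨θ, h1, h2⟩ := exists_thetaExpansion_sphere e 0
  refine ⟨θ, fun s hs => (h1 s hs).congr_fun fun k => ?_, by simpa using h2⟩
  simp [sphereCoord]

end SphereTheta

section SmoothCount

variable {ι : Type*} [Fintype ι]

/-- The multiplicity attached to a tuple of spherical harmonic degrees on the product of the
spheres `S^{e i + 1}`. -/
noncomputable def prodMult (e : ι → ℕ) (m : ι → ℕ) : ℝ := ∏ i, sphereMult (e i + 1) (m i)

/-- The shifted eigenvalue attached to a tuple of spherical harmonic degrees. -/
noncomputable def prodEigen (e : ι → ℕ) (m : ι → ℕ) : ℝ := ∑ i, sphereCoord (e i) (m i) ^ 2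

/-- The Weyl constant in terms of Gaussian moments. -/
noncomputable def momentWeylConst (e : ι → ℕ) : ℝ :=
  (∏ i, momentConst (e i) / (e i).factorial) *
    (2 / momentConst (∑ i, (e i + 1) - 1)) / (∑ i, (e i + 1) : ℕ)

theorem prodMult_nonneg (e m : ι → ℕ) : 0 ≤ prodMult e m :=
  Finset.prod_nonneg fun _ _ => sphereMult_nonneg _ _

variable {e : ι → ℕ} {θ : ι → ℂ → ℂ}

theorem hasSum_prod_sphereTheta (h : ∀ i, ∀ s : ℂ, 0 < s.re → HasSum (fun k : ℕ =>
      ((sphereMult (e i + 1) k : ℝ) : ℂ) * Complex.exp (-s * ((sphereCoord (e i) k ^ 2 : ℝ) : ℂ)))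
      (θ i s)) {s : ℂ} (hs : 0 < s.re) :
    (Summable fun m => ‖(prodMult e m : ℂ) * Complex.exp (-s * prodEigen e m)‖) ∧
    HasSum (fun m => (prodMult e m : ℂ) * Complex.exp (-s * prodEigen e m)) (∏ i, θ i s) := by
  have hsn : ∀ i, Summable fun k : ℕ => ‖((sphereMult (e i + 1) k : ℝ) : ℂ) *
      Complex.exp (-s * ((sphereCoord (e i) k ^ 2 : ℝ) : ℂ))‖ := fun i => (h i s hs).summable.norm
  have key : ∀ m : ι → ℕ, ∏ i, (((sphereMult (e i + 1) (m i) : ℝ) : ℂ) *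
      Complex.exp (-s * ((sphereCoord (e i) (m i) ^ 2 : ℝ) : ℂ))) =
      (prodMult e m : ℂ) * Complex.exp (-s * prodEigen e m) := by
    intro m
    rw [Finset.prod_mul_distrib, ← Complex.exp_sum, ← Finset.mul_sum, prodMult, prodEigen,
      Complex.ofReal_prod, Complex.ofReal_sum]
  have h1 := summable_norm_pi_prod hsn
  have h2 := hasSum_pi_prod hsn fun i => h i s hs
  simp only [key] at h1 h2
  exact ⟨h1, h2⟩

set_option maxHeartbeats 600000 in
theorem exists_abs_smoothCount_sub_le (hn : 2 ≤ Fintype.card ι) (e : ι → ℕ) {δ : ℝ} (hδ : 0 < δ)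
    (hδ1 : δ ≤ 1) :
    ∃ C > 0, ∀ R T Y : ℝ, 1 ≤ R → 0 < Y → ((2 * Fintype.card ι : ℕ) + 1) * Y ≤ R ^ 2 →
      R ^ 2 - ((2 * Fintype.card ι : ℕ) + 1) * Y ≤ T → T ≤ R ^ 2 →
      |(∫ m : ι → ℕ, prodMult e m * smoothStep Y (2 * Fintype.card ι) (T - prodEigen e m)
          ∂Measure.count) - momentWeylConst e * R ^ (∑ i, (e i + 1))| ≤
      C * (R ^ (∑ i, (e i + 1)) / R ^ 2 * ((R ^ 2)⁻¹ * Y) ^ (-δ) +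
        R ^ (∑ i, e i) * (R ^ (((Fintype.card ι : ℝ) - 1) / 2) *
          (R / Y) ^ (((Fintype.card ι : ℝ) - 1) / 2)) + R ^ (∑ i, (e i + 1)) / R ^ 2 * Y) := by
  set n := Fintype.card ι with hn'
  choose θ hsum hexp using fun i => exists_sphereTheta (e i)
  obtain ⟨C₁, hC₁, h1⟩ := exists_norm_halfLine_integral_le hn (fun i => Nat.le_add_left 1 (e i))
    hexp (fun i s hs => norm_le_norm_ofReal_re_of_hasSum (hsum i) hs) hδ hδ1
  obtain ⟨m, hm⟩ : ∃ m, ∑ i, (e i + 1) = m + 2 := by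
    refine ⟨∑ i, (e i + 1) - 2, ?_⟩
    have : n ≤ ∑ i, (e i + 1) := by
      rw [Finset.sum_add_distrib]; simp [hn']
    omega
  have hmc : 0 < momentConst (m + 1) := momentConst_pos _
  set P : ℝ := ∏ i, momentConst (e i) / (e i).factorial with hP
  have hP0 : 0 ≤ P := Finset.prod_nonneg fun i _ =>
    div_nonneg (momentConst_pos _).le (Nat.cast_nonneg _)
  set C₂ : ℝ := P * (2 / momentConst (m + 1)) * (((2 * n : ℕ) + 1) * 2 ^ m) with hC₂
  have hC₂0 : 0 ≤ C₂ := by positivity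
  refine ⟨C₁ + C₂, by positivity, fun R T Y hR hY hYR hT hTR => ?_⟩
  have hR0 : 0 < R := by linarith
  have hYR1 : Y ≤ R ^ 2 := by
    refine le_trans ?_ hYR
    have : 0 ≤ ((2 * n : ℕ) : ℝ) * Y := by positivity
    linarith
  have hT0 : 0 ≤ T := by linarith
  have hc : 0 < (R ^ 2)⁻¹ := by positivity
  have hcY : (R ^ 2)⁻¹ * Y ≤ 1 := by
    rw [inv_mul_le_iff₀ (by positivity), mul_one]; exact hYR1
  set c : ℝ := (R ^ 2)⁻¹ with hc'
  set s : ℝ → ℂ := fun y => (c : ℂ) + Complex.I * y with hs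
  have hre : ∀ y, 0 < (s y).re := fun y => by rw [hs]; simpa only [re_line] using hc
  have hwi : Integrable (fun m : ι → ℕ => prodMult e m * Real.exp (-c * prodEigen e m))
      Measure.count := by
    rw [integrable_count_iff]
    refine (hasSum_prod_sphereTheta hsum (s := (c : ℂ)) (by simpa using hc)).1.congr fun m => ?_
    rw [← Complex.ofReal_neg, ← Complex.ofReal_mul, ← Complex.ofReal_exp, ← Complex.ofReal_mul,
      Complex.norm_real]
  have hprod : ∀ y, ∏ i, θ i (s y) = ∫ m : ι → ℕ, (prodMult e m : ℂ) *
      Complex.exp (-((c : ℂ) + Complex.I * y) * prodEigen e m) ∂Measure.count := by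
    intro y
    obtain ⟨ha, hb⟩ := hasSum_prod_sphereTheta hsum (hre y)
    rw [← hb.tsum_eq, ← integral_count_eq_tsum ha]
  have i1 := integrable_line_smoothKernel_laplace (measurable_of_countable (prodEigen e)) hc hY hcY
    hwi (2 * n) T
  have v1 := integral_line_smoothKernel_laplace (measurable_of_countable (prodEigen e)) hc hY hcY
    hwi (2 * n) T
  simp only [← hprod] at i1 v1
  have i2 := (integrable_line_gaussMass_pow hc hY hcY (2 * n) (m + 1) T).const_mul (P : ℂ)
  have v2 := integral_line_gaussMass_pow hc hY hcY (2 * n) (m + 1) T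
  set N := ∫ m : ι → ℕ, prodMult e m * smoothStep Y (2 * n) (T - prodEigen e m) ∂Measure.count
  set G := ∫ x in Ioi (0 : ℝ), x ^ (m + 1) * smoothStep Y (2 * n) (T - x ^ 2)
  have hfun : ∀ y : ℝ, Complex.exp (s y * T) * (smoothKernel Y (2 * n) (s y) *
      (∏ i, θ i (s y) - (∏ i, ((momentConst (e i) / (e i).factorial : ℝ) : ℂ)) *
        gaussMass (s y) ^ (∑ i, (e i + 1)))) =
      Complex.exp (((c : ℂ) + Complex.I * y) * T) * smoothKernel Y (2 * n) ((c : ℂ) + Complex.I * y)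
        * (∏ i, θ i (s y)) - (P : ℂ) * (Complex.exp (((c : ℂ) + Complex.I * y) * T) *
        smoothKernel Y (2 * n) ((c : ℂ) + Complex.I * y) *
        gaussMass ((c : ℂ) + Complex.I * y) ^ (m + 1 + 1)) := by
    intro y
    rw [hm, hP, Complex.ofReal_prod]
    ring
  have hint : Integrable (fun y : ℝ => Complex.exp (s y * T) * (smoothKernel Y (2 * n) (s y) *
      (∏ i, θ i (s y) - (∏ i, ((momentConst (e i) / (e i).factorial : ℝ) : ℂ)) *
        gaussMass (s y) ^ (∑ i, (e i + 1))))) :=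
    (i1.sub i2).congr (.of_forall fun y => (hfun y).symm)
  have hhalf := h1 R T Y hR hT0 hTR hY hYR1 s (fun y => rfl) hint
  simp only [Nat.add_sub_cancel] at hhalf
  have hconj := norm_integral_le_two_mul_of_conj hint fun y => by
    have hsc : s (-y) = (starRingEnd ℂ) (s y) := by
      simp only [hs]
      rw [conj_line]
    rw [hsc, smoothKernel_conj, gaussMass_conj (hre y)]
    simp only [apply_conj_of_hasSum (hsum _) (hre y)]
    simp [← Complex.exp_conj]
  have hval : ∫ y : ℝ, Complex.exp (s y * T) * (smoothKernel Y (2 * n) (s y) *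
      (∏ i, θ i (s y) - (∏ i, ((momentConst (e i) / (e i).factorial : ℝ) : ℂ)) *
        gaussMass (s y) ^ (∑ i, (e i + 1)))) =
      ((2 * Real.pi * (N - P * (2 / momentConst (m + 1) * G)) : ℝ) : ℂ) := by
    simp only [hfun]
    rw [integral_sub i1 i2, integral_const_mul, v1, v2]
    push_cast
    ring
  rw [hval, Complex.norm_real, Real.norm_eq_abs, abs_mul,
    abs_of_pos Real.two_pi_pos] at hconj
  set X₁ := R ^ (∑ i, (e i + 1)) / R ^ 2 * (c * Y) ^ (-δ)
  set X₂ := R ^ (∑ i, e i) * (R ^ (((n : ℝ) - 1) / 2) * (R / Y) ^ (((n : ℝ) - 1) / 2))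
  have hX₁ : 0 ≤ X₁ := by positivity
  have hX₂ : 0 ≤ X₂ := by positivity
  have hmain : |N - P * (2 / momentConst (m + 1) * G)| ≤ C₁ * (X₁ + X₂) := by
    have h3 := hconj.trans (mul_le_mul_of_nonneg_left hhalf zero_le_two)
    have h4 := abs_nonneg (N - P * (2 / momentConst (m + 1) * G))
    have := Real.pi_gt_three
    nlinarith
  have hG := abs_smoothMoment_sub_le m (2 * n) hR0 hY hYR hT hTR
  have hRD : R ^ (∑ i, (e i + 1)) / R ^ 2 = R ^ m := by
    rw [hm, pow_add]; field_simp
  rw [hRD]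
  have hW : momentWeylConst e * R ^ (∑ i, (e i + 1)) =
      P * (2 / momentConst (m + 1) * (R ^ (m + 2) / (m + 2))) := by
    rw [momentWeylConst, hm]
    simp only [hP]
    push_cast
    ring
  have hsec : |P * (2 / momentConst (m + 1) * G) - momentWeylConst e * R ^ (∑ i, (e i + 1))| ≤
      C₂ * (R ^ m * Y) := by
    rw [hW, ← mul_sub, ← mul_sub, abs_mul, abs_mul, abs_of_nonneg hP0,
      abs_of_pos (by positivity : 0 < 2 / momentConst (m + 1))]
    calc _ ≤ P * (2 / momentConst (m + 1) * (((2 * n : ℕ) + 1) * 2 ^ m * (R ^ m * Y))) := by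
          gcongr
      _ = _ := by rw [hC₂]; ring
  have hZ : 0 ≤ R ^ m * Y := by positivity
  refine (abs_sub_le _ (P * (2 / momentConst (m + 1) * G)) _).trans
    ((add_le_add hmain hsec).trans ?_)
  have h0 : 0 ≤ C₂ * (X₁ + X₂) + C₁ * (R ^ m * Y) := by positivity
  have h5 : (C₁ + C₂) * (X₁ + X₂ + R ^ m * Y) =
      C₁ * (X₁ + X₂) + C₂ * (R ^ m * Y) + (C₂ * (X₁ + X₂) + C₁ * (R ^ m * Y)) := by ring
  rw [h5]
  exact le_add_of_nonneg_right h0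

end SmoothCount

end

section

open MeasureTheory Set Filter Topology

section Sandwich

variable {ι : Type*} [Fintype ι]

theorem cast_le_sphereCoord (e k : ℕ) : (k : ℝ) ≤ sphereCoord e k :=
  le_add_of_nonneg_right (by positivity)

theorem finite_prodEigen_le (e : ι → ℕ) (B : ℝ) : {m : ι → ℕ | prodEigen e m ≤ B}.Finite := by
  refine (Set.Finite.pi' fun _ : ι => Set.finite_Iic ⌊|B| + 1⌋₊).subset fun m hm i => ?_
  refine Nat.le_floor ?_
  have h1 : sphereCoord (e i) (m i) ^ 2 ≤ prodEigen e m :=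
    Finset.single_le_sum (f := fun i => sphereCoord (e i) (m i) ^ 2) (fun _ _ => sq_nonneg _)
      (Finset.mem_univ i)
  have h2 := cast_le_sphereCoord (e i) (m i)
  have h3 : (0 : ℝ) ≤ m i := Nat.cast_nonneg _
  have h4 : prodEigen e m ≤ |B| := le_trans hm (le_abs_self B)
  nlinarith

theorem integral_smoothCount_eq_tsum (e : ι → ℕ) {Y : ℝ} (hY : 0 < Y) (j : ℕ) (T : ℝ) :
    (Summable fun m : ι → ℕ => prodMult e m * smoothStep Y j (T - prodEigen e m)) ∧
    ∫ m : ι → ℕ, prodMult e m * smoothStep Y j (T - prodEigen e m) ∂Measure.count =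
      ∑' m : ι → ℕ, prodMult e m * smoothStep Y j (T - prodEigen e m) := by
  have h : Summable fun m : ι → ℕ => prodMult e m * smoothStep Y j (T - prodEigen e m) := by
    refine summable_of_hasFiniteSupport ((finite_prodEigen_le e (T + (j + 1) * Y)).subset
      fun m hm => ?_)
    by_contra hlt
    rw [Set.mem_ofPred_eq, not_le] at hlt
    exact hm (by simp only [smoothStep_of_le hY j (by linarith : T - prodEigen e m ≤ _), mul_zero])
  exact ⟨h, integral_count_eq_tsum h.norm⟩

open scoped Classical in
theorem tsum_count_bounds (e : ι → ℕ) {Y : ℝ} (hY : 0 < Y) (j : ℕ) (T : ℝ) :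
    ∫ m : ι → ℕ, prodMult e m * smoothStep Y j (T - (j + 1) * Y - prodEigen e m) ∂Measure.count ≤
      (∑' m : ι → ℕ, if prodEigen e m ≤ T then prodMult e m else 0) ∧
    (∑' m : ι → ℕ, if prodEigen e m ≤ T then prodMult e m else 0) ≤
      ∫ m : ι → ℕ, prodMult e m * smoothStep Y j (T - prodEigen e m) ∂Measure.count := by
  have hs : Summable fun m : ι → ℕ => if prodEigen e m ≤ T then prodMult e m else 0 := by
    refine summable_of_hasFiniteSupport ((finite_prodEigen_le e T).subset fun m hm => ?_)
    by_contra hlt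
    exact hm (if_neg hlt)
  obtain ⟨h1, h1'⟩ := integral_smoothCount_eq_tsum e hY j (T - (j + 1) * Y)
  obtain ⟨h2, h2'⟩ := integral_smoothCount_eq_tsum e hY j T
  rw [h1', h2']
  refine ⟨h1.tsum_le_tsum (fun m => ?_) hs, hs.tsum_le_tsum (fun m => ?_) h2⟩
  · split_ifs with h
    · exact mul_le_of_le_one_right (prodMult_nonneg e m) (smoothStep_le_one hY j _)
    · rw [smoothStep_of_le hY j (by linarith), mul_zero]
  · split_ifs with h
    · rw [smoothStep_of_nonneg hY j (by linarith), mul_one]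
    · exact mul_nonneg (prodMult_nonneg e m) (smoothStep_nonneg hY j _)

theorem exists_abs_smoothCount_sub_le_rpow (hn : 2 ≤ Fintype.card ι) (e : ι → ℕ) :
    ∃ C > 0, ∀ R : ℝ, 1 ≤ R → ∃ Y > 0, ∀ T : ℝ,
      R ^ 2 - ((2 * Fintype.card ι : ℕ) + 1) * Y ≤ T → T ≤ R ^ 2 →
      |(∫ m : ι → ℕ, prodMult e m * smoothStep Y (2 * Fintype.card ι) (T - prodEigen e m)
          ∂Measure.count) - momentWeylConst e * R ^ (∑ i, (e i + 1))| ≤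
      C * R ^ (((∑ i, (e i + 1) : ℕ) : ℝ) - 1 -
        ((Fintype.card ι : ℝ) - 1) / ((Fintype.card ι : ℝ) + 1)) := by
  set n := Fintype.card ι with hn'
  have hn2 : (2 : ℝ) ≤ n := by exact_mod_cast hn
  set δ : ℝ := 1 / ((n : ℝ) + 1) with hδ
  have hδ0 : 0 < δ := by positivity
  have hδ1 : δ ≤ 1 := by rw [hδ, div_le_one (by positivity)]; linarith
  have hδn : δ * ((n : ℝ) + 1) = 1 := by rw [hδ]; field_simp
  obtain ⟨C, hC, h⟩ := exists_abs_smoothCount_sub_le hn e hδ0 hδ1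
  set ρ : ℝ := ((2 * n : ℕ) + 1 : ℝ) with hρ
  have hρ1 : 1 ≤ ρ := by rw [hρ]; simp
  have hρ0 : 0 < ρ := by linarith
  set D := ∑ i, (e i + 1) with hD
  have hDe : (D : ℝ) = (∑ i, e i : ℕ) + n := by
    rw [hD, Finset.sum_add_distrib]; simp [hn']
  refine ⟨C * (ρ ^ δ + ρ ^ (((n : ℝ) - 1) / 2) + ρ⁻¹), by positivity, fun R hR => ?_⟩
  have hR0 : 0 < R := by linarith
  set p : ℝ := (D : ℝ) - 1 - ((n : ℝ) - 1) / ((n : ℝ) + 1) with hp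
  have hpδ : p = (D : ℝ) - 2 + 2 * δ := by
    rw [hp, hδ]; field_simp; ring
  refine ⟨R ^ (2 * δ) / ρ, by positivity, fun T hT hTR => ?_⟩
  set Y : ℝ := R ^ (2 * δ) / ρ with hY
  have hY0 : 0 < Y := by positivity
  have hρY : ρ * Y = R ^ (2 * δ) := by rw [hY]; field_simp
  have hYR : ρ * Y ≤ R ^ 2 := by
    rw [hρY, ← Real.rpow_natCast]
    exact Real.rpow_le_rpow_of_exponent_le hR (by push_cast; linarith)
  have hb := h R T Y hR hY0 hYR hT hTR
  refine hb.trans ?_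
  rw [mul_assoc]
  refine mul_le_mul_of_nonneg_left ?_ hC.le
  have hRD : R ^ D / R ^ 2 = R ^ ((D : ℝ) - 2) := by
    rw [Real.rpow_sub hR0, Real.rpow_natCast, Real.rpow_ofNat]
  have hb1 : R ^ D / R ^ 2 * ((R ^ 2)⁻¹ * Y) ^ (-δ) ≤ ρ ^ δ * R ^ p := by
    have h1 : ((R ^ 2)⁻¹ * Y) ^ (-δ) ≤ ρ ^ δ * R ^ (2 * δ) := by
      have h2 : ((R ^ 2)⁻¹ * Y)⁻¹ ≤ ρ * R ^ 2 := by
        rw [hY, mul_inv, inv_inv, inv_div, mul_comm]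
        refine mul_le_mul_of_nonneg_right (div_le_self hρ0.le ?_) (by positivity)
        exact Real.one_le_rpow hR (by positivity)
      rw [Real.rpow_neg (by positivity), ← Real.inv_rpow (by positivity)]
      calc _ ≤ (ρ * R ^ 2) ^ δ := by gcongr
        _ = _ := by
          rw [Real.mul_rpow hρ0.le (by positivity), Real.rpow_mul hR0.le, Real.rpow_ofNat]
    rw [hRD]
    calc _ ≤ R ^ ((D : ℝ) - 2) * (ρ ^ δ * R ^ (2 * δ)) := by gcongr
      _ = _ := by rw [hpδ, Real.rpow_add hR0]; ring
  have hb2 : R ^ (∑ i, e i) * (R ^ (((n : ℝ) - 1) / 2) * (R / Y) ^ (((n : ℝ) - 1) / 2)) =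
      ρ ^ (((n : ℝ) - 1) / 2) * R ^ p := by
    have h1 : R / Y = ρ * R ^ (1 - 2 * δ) := by
      rw [hY, Real.rpow_sub hR0, Real.rpow_one]; field_simp
    rw [h1, Real.mul_rpow hρ0.le (by positivity), ← Real.rpow_mul hR0.le, ← Real.rpow_natCast R]
    have h2 : p = (∑ i, e i : ℕ) + (((n : ℝ) - 1) / 2 + (1 - 2 * δ) * (((n : ℝ) - 1) / 2)) := by
      rw [hpδ, hDe]
      linear_combination hδn
    rw [h2, Real.rpow_add hR0, Real.rpow_add hR0]
    ring
  have hb3 : R ^ D / R ^ 2 * Y = ρ⁻¹ * R ^ p := by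
    rw [hRD, hY, hpδ, Real.rpow_add hR0]
    ring
  rw [hb2, hb3, add_mul, add_mul]
  gcongr

open scoped Classical in
theorem exists_abs_tsum_count_sub_le (hn : 2 ≤ Fintype.card ι) (e : ι → ℕ) :
    ∃ C > 0, ∀ R : ℝ, 1 ≤ R →
      |(∑' m : ι → ℕ, if prodEigen e m ≤ R ^ 2 then prodMult e m else 0) -
        momentWeylConst e * R ^ (∑ i, (e i + 1))| ≤
      C * R ^ (((∑ i, (e i + 1) : ℕ) : ℝ) - 1 -
        ((Fintype.card ι : ℝ) - 1) / ((Fintype.card ι : ℝ) + 1)) := by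
  obtain ⟨C, hC, h⟩ := exists_abs_smoothCount_sub_le_rpow hn e
  refine ⟨C, hC, fun R hR => ?_⟩
  obtain ⟨Y, hY, hT⟩ := h R hR
  have hj : 0 ≤ (((2 * Fintype.card ι : ℕ) : ℝ) + 1) * Y := by positivity
  have h1 := abs_le.1 (hT (R ^ 2 - ((2 * Fintype.card ι : ℕ) + 1) * Y) le_rfl (by linarith))
  have h2 := abs_le.1 (hT (R ^ 2) (by linarith) le_rfl)
  obtain ⟨h3, h4⟩ := tsum_count_bounds e hY (2 * Fintype.card ι) (R ^ 2)
  rw [abs_le]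
  constructor <;> linarith [h1.1, h2.2]

end Sandwich

end

section

open MeasureTheory Set Filter Topology

variable {ι : Type*} [Fintype ι]

theorem momentConst_eq (k : ℕ) :
    momentConst k = Real.Gamma (((k : ℝ) + 1) / 2) / √Real.pi ^ (k + 1) := by
  rw [momentConst, Real.rpow_div_two_eq_sqrt _ Real.pi_pos.le, ← Nat.cast_succ,
    Real.rpow_natCast]

theorem toReal_volume_unitBall (k : ℕ) :
    (volume (Metric.ball (0 : EuclideanSpace ℝ (Fin (k + 1))) 1)).toReal =
      √Real.pi ^ (k + 1) / Real.Gamma ((k + 1 : ℝ) / 2 + 1) := by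
  rw [EuclideanSpace.volume_ball, Fintype.card_fin, ENNReal.ofReal_one, one_pow, one_mul,
    ENNReal.toReal_ofReal, Nat.cast_succ]
  exact div_nonneg (by positivity) (Real.Gamma_pos_of_pos (by positivity)).le

theorem two_div_momentConst_div (k : ℕ) :
    2 / momentConst k / (k + 1 : ℕ) =
      (volume (Metric.ball (0 : EuclideanSpace ℝ (Fin (k + 1))) 1)).toReal := by
  rw [toReal_volume_unitBall, momentConst_eq, Real.Gamma_add_one (by positivity)]
  have h := (Real.Gamma_pos_of_pos (by positivity : (0 : ℝ) < (k + 1) / 2)).ne'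
  push_cast
  field_simp

theorem momentConst_div_factorial (k : ℕ) :
    momentConst k / k.factorial =
      (((k + 1 : ℕ) : ℝ) + 1) *
        (volume (Metric.ball (0 : EuclideanSpace ℝ (Fin (k + 1 + 1))) 1)).toReal /
          (2 * Real.pi) ^ (k + 1) := by
  have hG := Real.Gamma_mul_Gamma_add_half (((k : ℝ) + 1) / 2)
  have h2 : 2 * (((k : ℝ) + 1) / 2) = k + 1 := by ring
  have h3 : (2 : ℝ) ^ (1 - ((k : ℝ) + 1)) = (2 ^ k)⁻¹ := by
    rw [show (1 : ℝ) - (k + 1) = -(k : ℝ) by ring, Real.rpow_neg zero_le_two, Real.rpow_natCast]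
  rw [h2, Real.Gamma_nat_eq_factorial, h3] at hG
  have h4 : (((k + 1 : ℕ) : ℝ) + 1) / 2 = ((k : ℝ) + 1) / 2 + 1 / 2 := by push_cast; ring
  have hp : 0 < Real.Gamma (((k : ℝ) + 1) / 2 + 1 / 2) := Real.Gamma_pos_of_pos (by positivity)
  rw [toReal_volume_unitBall, momentConst_eq, h4, Real.Gamma_add_one (by positivity),
    ← h4, mul_pow, ← Real.sq_sqrt Real.pi_pos.le, Real.sqrt_sq (Real.sqrt_nonneg _), h4]
  have hq : 0 < √Real.pi := Real.sqrt_pos.2 Real.pi_pos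
  have hf : (0 : ℝ) < k.factorial := by exact_mod_cast k.factorial_pos
  rw [eq_div_iff_mul_eq hp.ne' |>.2 hG]
  push_cast
  generalize Real.Gamma (((k : ℝ) + 1) / 2 + 1 / 2) = G at *
  generalize √Real.pi = q at *
  field_simp
  ring

theorem momentWeylConst_eq [Nonempty ι] (e : ι → ℕ) :
    momentWeylConst e =
      (volume (Metric.ball (0 : EuclideanSpace ℝ (Fin (∑ i, (e i + 1)))) 1)).toReal /
        (2 * Real.pi) ^ (∑ i, (e i + 1)) *
        ∏ i, (((e i + 1 : ℕ) : ℝ) + 1) *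
          (volume (Metric.ball (0 : EuclideanSpace ℝ (Fin (e i + 1 + 1))) 1)).toReal := by
  obtain ⟨D, hD⟩ : ∃ D, ∑ i, (e i + 1) = D + 1 :=
    Nat.exists_eq_succ_of_ne_zero
      (Finset.sum_pos (fun i _ => Nat.succ_pos _) Finset.univ_nonempty).ne'
  rw [momentWeylConst, mul_div_assoc]
  simp only [momentConst_div_factorial, Finset.prod_div_distrib, Finset.prod_pow_eq_pow_sum]
  rw [hD, Nat.add_sub_cancel, two_div_momentConst_div]
  ring

theorem prodEigen_eq (e m : ι → ℕ) :
    prodEigen e m = ∑ i, (m i : ℝ) * ((m i : ℝ) + ((e i + 1 : ℕ) : ℝ) - 1) +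
      ∑ i, ((e i : ℝ) / 2) ^ 2 := by
  rw [prodEigen, ← Finset.sum_add_distrib]
  refine Finset.sum_congr rfl fun i _ => ?_
  rw [sphereCoord]
  push_cast
  ring

open scoped Classical in
theorem exists_abs_tsum_eigenvalue_count_sub_le (hn : 2 ≤ Fintype.card ι) (e : ι → ℕ) :
    ∃ C > 0, ∀ R : ℝ, 1 ≤ R →
      |(∑' m : ι → ℕ, if ∑ i, (m i : ℝ) * ((m i : ℝ) + ((e i + 1 : ℕ) : ℝ) - 1) ≤ R ^ 2
          then prodMult e m else 0) - momentWeylConst e * R ^ (∑ i, (e i + 1))| ≤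
      C * R ^ (((∑ i, (e i + 1) : ℕ) : ℝ) - 1 -
        ((Fintype.card ι : ℝ) - 1) / ((Fintype.card ι : ℝ) + 1)) := by
  obtain ⟨C, hC, h⟩ := exists_abs_tsum_count_sub_le hn e
  set n := Fintype.card ι with hn'
  set A := momentWeylConst e
  set H := ∑ i, ((e i : ℝ) / 2) ^ 2 with hH
  have hH0 : 0 ≤ H := Finset.sum_nonneg fun i _ => sq_nonneg _
  obtain ⟨m, hm⟩ : ∃ m, ∑ i, (e i + 1) = m + 2 := by
    refine ⟨∑ i, (e i + 1) - 2, ?_⟩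
    have : n ≤ ∑ i, (e i + 1) := by
      rw [Finset.sum_add_distrib]; simp [hn']
    omega
  rw [hm] at h ⊢
  set p : ℝ := ((m + 2 : ℕ) : ℝ) - 1 - ((n : ℝ) - 1) / ((n : ℝ) + 1) with hp
  have hpm : (m : ℝ) ≤ p := by
    have : ((n : ℝ) - 1) / ((n : ℝ) + 1) ≤ 1 := by
      rw [div_le_one (by positivity)]; linarith
    rw [hp]; push_cast; linarith
  have hp0 : 0 ≤ p := le_trans (by positivity) hpm
  refine ⟨C * (1 + H) ^ p + |A| * ((m + 2) * (1 + H) ^ p * H), by positivity, fun L hL => ?_⟩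
  have hL0 : 0 < L := by linarith
  set R := √(L ^ 2 + H) with hR
  have hR2 : R ^ 2 = L ^ 2 + H := Real.sq_sqrt (by positivity)
  have hLR : L ≤ R := Real.le_sqrt_of_sq_le (by linarith)
  have hRL : R ≤ (1 + H) * L := by
    refine Real.sqrt_le_iff.2 ⟨by positivity, ?_⟩
    have h1 : 1 ≤ L ^ 2 := one_le_pow₀ hL
    nlinarith [mul_nonneg hH0 (sub_nonneg.2 h1), mul_nonneg (sq_nonneg H) (sq_nonneg L), mul_nonneg hH0 (sq_nonneg L)]
  have hRp : R ^ p ≤ (1 + H) ^ p * L ^ p := by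
    rw [← Real.mul_rpow (by positivity) hL0.le]
    exact Real.rpow_le_rpow (by positivity) hRL hp0
  have hRm : R ^ m ≤ (1 + H) ^ p * L ^ p := by
    rw [← Real.rpow_natCast]
    exact (Real.rpow_le_rpow_of_exponent_le (hL.trans hLR) hpm).trans hRp
  have hcount := h R (hL.trans hLR)
  simp only [prodEigen_eq, ← hH, hR2, add_le_add_iff_right] at hcount
  have hsub := sub_mul_pow_le hL0.le hLR m
  rw [hR2, add_sub_cancel_left] at hsub
  have hdiff : |A * R ^ (m + 2) - A * L ^ (m + 2)| ≤
      |A| * ((m + 2) * ((1 + H) ^ p * L ^ p) * H) := by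
    rw [← mul_sub, abs_mul,
      abs_of_nonneg (sub_nonneg.2 (pow_le_pow_left₀ hL0.le hLR _))]
    refine mul_le_mul_of_nonneg_left (hsub.trans ?_) (abs_nonneg _)
    exact mul_le_mul_of_nonneg_right (mul_le_mul_of_nonneg_left hRm (by positivity)) hH0
  refine (abs_sub_le _ (A * R ^ (m + 2)) _).trans ((add_le_add hcount hdiff).trans ?_)
  have := mul_le_mul_of_nonneg_left hRp hC.le
  linarith

end

open MeasureTheory
open scoped Classical

/-- Weyl law with power-saving remainder for a product of spheres
`M = S^{d_1} × ⋯ × S^{d_n}` (`n ≥ 2`, `d_i ≥ 1`).  The spectrum of `S^d` is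
`{√(k(k+d−1))}` with multiplicities `C(d+k,d) − C(d+k−2,d)`, and the counting function
of the product satisfies
`N(λ) = (|B_{|d|}|/(2π)^{|d|})·vol(M)·λ^{|d|} + O(λ^{|d|−1−(n−1)/(n+1)})`,
where `vol(M) = ∏ vol(S^{d_i})` and `vol(S^d) = (d+1)·|B_{d+1}|`. -/
theorem weyl_law_product_of_spheres (n : ℕ) (hn : 2 ≤ n) (d : Fin n → ℕ)
    (hd : ∀ i, 1 ≤ d i) :
    ∃ C > 0, ∀ lam : ℝ, 1 ≤ lam →
      |(∑' m : Fin n → ℕ,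
          if (∑ i, (m i : ℝ) * ((m i : ℝ) + (d i : ℝ) - 1)) ≤ lam ^ 2
          then ∏ i, (((d i + m i).choose (d i) : ℝ) - ((d i + m i - 2).choose (d i) : ℝ))
          else 0)
        - (volume (Metric.ball (0 : EuclideanSpace ℝ (Fin (∑ i, d i))) 1)).toReal
            / (2 * Real.pi) ^ (∑ i, d i)
            * (∏ i, (((d i : ℝ) + 1) *
                (volume (Metric.ball (0 : EuclideanSpace ℝ (Fin (d i + 1))) 1)).toReal))
            * lam ^ (((∑ i, d i : ℕ) : ℝ))|
        ≤ C * lam ^ (((∑ i, d i : ℕ) : ℝ) - 1 - ((n : ℝ) - 1) / ((n : ℝ) + 1)) := by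
  obtain ⟨e, rfl⟩ : ∃ e : Fin n → ℕ, d = fun i => e i + 1 :=
    ⟨fun i => d i - 1, funext fun i => (Nat.sub_add_cancel (hd i)).symm⟩
  have : Nonempty (Fin n) := ⟨⟨0, by omega⟩⟩
  obtain ⟨C, hC, h⟩ := exists_abs_tsum_eigenvalue_count_sub_le (by simpa using hn) e
  refine ⟨C, hC, fun lam hlam => ?_⟩
  have := h lam hlam
  rw [momentWeylConst_eq, Fintype.card_fin] at this
  rw [Real.rpow_natCast]
  exact this
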